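/- There exists an absolute constant c > 0 such that for every natural number m ≥ 1 there is a constant C > 0 with the following property: for every finite field F, writing q = |F| and G = Sp_{2m}(F), the number of ordered pairs (x₁, x₂) ∈ G × G such that {x₁, x₂} invariably generates G is at least (c/m − C/q) · |G|². -/

import Mathlib

/-- `{x, y}` invariably generates `G`: for all `g, h`, the conjugates
`g * x * g⁻¹` and `h * y * h⁻¹` generate `G`. -/
def InvGen {G : Type*} [Group G] (x y : G) : Prop :=
  ∀ g h : G, Subgroup.closure {g * x * g⁻¹, h * y * h⁻¹} = ⊤

set_option autoImplicit false
set_option linter.all false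

section P1
variable {F V : Type} [Field F] [AddCommGroup V] [Module F V]

structure Symp (ω : V →ₗ[F] V →ₗ[F] F) : Prop where
  alt : ∀ v, ω v v = 0
  nd : ∀ v, (∀ w, ω v w = 0) → v = 0

def Sp (ω : V →ₗ[F] V →ₗ[F] F) : Subgroup (V ≃ₗ[F] V) where
  carrier := {g | ∀ u v, ω (g u) (g v) = ω u v}
  mul_mem' := by
    intro a b ha hb u v
    simp only [LinearEquiv.mul_apply]
    rw [ha, hb]
  one_mem' := by intro u v; simp
  inv_mem' := by
    intro a ha u v
    have := ha (a⁻¹ u) (a⁻¹ v)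
    rw [← LinearEquiv.mul_apply, ← LinearEquiv.mul_apply] at this
    simpa using this.symm

variable {ω : V →ₗ[F] V →ₗ[F] F}

theorem mem_Sp {g : V ≃ₗ[F] V} : g ∈ Sp ω ↔ ∀ u v, ω (g u) (g v) = ω u v := Iff.rfl

@[simp] theorem le_inv_apply (g : V ≃ₗ[F] V) (x : V) : g (g⁻¹ x) = x := by
  rw [← LinearEquiv.mul_apply]; simp
@[simp] theorem le_inv_apply' (g : V ≃ₗ[F] V) (x : V) : g⁻¹ (g x) = x := by
  rw [← LinearEquiv.mul_apply]; simp

theorem Sp_inv_left {g : V ≃ₗ[F] V} (hg : g ∈ Sp ω) (u v : V) :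
    ω (g⁻¹ u) v = ω u (g v) := by
  have := mem_Sp.1 hg (g⁻¹ u) v; simpa using this.symm
theorem Sp_inv_right {g : V ≃ₗ[F] V} (hg : g ∈ Sp ω) (u v : V) :
    ω u (g⁻¹ v) = ω (g u) v := by
  have := mem_Sp.1 hg u (g⁻¹ v); simpa using this.symm

theorem Symp.neg (h : Symp ω) (u v : V) : ω u v = - ω v u := by
  have := h.alt (u + v)
  simp only [map_add, LinearMap.add_apply, h.alt] at this
  linear_combination this

theorem Symp.nd' (h : Symp ω) {v : V} (hv : v ≠ 0) : ∃ w, ω v w = 1 := by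
  by_contra hc
  push Not at hc
  apply hv
  apply h.nd
  intro w
  by_contra hw
  apply hc ((ω v w)⁻¹ • w)
  simp [hw]

/-- transvection -/
def tvl (ω : V →ₗ[F] V →ₗ[F] F) (v : V) (c : F) : V →ₗ[F] V :=
  LinearMap.id + (c • (ω v)).smulRight v

theorem tvl_apply (v : V) (c : F) (x : V) : tvl ω v c x = x + (c * ω v x) • v := by
  simp [tvl]

def tv (h : Symp ω) (v : V) (c : F) : V ≃ₗ[F] V :=
  LinearEquiv.ofLinear (tvl ω v c) (tvl ω v (-c))
    (by ext x; simp [tvl_apply, h.alt])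
    (by ext x; simp [tvl_apply, h.alt])

theorem tv_apply (h : Symp ω) (v : V) (c : F) (x : V) : tv h v c x = x + (c * ω v x) • v :=
  tvl_apply v c x

theorem tv_mem (h : Symp ω) (v : V) (c : F) : tv h v c ∈ Sp ω := by
  intro x y
  simp only [tv_apply, map_add, map_smul, LinearMap.add_apply, LinearMap.smul_apply, h.alt, smul_eq_mul]
  rw [h.neg x v]; ring

theorem tv_mul (h : Symp ω) (v : V) (c d : F) : tv h v c * tv h v d = tv h v (c + d) := by
  ext x
  simp only [LinearEquiv.mul_apply, tv_apply, map_add, map_smul, h.alt, smul_eq_mul]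
  module

theorem tv_zero (h : Symp ω) (v : V) : tv h v 0 = 1 := by
  ext x; simp [tv_apply]

theorem tv_inv (h : Symp ω) (v : V) (c : F) : (tv h v c)⁻¹ = tv h v (-c) := by
  rw [inv_eq_iff_mul_eq_one, tv_mul]; simp [tv_zero]

theorem tv_conj (h : Symp ω) {g : V ≃ₗ[F] V} (hg : g ∈ Sp ω) (v : V) (c : F) :
    g * tv h v c * g⁻¹ = tv h (g v) c := by
  ext x
  simp only [LinearEquiv.mul_apply, tv_apply, map_add, map_smul, le_inv_apply]
  rw [Sp_inv_right hg]

/-- group generated by transvections along vectors in `K`. -/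
def Tv (h : Symp ω) (K : Submodule F V) : Subgroup (V ≃ₗ[F] V) :=
  Subgroup.closure {g | ∃ v ∈ K, ∃ c, g = tv h v c}

theorem tv_mem_Tv (h : Symp ω) {K : Submodule F V} {v : V} (hv : v ∈ K) (c : F) :
    tv h v c ∈ Tv h K := Subgroup.subset_closure ⟨v, hv, c, rfl⟩

theorem Tv_le (h : Symp ω) (K : Submodule F V) : Tv h K ≤ Sp ω := by
  rw [Tv, Subgroup.closure_le]
  rintro _ ⟨v, _, c, rfl⟩
  exact tv_mem h v c

theorem Tv_mono (h : Symp ω) {K L : Submodule F V} (hKL : K ≤ L) : Tv h K ≤ Tv h L :=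
  Subgroup.closure_mono fun _ ⟨v, hv, c, e⟩ => ⟨v, hKL hv, c, e⟩

theorem Tv_fix (h : Symp ω) {K : Submodule F V} {x : V} (hx : ∀ k ∈ K, ω k x = 0)
    {g : V ≃ₗ[F] V} (hg : g ∈ Tv h K) : g x = x := by
  induction hg using Subgroup.closure_induction with
  | mem g hg => obtain ⟨v, hv, c, rfl⟩ := hg; simp [tv_apply, hx v hv]
  | one => rfl
  | mul a b _ _ ha hb => rw [LinearEquiv.mul_apply, hb, ha]
  | inv a _ ha => conv_lhs => rw [← ha]
                  simp

theorem Tv_stab (h : Symp ω) {K L : Submodule F V} (hKL : K ≤ L)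
    {g : V ≃ₗ[F] V} (hg : g ∈ Tv h K) : ∀ x ∈ L, g x ∈ L := by
  induction hg using Subgroup.closure_induction'' with
  | mem g hg =>
      obtain ⟨v, hv, c, rfl⟩ := hg; intro x hx; rw [tv_apply]
      exact L.add_mem hx (L.smul_mem _ (hKL hv))
  | inv_mem g hg =>
      obtain ⟨v, hv, c, rfl⟩ := hg; intro x hx; rw [tv_inv, tv_apply]
      exact L.add_mem hx (L.smul_mem _ (hKL hv))
  | one => intro x hx; exact hx
  | mul a b _ _ ha hb => intro x hx; rw [LinearEquiv.mul_apply]; exact ha _ (hb _ hx)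

/-- nondegenerate subspace -/
def ND (ω : V →ₗ[F] V →ₗ[F] F) (K : Submodule F V) : Prop :=
  ∀ u ∈ K, u ≠ 0 → ∃ v ∈ K, ω u v ≠ 0

theorem Tv_step (h : Symp ω) {K : Submodule F V} {u v : V} (hu : u ∈ K) (hv : v ∈ K)
    (huv : ω u v ≠ 0) : ∃ g ∈ Tv h K, g u = v ∧ ∀ x, ω (v - u) x = 0 → g x = x := by
  refine ⟨tv h (v - u) ((ω v u)⁻¹), tv_mem_Tv h (K.sub_mem hv hu) _, ?_, ?_⟩
  · have : ω v u ≠ 0 := by rw [h.neg]; simpa using huv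
    simp [tv_apply, h.alt, this]
  · intro x hx; rw [tv_apply, hx]; simp

theorem Tv_trans (h : Symp ω) {K : Submodule F V} (hK : ND ω K) {u v : V} (hu : u ∈ K)
    (hv : v ∈ K) (hu0 : u ≠ 0) (hv0 : v ≠ 0) : ∃ g ∈ Tv h K, g u = v := by
  have : ∃ z ∈ K, ω u z ≠ 0 ∧ ω z v ≠ 0 := by
    obtain ⟨a, ha, hua⟩ := hK u hu hu0
    obtain ⟨b, hb, hvb⟩ := hK v hv hv0
    have hbv : ω b v ≠ 0 := by rw [h.neg]; simpa using hvb
    by_cases h1 : ω a v = 0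
    · by_cases h2 : ω u b = 0
      · refine ⟨a + b, K.add_mem ha hb, ?_, ?_⟩ <;> simp [*]
      · exact ⟨b, hb, h2, hbv⟩
    · exact ⟨a, ha, hua, h1⟩
  obtain ⟨z, hz, h1, h2⟩ := this
  obtain ⟨g1, hg1, e1, -⟩ := Tv_step h hu hz h1
  obtain ⟨g2, hg2, e2, -⟩ := Tv_step h hz hv h2
  exact ⟨g2 * g1, mul_mem hg2 hg1, by rw [LinearEquiv.mul_apply, e1, e2]⟩

theorem Tv_trans2 (h : Symp ω) {K : Submodule F V} {e f f' : V} (he : e ∈ K)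
    (hf : f ∈ K) (hf' : f' ∈ K) (h1 : ω e f = 1) (h2 : ω e f' = 1) :
    ∃ g ∈ Tv h K, g e = e ∧ g f = f' := by
  have key : ∀ a ∈ K, ∀ b ∈ K, ω e a = 1 → ω e b = 1 → ω a b ≠ 0 →
      ∃ g ∈ Tv h K, g e = e ∧ g a = b := by
    intro a ha b hb h1 h2 hab
    obtain ⟨g, hg, e1, e2⟩ := Tv_step h ha hb hab
    refine ⟨g, hg, e2 e ?_, e1⟩
    rw [h.neg, map_sub, h1, h2]; simp
  by_cases hff : ω f f' = 0
  · obtain ⟨g1, m1, a1, b1⟩ := key f hf (f + e) (K.add_mem hf he) h1 (by simp [h1, h.alt])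
      (by simp [h.alt]; rw [h.neg, h1]; simp)
    obtain ⟨g2, m2, a2, b2⟩ := key (f + e) (K.add_mem hf he) f' hf' (by simp [h1, h.alt]) h2
      (by simp [hff, h2])
    exact ⟨g2 * g1, mul_mem m2 m1, by rw [LinearEquiv.mul_apply, a1, a2],
      by rw [LinearEquiv.mul_apply, b1, b2]⟩
  · exact key f hf f' hf' h1 h2 hff

theorem Tv_pair (h : Symp ω) {K : Submodule F V} (hK : ND ω K) {e f e' f' : V} (he : e ∈ K)
    (hf : f ∈ K) (he' : e' ∈ K) (hf' : f' ∈ K) (h1 : ω e f = 1) (h2 : ω e' f' = 1) :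
    ∃ g ∈ Tv h K, g e = e' ∧ g f = f' := by
  obtain ⟨g1, m1, a1⟩ := Tv_trans h hK he he' (by rintro rfl; simp at h1) (by rintro rfl; simp at h2)
  have hg1f : g1 f ∈ K := Tv_stab h le_rfl m1 _ hf
  obtain ⟨g2, m2, a2, b2⟩ := Tv_trans2 h (e := e') (f := g1 f) (f' := f') he' hg1f hf'
    (by rw [← a1, mem_Sp.1 (Tv_le h K m1), h1]) h2
  exact ⟨g2 * g1, mul_mem m2 m1, by rw [LinearEquiv.mul_apply, a1, a2],
    by rw [LinearEquiv.mul_apply, b2]⟩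

/-- hyperbolic family of length `r` -/
structure Hyp (ω : V →ₗ[F] V →ₗ[F] F) (r : ℕ) (e f : ℕ → V) : Prop where
  ef : ∀ i < r, ∀ j < r, ω (e i) (f j) = if i = j then 1 else 0
  ee : ∀ i < r, ∀ j < r, ω (e i) (e j) = 0
  ff : ∀ i < r, ∀ j < r, ω (f i) (f j) = 0

/-- the common perp of a hyperbolic family -/
def hperp (ω : V →ₗ[F] V →ₗ[F] F) (r : ℕ) (e f : ℕ → V) : Submodule F V where
  carrier := {v | ∀ i < r, ω (e i) v = 0 ∧ ω (f i) v = 0}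
  add_mem' := by intro a b ha hb i hi; simp [ha i hi, hb i hi]
  zero_mem' := by intro i hi; simp
  smul_mem' := by intro c a ha i hi; simp [ha i hi]

theorem mem_hperp {r : ℕ} {e f : ℕ → V} {v : V} :
    v ∈ hperp ω r e f ↔ ∀ i < r, ω (e i) v = 0 ∧ ω (f i) v = 0 := Iff.rfl

/-- projection to the span of family -/
def hproj (ω : V →ₗ[F] V →ₗ[F] F) (r : ℕ) (e f : ℕ → V) (v : V) : V :=
  ∑ i ∈ Finset.range r, (ω v (f i) • e i + ω (e i) v • f i)

theorem sub_hproj_mem (h : Symp ω) {r : ℕ} {e f : ℕ → V} (H : Hyp ω r e f) (v : V) :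
    v - hproj ω r e f v ∈ hperp ω r e f := by
  intro i hi
  have hfe : ∀ j < r, ω (f i) (e j) = if i = j then -1 else 0 := by
    intro j hj; rw [h.neg, H.ef j hj i hi]; by_cases hij : i = j <;> simp [hij, eq_comm]
  constructor
  · rw [map_sub, hproj, map_sum, Finset.sum_congr rfl (g := fun j => if i = j then ω (e i) v else 0)]
    · simp [hi]
    · intro j hj
      have hj := Finset.mem_range.1 hj
      by_cases hij : i = j
      · subst hij; simp [H.ee i hi i hi, H.ef i hi i hi]
      · simp [H.ee i hi j hj, H.ef i hi j hj, hij]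
  · rw [map_sub, hproj, map_sum, Finset.sum_congr rfl (g := fun j => if i = j then ω (f i) v else 0)]
    · simp [hi]
    · intro j hj
      have hj := Finset.mem_range.1 hj
      by_cases hij : i = j
      · subst hij; simp [H.ff i hi i hi, hfe i hi]; rw [h.neg]; simp
      · simp [H.ff i hi j hj, hfe j hj, hij]

theorem hperp_ND (h : Symp ω) {r : ℕ} {e f : ℕ → V} (H : Hyp ω r e f) : ND ω (hperp ω r e f) := by
  intro u hu hu0
  obtain ⟨w, hw⟩ := h.nd' hu0
  refine ⟨w - hproj ω r e f w, sub_hproj_mem h H w, ?_⟩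
  rw [map_sub, hproj, map_sum, Finset.sum_eq_zero, hw]
  · simp
  · intro i hi
    have hi := Finset.mem_range.1 hi
    simp only [map_add, map_smul]
    rw [h.neg u (e i), h.neg u (f i), (hu i hi).1, (hu i hi).2]; simp

theorem Hyp.mono {r s : ℕ} {e f : ℕ → V} (H : Hyp ω r e f) (hs : s ≤ r) : Hyp ω s e f :=
  ⟨fun i hi j hj => H.ef i (by omega) j (by omega), fun i hi j hj => H.ee i (by omega) j (by omega),
   fun i hi j hj => H.ff i (by omega) j (by omega)⟩

theorem Hyp.last_mem (h : Symp ω) {r : ℕ} {e f : ℕ → V} (H : Hyp ω (r+1) e f) :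
    e r ∈ hperp ω r e f ∧ f r ∈ hperp ω r e f := by
  constructor <;> intro i hi <;> constructor
  · exact H.ee i (by omega) r (by omega)
  · rw [h.neg, H.ef r (by omega) i (by omega), if_neg (by omega)]; simp
  · rw [H.ef i (by omega) r (by omega), if_neg (by omega)]
  · exact H.ff i (by omega) r (by omega)

theorem Hyp.trans (h : Symp ω) {r : ℕ} {e f e' f' : ℕ → V} (H : Hyp ω r e f) (H' : Hyp ω r e' f') :
    ∃ g ∈ Tv h ⊤, ∀ i < r, g (e i) = e' i ∧ g (f i) = f' i := by
  induction r with
  | zero => exact ⟨1, one_mem _, by simp⟩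
  | succ r ih =>
    obtain ⟨g, hg, hi⟩ := ih (H.mono (by omega)) (H'.mono (by omega))
    have hgS := mem_Sp.1 (Tv_le h _ hg)
    have L := H.last_mem h
    have L' := H'.last_mem h
    have hm : ∀ x ∈ hperp ω r e f, g x ∈ hperp ω r e' f' := by
      intro x hx i hir
      rw [← (hi i hir).1, ← (hi i hir).2, hgS, hgS]; exact hx i hir
    obtain ⟨k, hk, k1, k2⟩ := Tv_pair h (hperp_ND h (H'.mono (Nat.le_succ r))) (hm _ L.1) (hm _ L.2)
      L'.1 L'.2 (by rw [hgS, H.ef r (by omega) r (by omega)]; simp)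
      (by rw [H'.ef r (by omega) r (by omega)]; simp)
    refine ⟨k * g, mul_mem (Tv_mono h le_top hk) hg, ?_⟩
    intro i hir
    rcases Nat.lt_succ_iff_lt_or_eq.1 hir with h1 | rfl
    · rw [LinearEquiv.mul_apply, LinearEquiv.mul_apply, (hi i h1).1, (hi i h1).2]
      constructor
      · exact Tv_fix h (fun y hy => by rw [h.neg, (hy i h1).1, neg_zero]) hk
      · exact Tv_fix h (fun y hy => by rw [h.neg, (hy i h1).2, neg_zero]) hk
    · exact ⟨k1, k2⟩

theorem Hyp.extend (h : Symp ω) {r : ℕ} {e f : ℕ → V} (H : Hyp ω r e f) {a b : V}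
    (ha : a ∈ hperp ω r e f) (hb : b ∈ hperp ω r e f) (hab : ω a b = 1) :
    Hyp ω (r+1) (Function.update e r a) (Function.update f r b) := by
  have main : ∀ i < r + 1, (i < r ∨ i = r) := by intro i hi; omega
  refine ⟨fun i hi j hj => ?_, fun i hi j hj => ?_, fun i hi j hj => ?_⟩ <;>
  rcases main i hi with h1 | rfl <;> rcases main j hj with h2 | h2
  · rw [Function.update_of_ne (by omega), Function.update_of_ne (by omega), H.ef i h1 j h2]
  · subst h2; rw [Function.update_of_ne (by omega), Function.update_self, (hb i h1).1, if_neg (by omega)]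
  · rw [Function.update_self, Function.update_of_ne (by omega), h.neg, (ha j h2).2, if_neg (by omega)]; simp
  · subst h2; simp [hab]
  · rw [Function.update_of_ne (by omega), Function.update_of_ne (by omega), H.ee i h1 j h2]
  · subst h2; rw [Function.update_of_ne (by omega), Function.update_self, (ha i h1).1]
  · rw [Function.update_self, Function.update_of_ne (by omega), h.neg, (ha j h2).1]; simp
  · subst h2; simp [h.alt]
  · rw [Function.update_of_ne (by omega), Function.update_of_ne (by omega), H.ff i h1 j h2]
  · subst h2; rw [Function.update_of_ne (by omega), Function.update_self, (hb i h1).2]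
  · rw [Function.update_self, Function.update_of_ne (by omega), h.neg, (hb j h2).2]; simp
  · subst h2; simp [h.alt]

def hfam (r : ℕ) (e f : ℕ → V) : Fin r ⊕ Fin r → V := Sum.elim (fun i => e i) (fun i => f i)

theorem Hyp.fe (h : Symp ω) {r : ℕ} {e f : ℕ → V} (H : Hyp ω r e f) :
    ∀ i < r, ∀ j < r, ω (f i) (e j) = if i = j then -1 else 0 := by
  intro i hi j hj; rw [h.neg, H.ef j hj i hi]; by_cases hij : i = j <;> simp [hij, eq_comm]

theorem Hyp.li (h : Symp ω) {r : ℕ} {e f : ℕ → V} (H : Hyp ω r e f) :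
    LinearIndependent F (hfam r e f) := by
  rw [Fintype.linearIndependent_iff]
  intro c hc
  simp only [Fintype.sum_sum_type, hfam, Sum.elim_inl, Sum.elim_inr] at hc
  rintro (i | i)
  · have := congrArg (ω (f i)) hc
    simp only [map_add, map_sum, map_smul, map_zero] at this
    rw [Finset.sum_congr rfl (g := fun j : Fin r => if i = j then - c (.inl j) else 0)
      (fun j _ => by rw [H.fe h i i.2 j j.2]; by_cases hij : i = j <;> simp [hij, Fin.val_inj]),
      Finset.sum_congr (f := fun x => c (.inr x) • _) rfl (g := fun j : Fin r => (0:F))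
      (fun j _ => by rw [H.ff i i.2 j j.2]; simp)] at this
    simpa using this
  · have := congrArg (ω (e i)) hc
    simp only [map_add, map_sum, map_smul, map_zero] at this
    rw [Finset.sum_congr (f := fun x => c (.inl x) • _) rfl (g := fun j : Fin r => (0:F))
      (fun j _ => by rw [H.ee i i.2 j j.2]; simp),
      Finset.sum_congr (f := fun x => c (.inr x) • _) rfl (g := fun j : Fin r => if i = j then c (.inr j) else 0)
      (fun j _ => by rw [H.ef i i.2 j j.2]; by_cases hij : i = j <;> simp [hij, Fin.val_inj])] at this
    simpa using this

theorem hproj_mem_span (r : ℕ) (e f : ℕ → V) (v : V) :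
    hproj ω r e f v ∈ Submodule.span F (Set.range (hfam r e f)) := by
  rw [hproj]
  refine Submodule.sum_mem _ fun i hi => ?_
  have hi := Finset.mem_range.1 hi
  exact Submodule.add_mem _ (Submodule.smul_mem _ _ (Submodule.subset_span ⟨.inl ⟨i, hi⟩, rfl⟩))
    (Submodule.smul_mem _ _ (Submodule.subset_span ⟨.inr ⟨i, hi⟩, rfl⟩))

theorem Hyp.exists_ext [FiniteDimensional F V] (h : Symp ω) {m : ℕ} (hm : Module.finrank F V = 2 * m)
    {r : ℕ} {e f : ℕ → V}
    (H : Hyp ω r e f) (hr : r < m) : ∃ a b, a ∈ hperp ω r e f ∧ b ∈ hperp ω r e f ∧ ω a b = 1 := by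
  have : ∃ a ∈ hperp ω r e f, a ≠ 0 := by
    by_contra hc
    push Not at hc
    have hspan : ⊤ ≤ Submodule.span F (Set.range (hfam r e f)) := by
      intro v _
      rw [sub_eq_zero.1 (hc _ (sub_hproj_mem h H v))]
      exact hproj_mem_span (ω := ω) r e f v
    have := finrank_range_le_card (R := F) (hfam r e f)
    rw [Set.finrank, top_le_iff.1 hspan, finrank_top, hm] at this
    simp at this; omega
  obtain ⟨a, ha, ha0⟩ := this
  obtain ⟨b, hb, hab⟩ := hperp_ND h H a ha ha0
  exact ⟨a, (ω a b)⁻¹ • b, ha, Submodule.smul_mem _ _ hb, by simp [hab]⟩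

theorem Hyp.complete [FiniteDimensional F V] (h : Symp ω) {m : ℕ} (hm : Module.finrank F V = 2 * m)
    {r : ℕ} {e f : ℕ → V}
    (H : Hyp ω r e f) (s : ℕ) (hr : r ≤ s) (hs : s ≤ m) :
    ∃ e' f', Hyp ω s e' f' ∧ ∀ i < r, e' i = e i ∧ f' i = f i := by
  obtain ⟨d, rfl⟩ := Nat.exists_eq_add_of_le hr
  clear hr
  induction d with
  | zero => exact ⟨e, f, H, by simp⟩
  | succ d ih =>
    obtain ⟨e', f', H', hi⟩ := ih (by omega)
    obtain ⟨a, b, ha, hb, hab⟩ := H'.exists_ext h hm (by omega)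
    refine ⟨_, _, H'.extend h ha hb hab, fun i hi' => ?_⟩
    rw [Function.update_of_ne (by omega), Function.update_of_ne (by omega)]
    exact hi i hi'

theorem Hyp.zero : Hyp ω 0 (fun _ => 0) (fun _ => 0) := ⟨by simp, by simp, by simp⟩

theorem Symp.exists_hyp [FiniteDimensional F V] (h : Symp ω) {m : ℕ}
    (hm : Module.finrank F V = 2 * m) : ∃ e f, Hyp ω m e f := by
  obtain ⟨e, f, H, -⟩ := Hyp.zero.complete h hm m (by omega) le_rfl
  exact ⟨e, f, H⟩

theorem Hyp.hperp_bot [FiniteDimensional F V] (h : Symp ω) {m : ℕ}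
    (hm : Module.finrank F V = 2 * m) {e f : ℕ → V} (H : Hyp ω m e f) {v : V}
    (hv : v ∈ hperp ω m e f) : v = 0 := by
  by_contra hv0
  obtain ⟨b, hb, hab⟩ := hperp_ND h H v hv hv0
  have := (H.extend h hv (Submodule.smul_mem _ (ω v b)⁻¹ hb) (by simp [hab])).li h
  have := this.fintype_card_le_finrank
  simp at this; omega

theorem Hyp.expand [FiniteDimensional F V] (h : Symp ω) {m : ℕ}
    (hm : Module.finrank F V = 2 * m) {e f : ℕ → V} (H : Hyp ω m e f) (v : V) :
    v = hproj ω m e f v :=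
  sub_eq_zero.1 (H.hperp_bot h hm (sub_hproj_mem h H v))

theorem Hyp.ext_eq [FiniteDimensional F V] (h : Symp ω) {m : ℕ}
    (hm : Module.finrank F V = 2 * m) {e f : ℕ → V} (H : Hyp ω m e f) {g k : V ≃ₗ[F] V}
    (hgk : ∀ i < m, g (e i) = k (e i) ∧ g (f i) = k (f i)) : g = k := by
  ext v
  rw [H.expand h hm v, hproj, map_sum, map_sum]
  refine Finset.sum_congr rfl fun i hi => ?_
  have hi := Finset.mem_range.1 hi
  simp [hgk i hi]

theorem Hyp.map {r : ℕ} {e f : ℕ → V} (H : Hyp ω r e f) {g : V ≃ₗ[F] V} (hg : g ∈ Sp ω) :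
    Hyp ω r (fun i => g (e i)) (fun i => g (f i)) := by
  refine ⟨fun i hi j hj => ?_, fun i hi j hj => ?_, fun i hi j hj => ?_⟩ <;>
  rw [mem_Sp.1 hg]
  exacts [H.ef i hi j hj, H.ee i hi j hj, H.ff i hi j hj]

theorem Sp_le_Tv [FiniteDimensional F V] (h : Symp ω) {m : ℕ}
    (hm : Module.finrank F V = 2 * m) : Sp ω ≤ Tv h ⊤ := by
  intro g hg
  obtain ⟨e, f, H⟩ := h.exists_hyp hm
  obtain ⟨k, hk, hi⟩ := H.trans h (H.map hg)
  rwa [← H.ext_eq h hm hi]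

theorem ND_top (h : Symp ω) : ND ω (⊤ : Submodule F V) := by
  intro u _ hu
  obtain ⟨w, hw⟩ := h.nd' hu
  exact ⟨w, trivial, by simp [hw]⟩

theorem Hyp.li_basis [FiniteDimensional F V] (h : Symp ω) {m : ℕ}
    (hm : Module.finrank F V = 2 * m) {e f : ℕ → V} (H : Hyp ω m e f) :
    ∃ b : Module.Basis (Fin m ⊕ Fin m) F V, ∀ i, b i = hfam m e f i := by
  have hs : ⊤ ≤ Submodule.span F (Set.range (hfam m e f)) := by
    intro v _
    rw [H.expand h hm v]; exact hproj_mem_span (ω := ω) m e f v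
  exact ⟨Module.Basis.mk (H.li h) hs, fun i => Module.Basis.mk_apply (H.li h) hs i⟩

theorem isometry {V' : Type} [AddCommGroup V'] [Module F V'] {ω' : V' →ₗ[F] V' →ₗ[F] F}
    [FiniteDimensional F V] [FiniteDimensional F V'] (h : Symp ω) (h' : Symp ω') {m : ℕ}
    (hm : Module.finrank F V = 2 * m) (hm' : Module.finrank F V' = 2 * m) :
    ∃ φ : V ≃ₗ[F] V', ∀ u v, ω' (φ u) (φ v) = ω u v := by
  obtain ⟨e, f, H⟩ := h.exists_hyp hm
  obtain ⟨e', f', H'⟩ := h'.exists_hyp hm'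
  obtain ⟨b, hb⟩ := H.li_basis h hm
  obtain ⟨b', hb'⟩ := H'.li_basis h' hm'
  refine ⟨b.equiv b' (Equiv.refl _), ?_⟩
  have : (ω'.compl₁₂ (b.equiv b' (Equiv.refl _)).toLinearMap (b.equiv b' (Equiv.refl _)).toLinearMap) = ω := by
    refine LinearMap.ext_basis b b ?_
    intro i j
    simp only [LinearMap.compl₁₂_apply, LinearEquiv.coe_coe, Module.Basis.equiv_apply, Equiv.refl_apply]
    rw [hb, hb, hb', hb']
    rcases i with i | i <;> rcases j with j | j <;> simp only [hfam, Sum.elim_inl, Sum.elim_inr]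
    · rw [H.ee i i.2 j j.2, H'.ee i i.2 j j.2]
    · rw [H.ef i i.2 j j.2, H'.ef i i.2 j j.2]
    · rw [H.fe h i i.2 j j.2, H'.fe h' i i.2 j j.2]
    · rw [H.ff i i.2 j j.2, H'.ff i i.2 j j.2]
  intro u v
  rw [← this]; rfl

def Sp_congr {V' : Type} [AddCommGroup V'] [Module F V'] {ω' : V' →ₗ[F] V' →ₗ[F] F}
    (φ : V ≃ₗ[F] V') (hφ : ∀ u v, ω' (φ u) (φ v) = ω u v) : Sp ω ≃* Sp ω' where
  toFun g := ⟨φ.symm.trans (g.1.trans φ), by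
    intro u v
    simp only [LinearEquiv.trans_apply, hφ]
    rw [mem_Sp.1 g.2, ← hφ]; simp⟩
  invFun g := ⟨φ.trans (g.1.trans φ.symm), by
    intro u v
    simp only [LinearEquiv.trans_apply]
    rw [← hφ]; simp only [LinearEquiv.apply_symm_apply]
    rw [mem_Sp.1 g.2, hφ]⟩
  left_inv g := by ext x; simp
  right_inv g := by ext x; simp
  map_mul' a b := by ext x; simp

/-- standard form -/
noncomputable def stdω (F : Type) [Field F] (m : ℕ) : (Fin m ⊕ Fin m → F) →ₗ[F] (Fin m ⊕ Fin m → F) →ₗ[F] F :=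
  Matrix.toLinearMap₂' F (Matrix.J (Fin m) F)

theorem stdω_apply (m : ℕ) (u v : Fin m ⊕ Fin m → F) :
    stdω F m u v = u ⬝ᵥ (Matrix.J (Fin m) F).mulVec v := by
  simp [stdω, Matrix.toLinearMap₂'_apply']

theorem stdω_symp (m : ℕ) : Symp (stdω F m) := by
  constructor
  · intro v
    rw [stdω_apply]
    simp [Matrix.J, Matrix.mulVec, dotProduct, Fintype.sum_sum_type, Matrix.fromBlocks_apply₁₁, Matrix.one_apply]
    simp [mul_comm]
  · intro v hv
    have : Matrix.vecMul v (Matrix.J (Fin m) F) = 0 := by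
      funext i
      have := hv (Pi.single i 1)
      rw [stdω_apply, Matrix.dotProduct_mulVec] at this
      simpa using this
    have h2 := congrArg (fun w => Matrix.vecMul w (Matrix.J (Fin m) F)) this
    simp only [Matrix.vecMul_vecMul, Matrix.J_squared, Matrix.zero_vecMul] at h2
    simpa [Matrix.vecMul_neg] using h2

noncomputable def symLin {m : ℕ} (A : Matrix.symplecticGroup (Fin m) F) :
    (Fin m ⊕ Fin m → F) ≃ₗ[F] (Fin m ⊕ Fin m → F) :=
  LinearEquiv.ofLinear (Matrix.toLin' A.1) (Matrix.toLin' (A⁻¹).1)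
    (by rw [← Matrix.toLin'_mul, ← Submonoid.coe_mul]; simp)
    (by rw [← Matrix.toLin'_mul, ← Submonoid.coe_mul]; simp)

theorem symLin_apply {m : ℕ} (A : Matrix.symplecticGroup (Fin m) F) (w : Fin m ⊕ Fin m → F) :
    symLin A w = A.1.mulVec w := Matrix.toLin'_apply A.1 w

noncomputable def stdSp (F : Type) [Field F] (m : ℕ) : Matrix.symplecticGroup (Fin m) F ≃* Sp (stdω F m) where
  toFun A := ⟨symLin A, by
    intro u v
    have h2 := SymplecticGroup.mem_iff'.1 A.2
    rw [symLin_apply, symLin_apply, stdω_apply, stdω_apply]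
    conv_rhs => rw [← h2]
    rw [← Matrix.mulVec_mulVec, ← Matrix.mulVec_mulVec, Matrix.dotProduct_mulVec u, Matrix.vecMul_transpose]⟩
  invFun g := ⟨LinearMap.toMatrix' g.1.toLinearMap, by
    rw [SymplecticGroup.mem_iff']
    ext i j
    have := mem_Sp.1 g.2 (Pi.single i 1) (Pi.single j 1)
    rw [stdω_apply, stdω_apply] at this
    have e : ∀ w, g.1 w = (LinearMap.toMatrix' g.1.toLinearMap).mulVec w := by
      intro w; rw [LinearMap.toMatrix'_mulVec]; rfl
    rw [e, e, ← Matrix.vecMul_transpose, ← Matrix.dotProduct_mulVec, Matrix.mulVec_mulVec, Matrix.mulVec_mulVec] at this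
    simpa [← Matrix.mul_assoc] using this⟩
  left_inv A := by
    apply Subtype.ext
    exact LinearMap.toMatrix'_toLin' A.1
  right_inv g := by
    apply Subtype.ext
    ext1 w
    exact congrFun (congrArg DFunLike.coe (Matrix.toLin'_toMatrix' g.1.toLinearMap)) w
  map_mul' A B := by
    apply Subtype.ext
    ext1 w
    change symLin (A * B) w = symLin A (symLin B w)
    rw [symLin_apply, symLin_apply, symLin_apply, Matrix.mulVec_mulVec]; rfl

/-- all models of the symplectic group -/
theorem Sp_model (m : ℕ) [FiniteDimensional F V] (h : Symp ω) (hm : Module.finrank F V = 2 * m) :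
    Nonempty (Matrix.symplecticGroup (Fin m) F ≃* Sp ω) := by
  obtain ⟨φ, hφ⟩ := isometry (stdω_symp m) h (m := m) (by simp; ring) hm
  exact ⟨(stdSp F m).trans (Sp_congr φ hφ)⟩
end P1

section P2
open Classical Pointwise

section gen
variable {E : Type} [Group E] [Fintype E]

/-- fibre counting -/
theorem fib {Ω : Type} [MulAction E Ω] (St : Subgroup E) (D : Finset Ω) (x : Ω)
    (hD : ∀ g ∈ St, g • x ∈ D) (ht : ∀ y ∈ D, ∃ k ∈ St, k • x = y) {y : Ω} (hy : y ∈ D) :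
    (Finset.univ.filter (fun g : E => g ∈ St ∧ g • x = y)).card * D.card =
      (Finset.univ.filter (fun g : E => g ∈ St)).card := by
  have key : ∀ z ∈ D, (Finset.univ.filter (fun g : E => g ∈ St ∧ g • x = z)).card =
      (Finset.univ.filter (fun g : E => g ∈ St ∧ g • x = y)).card := by
    intro z hz
    obtain ⟨k, hk, rfl⟩ := ht y hy
    obtain ⟨l, hl, rfl⟩ := ht z hz
    refine Finset.card_bij' (fun g _ => k * l⁻¹ * g) (fun g _ => l * k⁻¹ * g) ?_ ?_ ?_ ?_
    · intro g hg
      simp only [Finset.mem_filter, Finset.mem_univ, true_and] at hg ⊢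
      exact ⟨mul_mem (mul_mem hk (inv_mem hl)) hg.1, by rw [mul_smul, hg.2, mul_smul, inv_smul_smul]⟩
    · intro g hg
      simp only [Finset.mem_filter, Finset.mem_univ, true_and] at hg ⊢
      exact ⟨mul_mem (mul_mem hl (inv_mem hk)) hg.1, by rw [mul_smul, hg.2, mul_smul, inv_smul_smul]⟩
    · intro g _; group
    · intro g _; group
  rw [Finset.card_eq_sum_card_fiberwise (f := fun g : E => g • x) (t := D)
    (s := Finset.univ.filter (fun g : E => g ∈ St))]
  · rw [Finset.sum_congr rfl (g := fun _ => (Finset.univ.filter (fun g : E => g ∈ St ∧ g • x = y)).card)]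
    · simp [mul_comm]
    · intro z hz
      rw [← key z hz, Finset.filter_filter]
  · intro g hg
    exact hD g (by simpa using hg)

/-- averaging -/
theorem avg {Λ : Type} (St : Subgroup E) (L : Finset Λ) (τ : Λ → E) (hτ : ∀ l ∈ L, τ l ∈ St)
    (P : E → Λ → Prop) (k : ℝ)
    (hk : ∀ g ∈ St, ((L.filter (fun l => P (g * τ l) l)).card : ℝ) ≤ k) :
    (∑ l ∈ L, ((Finset.univ.filter (fun g : E => g ∈ St ∧ P g l)).card : ℝ)) ≤
      k * (Finset.univ.filter (fun g : E => g ∈ St)).card := by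
  have h1 : ∀ l ∈ L, (Finset.univ.filter (fun g : E => g ∈ St ∧ P g l)).card =
      (Finset.univ.filter (fun g : E => g ∈ St ∧ P (g * τ l) l)).card := by
    intro l hl
    refine Finset.card_bij' (fun g _ => g * (τ l)⁻¹) (fun g _ => g * τ l) ?_ ?_ ?_ ?_
    · intro g hg
      simp only [Finset.mem_filter, Finset.mem_univ, true_and] at hg ⊢
      exact ⟨mul_mem hg.1 (inv_mem (hτ l hl)), by simpa using hg.2⟩
    · intro g hg
      simp only [Finset.mem_filter, Finset.mem_univ, true_and] at hg ⊢
      exact ⟨mul_mem hg.1 (hτ l hl), hg.2⟩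
    · intro g _; group
    · intro g _; group
  rw [Finset.sum_congr rfl (fun l hl => by rw [h1 l hl])]
  have h2 : ∀ l, (Finset.univ.filter (fun g : E => g ∈ St ∧ P (g * τ l) l)) =
     (Finset.univ.filter (fun g : E => g ∈ St)).filter (fun g => P (g * τ l) l) := by
    intro l; rw [Finset.filter_filter]
  have h3 := Finset.sum_card_bipartiteAbove_eq_sum_card_bipartiteBelow
    (s := L) (t := Finset.univ.filter (fun g : E => g ∈ St)) (fun l g => P (g * τ l) l)
  simp only [Finset.bipartiteAbove, Finset.bipartiteBelow] at h3
  simp only [h2]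
  rw [← Nat.cast_sum, h3, Nat.cast_sum]
  calc _ ≤ ∑ g ∈ Finset.univ.filter (fun g : E => g ∈ St), k :=
        Finset.sum_le_sum fun g hg => hk g (by simpa using hg)
    _ = _ := by simp [mul_comm]

theorem avg' {Λ : Type} (St : Subgroup E) (L : Finset Λ) (τ : Λ → E) (hτ : ∀ l ∈ L, τ l ∈ St)
    (P : E → Prop) (k : ℝ)
    (hk : ∀ g ∈ St, ((L.filter (fun l => P (g * τ l))).card : ℝ) ≤ k) :
    ((Finset.univ.filter (fun g : E => g ∈ St ∧ P g)).card : ℝ) * L.card ≤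
      k * (Finset.univ.filter (fun g : E => g ∈ St)).card := by
  have := avg St L τ hτ (fun g _ => P g) k hk
  simpa [mul_comm] using this
end gen

variable {F V : Type} [Field F] [AddCommGroup V] [Module F V] [Fintype F] [Fintype V]
  [Fintype (V ≃ₗ[F] V)] {ω : V →ₗ[F] V →ₗ[F] F}

noncomputable abbrev cG (St : Subgroup (V ≃ₗ[F] V)) : ℕ := (Finset.univ.filter (fun g => g ∈ St)).card
noncomputable abbrev cP (St : Subgroup (V ≃ₗ[F] V)) (P : (V ≃ₗ[F] V) → Prop) : ℕ :=
  (Finset.univ.filter (fun g => g ∈ St ∧ P g)).card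

theorem cP_mono {St : Subgroup (V ≃ₗ[F] V)} {P Q : (V ≃ₗ[F] V) → Prop}
    (h : ∀ g ∈ St, P g → Q g) : cP St P ≤ cP St Q := by
  apply Finset.card_le_card
  intro g hg
  simp only [Finset.mem_filter, Finset.mem_univ, true_and] at hg ⊢
  exact ⟨hg.1, h g hg.1 hg.2⟩

theorem cP_or {St : Subgroup (V ≃ₗ[F] V)} {P Q : (V ≃ₗ[F] V) → Prop} :
    cP St (fun g => P g ∨ Q g) ≤ cP St P + cP St Q := by
  refine le_trans (Finset.card_le_card ?_) (Finset.card_union_le _ _)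
  intro g hg
  simp only [Finset.mem_filter, Finset.mem_univ, true_and, Finset.mem_union] at hg ⊢
  tauto

theorem cP_not {St : Subgroup (V ≃ₗ[F] V)} {P : (V ≃ₗ[F] V) → Prop} :
    cP St P + cP St (fun g => ¬ P g) = cG St := by
  rw [cG, cP, cP, ← Finset.card_filter_add_card_filter_not (s := Finset.univ.filter (fun g => g ∈ St)) P,
    Finset.filter_filter, Finset.filter_filter]
  congr!

/-- `St` acts on `U` and contains transvections along `U`. -/
structure Act (h : Symp ω) (St : Subgroup (V ≃ₗ[F] V)) (U : Submodule F V) : Prop where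
  sp : St ≤ Sp ω
  tr : ∀ v ∈ U, ∀ c, tv h v c ∈ St
  pr : ∀ g ∈ St, ∀ v ∈ U, g v ∈ U
  nd : ND ω U

theorem Act.trans {h : Symp ω} {St : Subgroup (V ≃ₗ[F] V)} {U : Submodule F V} (A : Act h St U)
    {x y : V} (hx : x ∈ U) (hy : y ∈ U) (hx0 : x ≠ 0) (hy0 : y ≠ 0) : ∃ k ∈ St, k x = y := by
  obtain ⟨g, hg, e⟩ := Tv_trans h A.nd hx hy hx0 hy0
  refine ⟨g, ?_, e⟩
  have : Tv h U ≤ St := by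
    rw [Tv, Subgroup.closure_le]; rintro _ ⟨v, hv, c, rfl⟩; exact A.tr v hv c
  exact this hg

noncomputable def nzU (U : Submodule F V) : Finset V := Finset.univ.filter (fun v => v ∈ U ∧ v ≠ 0)
@[simp] theorem mem_nzU {U : Submodule F V} {v : V} : v ∈ nzU U ↔ v ∈ U ∧ v ≠ 0 := by simp [nzU]

theorem Act.fib {h : Symp ω} {St : Subgroup (V ≃ₗ[F] V)} {U : Submodule F V} (A : Act h St U)
    {x y : V} (hx : x ∈ U) (hy : y ∈ U) (hx0 : x ≠ 0) (hy0 : y ≠ 0) :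
    cP St (fun g => g x = y) * (nzU U).card = cG St := by
  refine _root_.fib (E := V ≃ₗ[F] V) St (nzU U) x ?_ ?_ (mem_nzU.2 ⟨hy, hy0⟩)
  · intro g hg; exact mem_nzU.2 ⟨A.pr g hg x hx, by simpa using hx0⟩
  · intro z hz; rw [mem_nzU] at hz; exact A.trans hx hz.1 hx0 hz.2

/-- probability that `a` is an eigenvalue on U -/
theorem Act.eig {h : Symp ω} {St : Subgroup (V ≃ₗ[F] V)} {U : Submodule F V} (A : Act h St U)
    {a : F} (ha : a ≠ 0) :
    cP St (fun g => ∃ x ∈ U, x ≠ 0 ∧ g x = a • x) * (Fintype.card F - 1) ≤ cG St := by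
  have h1 : (∑ g ∈ Finset.univ.filter (fun g => g ∈ St), ((nzU U).filter (fun x => g x = a • x)).card) ≤ cG St := by
    have h3 := Finset.sum_card_bipartiteAbove_eq_sum_card_bipartiteBelow
      (s := Finset.univ.filter (fun g => g ∈ St)) (t := nzU U) (fun (g : V ≃ₗ[F] V) x => g x = a • x)
    simp only [Finset.bipartiteAbove, Finset.bipartiteBelow, Finset.filter_filter] at h3
    rw [h3]
    rcases (nzU U).eq_empty_or_nonempty with h0 | h0
    · simp [h0]
    · have hc : 0 < (nzU U).card := Finset.card_pos.2 h0
      apply le_of_mul_le_mul_right _ hc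
      rw [Finset.sum_mul]
      rw [Finset.sum_congr rfl (g := fun _ => cG St)]
      · simp [mul_comm]
      · intro x hx
        rw [mem_nzU] at hx
        exact A.fib hx.1 (U.smul_mem a hx.1) hx.2 (smul_ne_zero ha hx.2)
  refine le_trans ?_ h1
  have h4 : ∀ g ∈ Finset.univ.filter (fun g => g ∈ St ∧ ∃ x ∈ U, x ≠ 0 ∧ g x = a • x),
      Fintype.card F - 1 ≤ ((nzU U).filter (fun x => g x = a • x)).card := by
    intro g hg
    simp only [Finset.mem_filter, Finset.mem_univ, true_and] at hg
    obtain ⟨hg, x, hx, hx0, e⟩ := hg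
    have : (Finset.univ.filter (fun c : F => c ≠ 0)).card = Fintype.card F - 1 := by
      rw [Finset.filter_ne' , Finset.card_erase_of_mem (Finset.mem_univ _), Finset.card_univ]
    rw [← this]
    refine Finset.card_le_card_of_injOn (fun c => c • x) ?_ ?_
    · intro c hc
      simp only [Finset.coe_filter, Finset.mem_univ, true_and, Set.mem_setOf_eq] at hc
      simp only [Finset.coe_filter, mem_nzU, Set.mem_setOf_eq]
      exact ⟨⟨U.smul_mem c hx, smul_ne_zero hc hx0⟩, by rw [map_smul, e, smul_comm]⟩
    · intro c _ d _ hcd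
      exact smul_left_injective F hx0 hcd
  calc _ = ∑ g ∈ Finset.univ.filter (fun g => g ∈ St ∧ ∃ x ∈ U, x ≠ 0 ∧ g x = a • x), (Fintype.card F - 1) := by
        rw [Finset.sum_const, smul_eq_mul]; congr!
    _ ≤ _ := Finset.sum_le_sum h4
    _ ≤ _ := by
        apply Finset.sum_le_sum_of_subset
        intro g hg
        simp only [Finset.mem_filter, Finset.mem_univ, true_and] at hg ⊢
        exact hg.1

/-- kernel of `ω v` on U is of index q -/
theorem card_perp (h : Symp ω) {U : Submodule F V} (hU : ND ω U) {v : V} (hv : v ∈ U) (hv0 : v ≠ 0) :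
    ((nzU U).filter (fun x => ω x v = 0)).card * Fintype.card F ≤ (nzU U).card := by
  obtain ⟨w, hw, hvw⟩ := hU v hv hv0
  have hwv : ω w v ≠ 0 := by rw [h.neg]; simpa using hvw
  rw [← Finset.card_univ, ← Finset.card_product]
  refine Finset.card_le_card_of_injOn (fun p => p.1 + p.2 • w) ?_ ?_
  · rintro ⟨x, c⟩ hp
    simp only [Finset.coe_product, Finset.coe_filter, mem_nzU, Finset.coe_univ, Set.mem_prod,
      Set.mem_setOf_eq, Set.mem_univ, and_true] at hp
    simp only [Finset.mem_coe, mem_nzU]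
    refine ⟨U.add_mem hp.1.1 (U.smul_mem c hw), ?_⟩
    intro h0
    have := congrArg (fun z => ω z v) h0
    simp [hp.2, hwv] at this
    subst this
    simp at h0
    exact hp.1.2 h0
  · rintro ⟨x, c⟩ hp ⟨y, d⟩ hq hpq
    simp only [Finset.coe_product, Finset.coe_filter, mem_nzU, Finset.coe_univ, Set.mem_prod,
      Set.mem_setOf_eq, Set.mem_univ, and_true] at hp hq
    have := congrArg (fun z => ω z v) hpq
    simp [hp.2, hq.2, hwv] at this
    subst this
    simp at hpq
    simp [hpq]

/-- generic: a statistic `T` with `T(g t_{v,c}) = T g + c * ω(g v, v) * unit`. -/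
theorem Act.stat {h : Symp ω} {St : Subgroup (V ≃ₗ[F] V)} {U : Submodule F V} (A : Act h St U)
    {v : V} (hv : v ∈ U) (hv0 : v ≠ 0) (T : (V ≃ₗ[F] V) → F) (B : (V ≃ₗ[F] V) → Finset F) (k : ℕ)
    (hT : ∀ g ∈ St, ∀ c, T (g * tv h v c) = T g + c * ω v (g v))
    (hB : ∀ g ∈ St, ∀ c, B (g * tv h v c) = B g) (hk : ∀ g ∈ St, (B g).card ≤ k) :
    cP St (fun g => T g ∈ B g) * Fintype.card F ≤ (k + 1) * cG St := by
  have h1 : cP St (fun g => ω v (g v) = 0) * Fintype.card F ≤ cG St := by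
    have hc : 0 < (nzU U).card := Finset.card_pos.2 ⟨v, mem_nzU.2 ⟨hv, hv0⟩⟩
    apply le_of_mul_le_mul_right _ hc
    have e1 : cP St (fun g => ω v (g v) = 0) =
        ∑ x ∈ (nzU U).filter (fun x => ω x v = 0), cP St (fun g => g v = x) := by
      rw [cP, Finset.card_eq_sum_card_fiberwise (f := fun g : V ≃ₗ[F] V => g v) (t := (nzU U).filter (fun x => ω x v = 0))]
      · refine Finset.sum_congr rfl fun x hx => ?_
        rw [Finset.filter_filter]
        congr 1
        ext g
        simp only [Finset.mem_filter, Finset.mem_univ, true_and, mem_nzU] at hx ⊢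
        constructor
        · rintro ⟨⟨a, b⟩, c⟩; exact ⟨a, c⟩
        · rintro ⟨a, c⟩; exact ⟨⟨a, by rw [c, h.neg, hx.2, neg_zero]⟩, c⟩
      · intro g hg
        simp only [Finset.coe_filter, Finset.mem_univ, true_and, Set.mem_setOf_eq, mem_nzU] at hg ⊢
        exact ⟨⟨A.pr g hg.1 v hv, by simpa using hv0⟩, by rw [h.neg, hg.2, neg_zero]⟩
    calc _ = (∑ x ∈ (nzU U).filter (fun x => ω x v = 0), cP St (fun g => g v = x) * (nzU U).card) * Fintype.card F := by
          rw [e1, ← Finset.sum_mul]; ring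
      _ = (((nzU U).filter (fun x => ω x v = 0)).card * cG St) * Fintype.card F := by
          rw [Finset.sum_congr rfl (g := fun _ => cG St)]
          · simp
          · intro x hx
            simp only [Finset.mem_filter, mem_nzU] at hx
            exact A.fib hv hx.1.1 hv0 hx.1.2
      _ ≤ _ := by nlinarith [card_perp h A.nd hv hv0]
  have h2 : cP St (fun g => T g ∈ B g ∧ ω v (g v) ≠ 0) * Fintype.card F ≤ k * cG St := by
    have := avg' (E := V ≃ₗ[F] V) St (Finset.univ : Finset F) (fun c => tv h v c) (fun c _ => A.tr v hv c)
      (fun g => T g ∈ B g ∧ ω v (g v) ≠ 0) k ?_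
    · rw [Finset.card_univ] at this
      exact (Nat.cast_le (α := ℝ)).1 (by rw [Nat.cast_mul, Nat.cast_mul]; exact this)
    · intro g hg
      have hv1 : ∀ c, (g * tv h v c) v = g v := by
        intro c; rw [LinearEquiv.mul_apply, tv_apply, h.alt]; simp
      simp only [hT g hg, hB g hg, hv1]
      by_cases h0 : ω v (g v) = 0
      · simp [h0]
      · refine le_trans ?_ (Nat.cast_le.2 (hk g hg))
        norm_cast
        refine Finset.card_le_card_of_injOn (fun c => T g + c * ω v (g v)) ?_ ?_
        · intro c hc; simp at hc; exact hc.1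
        · intro c _ d _ hcd
          simpa [h0] using hcd
  calc _ ≤ (cP St (fun g => (T g ∈ B g ∧ ω v (g v) ≠ 0) ∨ ω v (g v) = 0)) * Fintype.card F := by
        apply Nat.mul_le_mul_right
        apply cP_mono; intro g _ hg; by_cases h0 : ω v (g v) = 0 <;> simp [hg, h0]
    _ ≤ (cP St (fun g => T g ∈ B g ∧ ω v (g v) ≠ 0) + cP St (fun g => ω v (g v) = 0)) * Fintype.card F :=
        Nat.mul_le_mul_right _ cP_or
    _ ≤ _ := by nlinarith

theorem trace_tv [FiniteDimensional F V] (h : Symp ω) (g : V ≃ₗ[F] V) (v : V) (c : F) :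
    LinearMap.trace F V (g * tv h v c : V ≃ₗ[F] V).toLinearMap =
      LinearMap.trace F V g.toLinearMap + c * ω v (g v) := by
  have : (g * tv h v c : V ≃ₗ[F] V).toLinearMap = g.toLinearMap + c • (ω v).smulRight (g v) := by
    ext x; simp [tv_apply, smul_smul]
  rw [this, map_add, map_smul, LinearMap.trace_smulRight]; simp

theorem Act.top (h : Symp ω) : Act h (Sp ω) ⊤ :=
  ⟨le_rfl, fun v _ c => tv_mem h v c, fun _ _ _ _ => trivial, ND_top h⟩

theorem trace_count [FiniteDimensional F V] [Nontrivial V] (h : Symp ω) :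
    cP (Sp ω) (fun g => LinearMap.trace F V g.toLinearMap = 0) * Fintype.card F ≤ 2 * cG (Sp ω) := by
  obtain ⟨v, hv⟩ := exists_ne (0 : V)
  have := (Act.top h).stat (v := v) trivial hv (fun g => LinearMap.trace F V g.toLinearMap) (fun _ => {0}) 1
    (fun g _ c => trace_tv h g v c) (by simp) (by simp)
  simpa using this

end P2

section P3
open Classical Pointwise

variable {F V : Type} [Field F] [AddCommGroup V] [Module F V] [Fintype F] [Fintype V]
  [Fintype (V ≃ₗ[F] V)] {ω : V →ₗ[F] V →ₗ[F] F}

theorem pair_count (D : Finset (V × V))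
    (hD : ∀ p ∈ D, ∀ g ∈ Sp ω, (g p.1, g p.2) ∈ D)
    (ht : ∀ p ∈ D, ∀ q ∈ D, ∃ k ∈ Sp ω, k p.1 = q.1 ∧ k p.2 = q.2)
    (AA : Finset F) (hA : ∀ a ∈ AA, ∀ p ∈ D, (a • p.1, a⁻¹ • p.2) ∈ D) (k : ℕ)
    (P : (V ≃ₗ[F] V) → Prop)
    (hk : ∀ g ∈ Sp ω, P g → k ≤ ((AA ×ˢ D).filter
      (fun t => g t.2.1 = t.1 • t.2.1 ∧ g t.2.2 = t.1⁻¹ • t.2.2)).card) :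
    cP (Sp ω) P * k ≤ AA.card * cG (Sp ω) := by
  have h3 := Finset.sum_card_bipartiteAbove_eq_sum_card_bipartiteBelow
      (s := Finset.univ.filter (fun g => g ∈ Sp ω)) (t := AA ×ˢ D)
      (fun (g : V ≃ₗ[F] V) t => g t.2.1 = t.1 • t.2.1 ∧ g t.2.2 = t.1⁻¹ • t.2.2)
  simp only [Finset.bipartiteAbove, Finset.bipartiteBelow, Finset.filter_filter] at h3
  have h4 : cP (Sp ω) P * k ≤ ∑ g ∈ Finset.univ.filter (fun g => g ∈ Sp ω), ((AA ×ˢ D).filter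
      (fun t => g t.2.1 = t.1 • t.2.1 ∧ g t.2.2 = t.1⁻¹ • t.2.2)).card := by
    calc _ = ∑ g ∈ Finset.univ.filter (fun g => g ∈ Sp ω ∧ P g), k := by
          rw [Finset.sum_const, smul_eq_mul]
      _ ≤ ∑ g ∈ Finset.univ.filter (fun g => g ∈ Sp ω ∧ P g), ((AA ×ˢ D).filter
      (fun t => g t.2.1 = t.1 • t.2.1 ∧ g t.2.2 = t.1⁻¹ • t.2.2)).card := by
          apply Finset.sum_le_sum
          intro g hg
          simp only [Finset.mem_filter, Finset.mem_univ, true_and] at hg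
          exact hk g hg.1 hg.2
      _ ≤ _ := by
        apply Finset.sum_le_sum_of_subset
        intro g hg
        simp only [Finset.mem_filter, Finset.mem_univ, true_and] at hg ⊢
        exact hg.1
  refine h4.trans ?_
  rw [h3]
  rcases D.eq_empty_or_nonempty with h0 | h0
  · simp [h0]
  · have hc : 0 < D.card := Finset.card_pos.2 h0
    apply le_of_mul_le_mul_right _ hc
    rw [Finset.sum_mul, Finset.sum_congr rfl (g := fun _ => cG (Sp ω))]
    · simp; exact le_of_eq (by ring)
    · rintro ⟨a, p⟩ hap
      rw [Finset.mem_product] at hap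
      have := fib (E := V ≃ₗ[F] V) (Sp ω) D p (fun g hg => hD p hap.2 g hg)
        (fun q hq => by
          obtain ⟨k, hk, h1, h2⟩ := ht p hap.2 q hq
          exact ⟨k, hk, Prod.ext h1 h2⟩) (hA a hap.1 p hap.2)
      refine Eq.trans ?_ this
      congr 2
      ext g
      simp only [Finset.mem_filter, Finset.mem_univ, true_and]
      refine and_congr_right fun _ => ?_
      rw [Prod.ext_iff]
      rfl

theorem card_nz : (Finset.univ.filter (fun c : F => c ≠ 0)).card = Fintype.card F - 1 := by
  rw [Finset.filter_ne' , Finset.card_erase_of_mem (Finset.mem_univ _), Finset.card_univ]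

theorem iso_ext (h : Symp ω) {v w : V} (hv : v ≠ 0) (hw : ∀ c : F, w ≠ c • v) (hvw : ω v w = 0) :
    ∃ e f, Hyp ω 2 e f ∧ e 0 = v ∧ e 1 = w := by
  have hw0 : w ≠ 0 := by simpa using hw 0
  have : ∃ x, ω w x = 0 ∧ ω v x ≠ 0 := by
    by_contra hc
    push Not at hc
    obtain ⟨y, hy⟩ := h.nd' hw0
    have e1 : ∀ x, ω v x = ω w x * ω v y := by
      intro x
      have := hc (x - ω w x • y) (by simp [hy])
      simp only [map_sub, map_smul, smul_eq_mul] at this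
      linear_combination this
    have e2 : v = ω v y • w := by
      rw [← sub_eq_zero]
      apply h.nd
      intro x
      simp only [map_sub, map_smul, LinearMap.sub_apply, LinearMap.smul_apply, smul_eq_mul]
      rw [e1 x]; ring
    obtain ⟨c, e2⟩ : ∃ c, v = c • w := ⟨_, e2⟩
    have hne : c ≠ 0 := by rintro rfl; rw [zero_smul] at e2; exact hv e2
    apply hw c⁻¹
    rw [e2, smul_smul, inv_mul_cancel₀ hne, one_smul]
  obtain ⟨x, hx, hvx⟩ := this
  have H1 : Hyp ω 1 (Function.update (fun _ => 0) 0 v) (Function.update (fun _ => 0) 0 ((ω v x)⁻¹ • x)) :=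
    Hyp.zero.extend h (by intro i hi; omega) (by intro i hi; omega) (by simp [hvx])
  have hwm : w ∈ hperp ω 1 (Function.update (fun _ => 0) 0 v) (Function.update (fun _ => 0) 0 ((ω v x)⁻¹ • x)) := by
    intro i hi
    obtain rfl : i = 0 := by omega
    have : ω x w = 0 := by rw [h.neg, hx, neg_zero]
    simp [hvw, this]
  obtain ⟨b, hb, hab⟩ := hperp_ND h H1 w hwm hw0
  refine ⟨_, _, H1.extend h hwm (Submodule.smul_mem _ (ω w b)⁻¹ hb) (by simp [hab]), ?_, ?_⟩ <;> simp [Function.update]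

/-- isotropic eigenpairs -/
theorem iso_count (h : Symp ω) :
    cP (Sp ω) (fun g => ∃ (a : F) (v w : V), a ≠ 0 ∧ v ≠ 0 ∧ (∀ c : F, w ≠ c • v) ∧ ω v w = 0 ∧
      g v = a • v ∧ g w = a⁻¹ • w) * (Fintype.card F - 1) ≤ cG (Sp ω) := by
  have hq : 0 < Fintype.card F - 1 := Nat.sub_pos_of_lt Fintype.one_lt_card
  have hsc : ∀ a b : F, a ≠ 0 → b ≠ 0 → ∀ v w : V, v ≠ 0 → (∀ c : F, w ≠ c • v) →
      (a • v ≠ 0 ∧ ∀ c : F, b • w ≠ c • a • v) := by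
    intro a b ha hb v w hv hw
    refine ⟨smul_ne_zero ha hv, fun c hc => hw (b⁻¹ * c * a) ?_⟩
    rw [mul_smul, mul_smul, ← hc, inv_smul_smul₀ hb]
  have := pair_count (ω := ω) (Finset.univ.filter (fun p : V × V => p.1 ≠ 0 ∧ (∀ c : F, p.2 ≠ c • p.1) ∧ ω p.1 p.2 = 0))
    ?_ ?_ (Finset.univ.filter (fun c : F => c ≠ 0)) ?_ ((Fintype.card F - 1) * (Fintype.card F - 1))
    (fun g => ∃ (a : F) (v w : V), a ≠ 0 ∧ v ≠ 0 ∧ (∀ c : F, w ≠ c • v) ∧ ω v w = 0 ∧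
      g v = a • v ∧ g w = a⁻¹ • w) ?_
  · rw [card_nz] at this
    apply le_of_mul_le_mul_right _ hq
    calc _ = _ := by ring
      _ ≤ _ := this
      _ = _ := by ring
  · rintro ⟨v, w⟩ hp g hg
    simp only [Finset.mem_filter, Finset.mem_univ, true_and] at hp ⊢
    refine ⟨by simpa using hp.1, fun c hc => hp.2.1 c ?_, by rw [mem_Sp.1 hg]; exact hp.2.2⟩
    rw [← map_smul] at hc; exact g.injective hc
  · rintro ⟨v, w⟩ hp ⟨v', w'⟩ hq
    simp only [Finset.mem_filter, Finset.mem_univ, true_and] at hp hq ⊢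
    obtain ⟨e, f, H, rfl, rfl⟩ := iso_ext h hp.1 hp.2.1 hp.2.2
    obtain ⟨e', f', H', rfl, rfl⟩ := iso_ext h hq.1 hq.2.1 hq.2.2
    obtain ⟨k, hk, hi⟩ := H.trans h H'
    exact ⟨k, Tv_le h _ hk, (hi 0 (by omega)).1, (hi 1 (by omega)).1⟩
  · rintro a ha ⟨v, w⟩ hp
    simp only [Finset.mem_filter, Finset.mem_univ, true_and] at ha hp ⊢
    have := hsc a a⁻¹ ha (inv_ne_zero ha) v w hp.1 hp.2.1
    exact ⟨this.1, this.2, by simp [hp.2.2]⟩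
  · rintro g hg ⟨a, v, w, ha, hv, hw, hvw, e1, e2⟩
    have hw0 : w ≠ 0 := by simpa using hw 0
    rw [← card_nz, ← Finset.card_product]
    refine Finset.card_le_card_of_injOn (fun s => (a, (s.1 • v, s.2 • w))) ?_ ?_
    · rintro ⟨c, d⟩ hcd
      simp only [Finset.coe_product, Finset.coe_filter, Finset.mem_univ, true_and, Set.mem_prod, Set.mem_setOf_eq] at hcd
      simp only [Finset.coe_filter, Finset.mem_product, Finset.mem_filter, Finset.mem_univ, true_and, Set.mem_setOf_eq]
      have := hsc c d hcd.1 hcd.2 v w hv hw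
      refine ⟨⟨ha, this.1, this.2, by simp [hvw]⟩, ?_, ?_⟩
      · rw [map_smul, e1, smul_comm]
      · rw [map_smul, e2, smul_comm]
    · rintro ⟨c, d⟩ _ ⟨c', d'⟩ _ hcd
      simp only [Prod.mk.injEq, true_and] at hcd
      rw [smul_left_injective F hv hcd.1, smul_left_injective F hw0 hcd.2]

/-- hyperbolic eigenpairs -/
theorem hyp_count (h : Symp ω) :
    2 * cP (Sp ω) (fun g => ∃ (a : F) (v w : V), a ≠ 0 ∧ a ≠ a⁻¹ ∧ ω v w = 1 ∧
      g v = a • v ∧ g w = a⁻¹ • w) ≤ cG (Sp ω) := by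
  have hq : 0 < Fintype.card F - 1 := Nat.sub_pos_of_lt Fintype.one_lt_card
  have := pair_count (ω := ω) (Finset.univ.filter (fun p : V × V => ω p.1 p.2 = 1))
    ?_ ?_ (Finset.univ.filter (fun c : F => c ≠ 0)) ?_ (2 * (Fintype.card F - 1))
    (fun g => ∃ (a : F) (v w : V), a ≠ 0 ∧ a ≠ a⁻¹ ∧ ω v w = 1 ∧
      g v = a • v ∧ g w = a⁻¹ • w) ?_
  · rw [card_nz] at this
    apply le_of_mul_le_mul_right _ hq
    calc _ = _ := by ring
      _ ≤ _ := this
      _ = _ := by ring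
  · rintro ⟨v, w⟩ hp g hg
    simp only [Finset.mem_filter, Finset.mem_univ, true_and] at hp ⊢
    rw [mem_Sp.1 hg]; exact hp
  · rintro ⟨v, w⟩ hp ⟨v', w'⟩ hq
    simp only [Finset.mem_filter, Finset.mem_univ, true_and] at hp hq ⊢
    obtain ⟨k, hk, h1, h2⟩ := Tv_pair h (ND_top h) trivial trivial trivial trivial hp hq
    exact ⟨k, Tv_le h _ hk, h1, h2⟩
  · rintro a ha ⟨v, w⟩ hp
    simp only [Finset.mem_filter, Finset.mem_univ, true_and] at ha hp ⊢
    simp [hp, ha]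
  · rintro g hg ⟨a, v, w, ha, ha2, hvw, e1, e2⟩
    have hv : v ≠ 0 := by rintro rfl; simp at hvw
    have hw : w ≠ 0 := by rintro rfl; simp at hvw
    have hwv : ω w v = -1 := by rw [h.neg, hvw]
    have : 2 * (Fintype.card F - 1) = ((Finset.univ : Finset Bool) ×ˢ (Finset.univ.filter (fun c : F => c ≠ 0))).card := by
      rw [Finset.card_product, card_nz]; simp
    rw [this]
    refine Finset.card_le_card_of_injOn (fun s => if s.1 then (a, (s.2 • v, s.2⁻¹ • w)) else (a⁻¹, (s.2 • w, (-s.2⁻¹) • v))) ?_ ?_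
    · rintro ⟨b, c⟩ hcd
      simp only [Finset.coe_product, Finset.coe_filter, Finset.coe_univ, Finset.mem_univ, true_and, Set.mem_prod, Set.mem_setOf_eq, Set.mem_univ] at hcd
      cases b
      · simp only [Finset.coe_filter, Finset.mem_product, Finset.mem_filter, Finset.mem_univ, true_and, Set.mem_setOf_eq]
        simp [ha, hwv, hcd, e1, e2, smul_comm a]
        exact smul_comm _ _ _
      · simp only [Finset.coe_filter, Finset.mem_product, Finset.mem_filter, Finset.mem_univ, true_and, Set.mem_setOf_eq]
        simp [ha, hvw, hcd, e1, e2, smul_comm a]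
        exact smul_comm _ _ _
    · rintro ⟨b, c⟩ hb ⟨b', c'⟩ hb' hcd
      cases b <;> cases b' <;> simp at hcd
      · rw [smul_left_injective F hw hcd.1]
      · exact absurd hcd.1.symm ha2
      · exact absurd hcd.1 ha2
      · rw [smul_left_injective F hv hcd.1]

theorem inv_eig [FiniteDimensional F V] (h : Symp ω) {g : V ≃ₗ[F] V} (hg : g ∈ Sp ω) {a : F} {v : V} (hv : v ≠ 0)
    (e : g v = a • v) : a ≠ 0 ∧ ∃ w, w ≠ 0 ∧ g w = a⁻¹ • w := by
  have ha : a ≠ 0 := by rintro rfl; rw [zero_smul] at e; exact hv (by simpa using e)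
  refine ⟨ha, ?_⟩
  by_contra hc
  push Not at hc
  have hinj : Function.Injective (g.toLinearMap - a⁻¹ • (LinearMap.id : V →ₗ[F] V) : V →ₗ[F] V) := by
    rw [← LinearMap.ker_eq_bot, LinearMap.ker_eq_bot']
    intro w hw
    by_contra hw0
    apply hc w hw0
    simpa [sub_eq_zero] using hw
  have hs := LinearMap.injective_iff_surjective.1 hinj
  obtain ⟨w, hw⟩ := h.nd' hv
  obtain ⟨x, rfl⟩ := hs w
  have : ω v (g x) = a⁻¹ * ω v x := by
    have := mem_Sp.1 hg v x
    rw [e] at this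
    simp only [map_smul, LinearMap.smul_apply, smul_eq_mul] at this
    rw [← this]; field_simp
  simp [this] at hw

end P3

section P4
open Classical Pointwise

variable {F V : Type} [Field F] [AddCommGroup V] [Module F V] {ω : V →ₗ[F] V →ₗ[F] F}

/-- nondegenerate plane -/
def NDP (ω : V →ₗ[F] V →ₗ[F] F) (U : Submodule F V) : Prop :=
  ∃ e f, ω e f = 1 ∧ U = Submodule.span F {e, f}

def Fr (ω : V →ₗ[F] V →ₗ[F] F) {r : ℕ} (p : Fin r → Submodule F V) : Prop :=
  (∀ i, NDP ω (p i)) ∧ ∀ i j, i ≠ j → ∀ u ∈ p i, ∀ v ∈ p j, ω u v = 0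

def pW (ω : V →ₗ[F] V →ₗ[F] F) {r : ℕ} (p : Fin r → Submodule F V) : Submodule F V where
  carrier := {v | ∀ i, ∀ u ∈ p i, ω u v = 0}
  add_mem' := by intro a b ha hb i u hu; simp [ha i u hu, hb i u hu]
  zero_mem' := by intro i hi; simp
  smul_mem' := by intro c a ha i u hu; simp [ha i u hu]

theorem mem_sp_pair {e f x : V} : x ∈ Submodule.span F {e, f} ↔ ∃ a b : F, x = a • e + b • f := by
  rw [Submodule.mem_span_pair]
  constructor <;> rintro ⟨a, b, h⟩ <;> exact ⟨a, b, h.symm⟩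

theorem NDP.nd (h : Symp ω) {U : Submodule F V} (hU : NDP ω U) : ND ω U := by
  obtain ⟨e, f, hef, rfl⟩ := hU
  intro u hu hu0
  obtain ⟨a, b, rfl⟩ := mem_sp_pair.1 hu
  have hfe : ω f e = -1 := by rw [h.neg, hef]
  by_cases ha : a = 0
  · refine ⟨e, mem_sp_pair.2 ⟨1, 0, by simp⟩, ?_⟩
    simp only [ha, zero_smul, zero_add, map_smul, LinearMap.smul_apply, hfe]
    rintro h0
    apply hu0
    have : b = 0 := by simpa using h0
    simp [this, ha]
  · exact ⟨f, mem_sp_pair.2 ⟨0, 1, by simp⟩, by simp [hef, h.alt, ha]⟩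

theorem Fr.hyp (h : Symp ω) {r : ℕ} {p : Fin r → Submodule F V} (hp : Fr ω p) :
    ∃ e f, Hyp ω r e f ∧ ∀ i : Fin r, p i = Submodule.span F {e i, f i} := by
  obtain ⟨h1, h2⟩ := hp
  choose e f hef hU using h1
  have he : ∀ i, e i ∈ p i := fun i => by rw [hU i]; exact Submodule.subset_span (by simp)
  have hf : ∀ i, f i ∈ p i := fun i => by rw [hU i]; exact Submodule.subset_span (by simp)
  refine ⟨fun i => if hi : i < r then e ⟨i, hi⟩ else 0, fun i => if hi : i < r then f ⟨i, hi⟩ else 0, ⟨?_, ?_, ?_⟩, ?_⟩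
  · intro i hi j hj
    simp only [hi, hj, dif_pos]
    split_ifs with hij
    · subst hij; exact hef _
    · exact h2 _ _ (by simpa using hij) _ (he _) _ (hf _)
  · intro i hi j hj
    simp only [hi, hj, dif_pos]
    by_cases hij : i = j
    · subst hij; exact h.alt _
    · exact h2 _ _ (by simpa using hij) _ (he _) _ (he _)
  · intro i hi j hj
    simp only [hi, hj, dif_pos]
    by_cases hij : i = j
    · subst hij; exact h.alt _
    · exact h2 _ _ (by simpa using hij) _ (hf _) _ (hf _)
  · intro i
    simp [hU i]

theorem Hyp.fr (h : Symp ω) {r : ℕ} {e f : ℕ → V} (H : Hyp ω r e f) :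
    Fr ω (fun i : Fin r => Submodule.span F {e i, f i}) := by
  refine ⟨fun i => ⟨_, _, by simpa using H.ef i i.2 i i.2, rfl⟩, fun i j hij u hu v hv => ?_⟩
  obtain ⟨a, b, rfl⟩ := mem_sp_pair.1 hu
  obtain ⟨c, d, rfl⟩ := mem_sp_pair.1 hv
  have hij' : (i : ℕ) ≠ j := fun hh => hij (Fin.ext hh)
  simp [H.ee i i.2 j j.2, H.ff i i.2 j j.2, H.ef i i.2 j j.2, H.fe h i i.2 j j.2, hij']

theorem pW_eq {r : ℕ} {p : Fin r → Submodule F V} {e f : ℕ → V}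
    (hp : ∀ i : Fin r, p i = Submodule.span F {e i, f i}) : pW ω p = hperp ω r e f := by
  ext x
  rw [mem_hperp]
  constructor
  · intro hx i hi
    have := hx ⟨i, hi⟩
    rw [hp] at this
    exact ⟨this _ (Submodule.subset_span (by simp)), this _ (Submodule.subset_span (by simp))⟩
  · intro hx i u hu
    rw [hp] at hu
    obtain ⟨a, b, rfl⟩ := mem_sp_pair.1 hu
    simp [hx i i.2]

def Stb (ω : V →ₗ[F] V →ₗ[F] F) {r : ℕ} (p : Fin r → Submodule F V) : Subgroup (V ≃ₗ[F] V) :=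
  Sp ω ⊓ MulAction.stabilizer (V ≃ₗ[F] V) p

theorem smul_sub_eq [FiniteDimensional F V] {g : V ≃ₗ[F] V} {U : Submodule F V} (hU : ∀ v ∈ U, g v ∈ U) : g • U = U := by
  apply Submodule.eq_of_le_of_finrank_eq
  · intro x hx
    obtain ⟨s, hs, rfl⟩ := (Submodule.mem_smul_pointwise_iff_exists _ _ _).1 hx
    exact hU s hs
  · exact LinearEquiv.finrank_map_eq g U

theorem mem_Stb [FiniteDimensional F V] {r : ℕ} {p : Fin r → Submodule F V} {g : V ≃ₗ[F] V} :
    g ∈ Stb ω p ↔ g ∈ Sp ω ∧ ∀ i, ∀ v ∈ p i, g v ∈ p i := by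
  rw [Stb, Subgroup.mem_inf, MulAction.mem_stabilizer_iff]
  refine and_congr_right fun _ => ?_
  constructor
  · intro hg i v hv
    have := congrFun hg i
    rw [Pi.smul_apply] at this
    rw [← this]
    exact Submodule.smul_mem_pointwise_smul v g _ hv
  · intro hg
    funext i
    exact smul_sub_eq (hg i)

theorem Act.frame [FiniteDimensional F V] (h : Symp ω) {r : ℕ} {p : Fin r → Submodule F V} (hp : Fr ω p) (i : Fin r) :
    Act h (Stb ω p) (p i) := by
  refine ⟨inf_le_left, fun v hv c => mem_Stb.2 ⟨tv_mem h v c, fun j x hx => ?_⟩, fun g hg => (mem_Stb.1 hg).2 i,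
    (hp.1 i).nd h⟩
  rw [tv_apply]
  by_cases hij : i = j
  · subst hij; exact add_mem hx (Submodule.smul_mem _ _ hv)
  · rw [hp.2 i j hij v hv x hx]; simpa using hx

theorem Act.perp [FiniteDimensional F V] (h : Symp ω) {r : ℕ} {p : Fin r → Submodule F V} (hp : Fr ω p) :
    Act h (Stb ω p) (pW ω p) := by
  refine ⟨inf_le_left, fun v hv c => mem_Stb.2 ⟨tv_mem h v c, fun j x hx => ?_⟩, fun g hg x hx i u hu => ?_, ?_⟩
  · have : ω v x = 0 := by rw [h.neg, hv j x hx, neg_zero]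
    rw [tv_apply, this]; simpa using hx
  · rw [← Sp_inv_left (mem_Stb.1 hg).1]
    exact hx i _ ((mem_Stb.1 (inv_mem hg)).2 i u hu)
  · obtain ⟨e, f, H, hpi⟩ := hp.hyp h
    rw [pW_eq hpi]; exact hperp_ND h H

theorem comp_fix (h : Symp ω) {g : V ≃ₗ[F] V} (hg : g ∈ Sp ω) {U : Submodule F V}
    (hi : ∀ v ∈ U, g v ∈ U) (hi' : ∀ v ∈ U, g⁻¹ v ∈ U) (hU : ND ω U) {x c : V} (hc : c ∈ U)
    (hx : ∀ y ∈ U, ω y c = ω y x) (e : g x = x) : g c = c := by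
  by_contra hne
  obtain ⟨y, hy, h0⟩ := hU (g c - c) (sub_mem (hi c hc) hc) (sub_ne_zero.2 hne)
  apply h0
  have h1 : ω y (g c) = ω y c := by
    rw [← Sp_inv_left hg, hx _ (hi' y hy), Sp_inv_left hg, e, hx y hy]
  rw [h.neg, map_sub, h1, sub_self, neg_zero]

theorem NDP.comp (h : Symp ω) {U : Submodule F V} (hU : NDP ω U) (x : V) : ∃ c ∈ U, ∀ y ∈ U, ω y c = ω y x := by
  obtain ⟨e, f, hef, rfl⟩ := hU
  have hfe : ω f e = -1 := by rw [h.neg, hef]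
  refine ⟨ω x f • e + ω e x • f, mem_sp_pair.2 ⟨_, _, rfl⟩, fun y hy => ?_⟩
  obtain ⟨a, b, rfl⟩ := mem_sp_pair.1 hy
  simp only [map_add, map_smul, LinearMap.add_apply, LinearMap.smul_apply, smul_eq_mul, h.alt, hef, hfe]
  rw [h.neg x f]; ring

theorem plane_scalar (h : Symp ω) {U : Submodule F V} (hU : NDP ω U) {g : V ≃ₗ[F] V} (hg : g ∈ Sp ω)
    (hi : ∀ v ∈ U, g v ∈ U) : ∃ τ : F, ∀ u ∈ U, g u + g⁻¹ u = τ • u := by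
  obtain ⟨e, f, hef, rfl⟩ := hU
  obtain ⟨a, b, h1⟩ := mem_sp_pair.1 (hi e (mem_sp_pair.2 ⟨1, 0, by simp⟩))
  obtain ⟨c, d, h2⟩ := mem_sp_pair.1 (hi f (mem_sp_pair.2 ⟨0, 1, by simp⟩))
  have hfe : ω f e = -1 := by rw [h.neg, hef]
  have hdet : a * d - b * c = 1 := by
    have := mem_Sp.1 hg e f
    rw [h1, h2, hef] at this
    simp only [map_add, map_smul, LinearMap.add_apply, LinearMap.smul_apply, smul_eq_mul, h.alt, hef, hfe] at this
    linear_combination this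
  have h3 : g⁻¹ e = d • e - b • f := by
    apply g.injective
    rw [le_inv_apply, map_sub, map_smul, map_smul, h1, h2]
    have : e = (a * d - b * c) • e := by rw [hdet, one_smul]
    nth_rewrite 1 [this]; module
  have h4 : g⁻¹ f = a • f - c • e := by
    apply g.injective
    rw [le_inv_apply, map_sub, map_smul, map_smul, h1, h2]
    have : f = (a * d - b * c) • f := by rw [hdet, one_smul]
    nth_rewrite 1 [this]; module
  refine ⟨a + d, fun u hu => ?_⟩
  obtain ⟨x, y, rfl⟩ := mem_sp_pair.1 hu
  simp only [map_add, map_smul, h1, h2, h3, h4]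
  module

def NGd (ω : V →ₗ[F] V →ₗ[F] F) (g : V ≃ₗ[F] V) (U : Submodule F V) : Prop :=
  ∃ (τ : F) (x : V), x ≠ 0 ∧ (∀ u ∈ U, ω u x = 0) ∧ g x + g⁻¹ x = τ • x ∧ ∀ u ∈ U, g u + g⁻¹ u = τ • u

/-- two good planes are orthogonal -/
theorem good_orth (h : Symp ω) {g : V ≃ₗ[F] V} (hg : g ∈ Sp ω) {U U' : Submodule F V} (hU : NDP ω U) (hU' : NDP ω U')
    (hi : ∀ v ∈ U, g v ∈ U) (hi' : ∀ v ∈ U', g v ∈ U') (hG : ¬ NGd ω g U) (hG' : ¬ NGd ω g U') (hne : U ≠ U') :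
    ∀ u ∈ U, ∀ v ∈ U', ω u v = 0 := by
  obtain ⟨τ, hτ⟩ := plane_scalar h hU hg hi
  obtain ⟨τ', hτ'⟩ := plane_scalar h hU' hg hi'
  have key : τ ≠ τ' → ∀ u ∈ U, ∀ v ∈ U', ω u v = 0 := by
    intro ht u hu v hv
    have h1 : ω (g u + g⁻¹ u) v = ω u (g v + g⁻¹ v) := by
      rw [map_add, map_add, LinearMap.add_apply, Sp_inv_left hg, Sp_inv_right hg, add_comm]
    rw [hτ u hu, hτ' v hv, map_smul, map_smul, LinearMap.smul_apply, smul_eq_mul, smul_eq_mul] at h1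
    have : (τ - τ') * ω u v = 0 := by linear_combination h1
    rcases mul_eq_zero.1 this with h0 | h0
    · exact absurd (sub_eq_zero.1 h0) ht
    · exact h0
  by_cases ht : τ = τ'
  · subst ht
    exfalso
    have sub : ∀ (A B : Submodule F V), NDP ω A → (∀ u ∈ A, g u + g⁻¹ u = τ • u) → (∀ u ∈ B, g u + g⁻¹ u = τ • u)
        → ¬ NGd ω g A → B ≤ A := by
      intro A B hA h1 h2 h3 x hx
      obtain ⟨c, hc, hcx⟩ := hA.comp h x
      by_contra hxA
      apply h3
      refine ⟨τ, x - c, ?_, ?_, ?_, h1⟩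
      · rw [sub_ne_zero]; rintro rfl; exact hxA hc
      · intro u hu; rw [map_sub, hcx u hu, sub_self]
      · rw [map_sub, map_sub, smul_sub, ← h1 c hc, ← h2 x hx]; abel
    exact hne (le_antisymm (sub _ _ hU' hτ' hτ hG') (sub _ _ hU hτ hτ' hG))
  · exact key ht

variable [Fintype F] [Fintype V] [Fintype (V ≃ₗ[F] V)]

theorem cP_ex {ι : Type} [Fintype ι] {St : Subgroup (V ≃ₗ[F] V)} {P : ι → (V ≃ₗ[F] V) → Prop} :
    cP St (fun g => ∃ i, P i g) ≤ ∑ i, cP St (P i) := by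
  refine le_trans (Finset.card_le_card ?_) (Finset.card_biUnion_le (s := Finset.univ) (t := fun i => Finset.univ.filter (fun g => g ∈ St ∧ P i g)))
  intro g hg
  simp only [Finset.mem_filter, Finset.mem_univ, true_and, Finset.mem_biUnion] at hg ⊢
  obtain ⟨h1, i, h2⟩ := hg
  exact ⟨i, h1, h2⟩

theorem frame_fix [FiniteDimensional F V] (h : Symp ω) {r : ℕ} {p : Fin r → Submodule F V} (hp : Fr ω p) :
    cP (Stb ω p) (fun g => ∃ x, x ≠ 0 ∧ g x = x) * (Fintype.card F - 1) ≤ (r + 1) * cG (Stb ω p) := by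
  have h1 : cP (Stb ω p) (fun g => ∃ x, x ≠ 0 ∧ g x = x) ≤
      cP (Stb ω p) (fun g => (∃ i, ∃ x ∈ p i, x ≠ 0 ∧ g x = (1:F) • x) ∨ ∃ x ∈ pW ω p, x ≠ 0 ∧ g x = (1:F) • x) := by
    apply cP_mono
    rintro g hg ⟨x, hx, e⟩
    have hg' := mem_Stb.1 hg
    have hg'' := mem_Stb.1 (inv_mem hg)
    by_cases hW : x ∈ pW ω p
    · right; exact ⟨x, hW, hx, by simpa using e⟩
    · left
      have : ∃ i, ∃ u ∈ p i, ω u x ≠ 0 := by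
        by_contra hc; push Not at hc; exact hW hc
      obtain ⟨i, u, hu, hux⟩ := this
      obtain ⟨c, hc, hcx⟩ := (hp.1 i).comp h x
      refine ⟨i, c, hc, ?_, ?_⟩
      · rintro rfl; apply hux; rw [← hcx u hu]; simp
      · rw [one_smul]
        exact comp_fix h hg'.1 (hg'.2 i) (hg''.2 i) ((hp.1 i).nd h) hc hcx e
  have h2 := h1.trans (cP_or.trans (Nat.add_le_add_right cP_ex _))
  refine (Nat.mul_le_mul_right _ h2).trans ?_
  rw [add_mul, add_mul, Finset.sum_mul]
  refine Nat.add_le_add ?_ ?_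
  · refine (Finset.sum_le_sum (fun i _ => (Act.frame h hp i).eig one_ne_zero)).trans ?_
    simp
  · simpa using (Act.perp h hp).eig one_ne_zero

theorem frame_ng [FiniteDimensional F V] (h : Symp ω) {r : ℕ} {p : Fin r → Submodule F V} (hp : Fr ω p) (i : Fin r) :
    cP (Stb ω p) (fun g => NGd ω g (p i)) * Fintype.card F ≤ (Module.finrank F V + 1) * cG (Stb ω p) := by
  have hA := Act.frame h hp i
  obtain ⟨e, f, hef, hpi⟩ := hp.1 i
  have he : e ∈ p i := by rw [hpi]; exact Submodule.subset_span (by simp)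
  have he0 : e ≠ 0 := by rintro rfl; simp at hef
  refine le_trans (Nat.mul_le_mul_right _ (cP_mono ?_)) (hA.stat he he0 (fun g => ω (g e) f + ω e (g f))
    (fun g => Finset.univ.filter (fun τ => ∃ x, x ≠ 0 ∧ (∀ u ∈ p i, ω u x = 0) ∧ g x + g⁻¹ x = τ • x)) (Module.finrank F V) ?_ ?_ ?_)
  · rintro g hg ⟨τ, x, hx, h1, h2, h3⟩
    simp only [Finset.mem_filter, Finset.mem_univ, true_and]
    have : ω (g e) f + ω e (g f) = τ := by
      rw [← Sp_inv_left (mem_Stb.1 hg).1, ← LinearMap.add_apply, ← map_add, h3 e he]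
      simp [hef]
    rw [this]
    exact ⟨x, hx, h1, h2⟩
  · intro g hg c
    simp only [LinearEquiv.mul_apply, tv_apply, h.alt, hef]
    simp; ring
  · intro g hg c
    have hg'' := mem_Stb.1 (inv_mem hg)
    have hinv : (g * tv h e c)⁻¹ = tv h e (-c) * g⁻¹ := by rw [mul_inv_rev, tv_inv]
    ext τ
    simp only [Finset.mem_filter, Finset.mem_univ, true_and]
    refine exists_congr fun x => and_congr_right fun hx => and_congr_right fun h1 => ?_
    have e1 : ω e (g⁻¹ x) = 0 := by
      rw [Sp_inv_right (mem_Stb.1 hg).1]; exact h1 _ ((mem_Stb.1 hg).2 i e he)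
    rw [hinv, LinearEquiv.mul_apply, LinearEquiv.mul_apply, tv_apply, tv_apply, h1 e he, e1]
    simp
  · intro g hg
    let L : Module.End F V := g.toLinearMap + (g⁻¹ : V ≃ₗ[F] V).toLinearMap
    refine le_trans (Finset.card_le_card (t := L.charpoly.roots.toFinset) ?_) ?_
    · intro τ hτ
      simp only [Finset.mem_filter, Finset.mem_univ, true_and] at hτ
      obtain ⟨x, hx, -, h2⟩ := hτ
      rw [Multiset.mem_toFinset, Polynomial.mem_roots (LinearMap.charpoly_monic L).ne_zero]
      rw [← Module.End.hasEigenvalue_iff_isRoot_charpoly]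
      exact Module.End.hasEigenvalue_of_hasEigenvector ⟨by rw [Module.End.mem_eigenspace_iff]; exact h2, hx⟩
    · refine (Multiset.toFinset_card_le _).trans ((Polynomial.card_roots' _).trans ?_)
      rw [LinearMap.charpoly_natDegree]

variable [Fintype (Submodule F V)]

noncomputable def FrS (ω : V →ₗ[F] V →ₗ[F] F) (r : ℕ) : Finset (Fin r → Submodule F V) := Finset.univ.filter (fun p => Fr ω p)

theorem Fr.smul {r : ℕ} {p : Fin r → Submodule F V} (hp : Fr ω p) {g : V ≃ₗ[F] V} (hg : g ∈ Sp ω) : Fr ω (g • p) := by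
  refine ⟨fun i => ?_, fun i j hij u hu v hv => ?_⟩
  · obtain ⟨e, f, hef, hpi⟩ := hp.1 i
    refine ⟨g e, g f, by rw [mem_Sp.1 hg, hef], ?_⟩
    rw [Pi.smul_apply, hpi]
    ext x
    rw [Submodule.mem_smul_pointwise_iff_exists, mem_sp_pair]
    constructor
    · rintro ⟨s, hs, rfl⟩
      obtain ⟨a, b, rfl⟩ := mem_sp_pair.1 hs
      exact ⟨a, b, by change g _ = _; simp⟩
    · rintro ⟨a, b, rfl⟩
      exact ⟨a • e + b • f, mem_sp_pair.2 ⟨a, b, rfl⟩, by change g _ = _; simp⟩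
  · obtain ⟨s, hs, rfl⟩ := (Submodule.mem_smul_pointwise_iff_exists _ _ _).1 hu
    obtain ⟨t, ht, rfl⟩ := (Submodule.mem_smul_pointwise_iff_exists _ _ _).1 hv
    exact (mem_Sp.1 hg s t).trans (hp.2 i j hij s hs t ht)

theorem Fr.trans (h : Symp ω) {r : ℕ} {p p' : Fin r → Submodule F V} (hp : Fr ω p) (hp' : Fr ω p') :
    ∃ g ∈ Sp ω, g • p = p' := by
  obtain ⟨e, f, H, he⟩ := hp.hyp h
  obtain ⟨e', f', H', he'⟩ := hp'.hyp h
  obtain ⟨g, hg, hi⟩ := H.trans h H'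
  refine ⟨g, Tv_le h _ hg, ?_⟩
  funext i
  rw [Pi.smul_apply, he, he']
  ext x
  rw [Submodule.mem_smul_pointwise_iff_exists, mem_sp_pair]
  constructor
  · rintro ⟨s, hs, rfl⟩
    obtain ⟨a, b, rfl⟩ := mem_sp_pair.1 hs
    exact ⟨a, b, by change g _ = _; simp [hi i i.2]⟩
  · rintro ⟨a, b, rfl⟩
    exact ⟨a • e i + b • f i, mem_sp_pair.2 ⟨a, b, rfl⟩, by change g _ = _; simp [hi i i.2]⟩

theorem frame_card (h : Symp ω) {r : ℕ} {p : Fin r → Submodule F V} (hp : Fr ω p) :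
    cG (Stb ω p) * (FrS ω r).card = cG (Sp ω) := by
  have := fib (E := V ≃ₗ[F] V) (Sp ω) (FrS ω r) p (fun g hg => by simpa [FrS] using hp.smul hg)
    (fun y hy => hp.trans h (by simpa [FrS] using hy)) (y := p) (by simpa [FrS] using hp)
  refine Eq.trans ?_ this
  congr 1
  rw [cG]
  congr 1
  ext g
  simp only [Finset.mem_filter, Finset.mem_univ, true_and, Stb, Subgroup.mem_inf, MulAction.mem_stabilizer_iff]

/-- number of fixed frames with property φ -/
noncomputable def nF (ω : V →ₗ[F] V →ₗ[F] F) (r : ℕ) (φ : (V ≃ₗ[F] V) → (Fin r → Submodule F V) → Prop) (g : V ≃ₗ[F] V) : ℕ :=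
  ((FrS ω r).filter (fun p => g • p = p ∧ φ g p)).card

theorem nF_sum (r : ℕ) (φ : (V ≃ₗ[F] V) → (Fin r → Submodule F V) → Prop) :
    ∑ g ∈ Finset.univ.filter (fun g => g ∈ Sp ω), nF ω r φ g = ∑ p ∈ FrS ω r, cP (Stb ω p) (fun g => φ g p) := by
  have h3 := Finset.sum_card_bipartiteAbove_eq_sum_card_bipartiteBelow
      (s := Finset.univ.filter (fun g => g ∈ Sp ω)) (t := FrS ω r)
      (fun (g : V ≃ₗ[F] V) p => g • p = p ∧ φ g p)
  simp only [Finset.bipartiteAbove, Finset.bipartiteBelow, Finset.filter_filter] at h3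
  refine h3.trans (Finset.sum_congr rfl fun p _ => ?_)
  rw [cP]
  congr 1
  ext g
  simp only [Finset.mem_filter, Finset.mem_univ, true_and, Stb, Subgroup.mem_inf, MulAction.mem_stabilizer_iff]
  tauto

theorem nF_le (h : Symp ω) (r : ℕ) (φ : (V ≃ₗ[F] V) → (Fin r → Submodule F V) → Prop) (κ : ℝ) (hκ : 0 ≤ κ)
    (hb : ∀ p, Fr ω p → (cP (Stb ω p) (fun g => φ g p) : ℝ) ≤ κ * cG (Stb ω p)) :
    (∑ g ∈ Finset.univ.filter (fun g => g ∈ Sp ω), (nF ω r φ g : ℝ)) ≤ κ * cG (Sp ω) := by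
  rw [← Nat.cast_sum, nF_sum, Nat.cast_sum]
  rcases (FrS ω r).eq_empty_or_nonempty with h0 | ⟨p0, hp0⟩
  · rw [h0]; simp; positivity
  · have hp0' : Fr ω p0 := by simpa [FrS] using hp0
    have hc : (0 : ℝ) < (FrS ω r).card := by exact_mod_cast Finset.card_pos.2 ⟨p0, hp0⟩
    calc _ ≤ ∑ p ∈ FrS ω r, κ * cG (Sp ω) / (FrS ω r).card := by
          refine Finset.sum_le_sum fun p hp => ?_
          have hp' : Fr ω p := by simpa [FrS] using hp
          rw [le_div_iff₀ hc, ← frame_card h hp']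
          push_cast
          rw [← mul_assoc]
          exact mul_le_mul_of_nonneg_right (hb p hp') hc.le
      _ = _ := by rw [Finset.sum_const, nsmul_eq_mul]; field_simp

theorem nF_ge (h : Symp ω) (r : ℕ) (φ : (V ≃ₗ[F] V) → (Fin r → Submodule F V) → Prop) (κ : ℝ)
    (hne : ∃ p : Fin r → Submodule F V, Fr ω p)
    (hb : ∀ p, Fr ω p → κ * cG (Stb ω p) ≤ (cP (Stb ω p) (fun g => φ g p) : ℝ)) :
    κ * cG (Sp ω) ≤ (∑ g ∈ Finset.univ.filter (fun g => g ∈ Sp ω), (nF ω r φ g : ℝ)) := by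
  rw [← Nat.cast_sum, nF_sum, Nat.cast_sum]
  obtain ⟨p0, hp0⟩ := hne
  have hc : (0 : ℝ) < (FrS ω r).card := by exact_mod_cast Finset.card_pos.2 ⟨p0, by simpa [FrS] using hp0⟩
  calc _ = ∑ p ∈ FrS ω r, κ * cG (Sp ω) / (FrS ω r).card := by
          rw [Finset.sum_const, nsmul_eq_mul]; field_simp
    _ ≤ _ := by
          refine Finset.sum_le_sum fun p hp => ?_
          have hp' : Fr ω p := by simpa [FrS] using hp
          rw [div_le_iff₀ hc, ← frame_card h hp']
          push_cast
          rw [← mul_assoc]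
          exact mul_le_mul_of_nonneg_right (hb p hp') hc.le

end P4

section P5
open Classical Pointwise

variable {F V : Type} [Field F] [AddCommGroup V] [Module F V] {ω : V →ₗ[F] V →ₗ[F] F}
variable [Fintype F] [Fintype V] [Fintype (V ≃ₗ[F] V)] [Fintype (Submodule F V)]

noncomputable def PL (ω : V →ₗ[F] V →ₗ[F] F) (g : V ≃ₗ[F] V) : Finset (Submodule F V) :=
  Finset.univ.filter (fun U => NDP ω U ∧ (∀ v ∈ U, g v ∈ U) ∧ ¬ NGd ω g U)

theorem desc_le [FiniteDimensional F V] (h : Symp ω) {g : V ≃ₗ[F] V} (hg : g ∈ Sp ω) (r : ℕ) :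
    (PL ω g).card.descFactorial r ≤ nF ω r (fun _ _ => True) g := by
  have h1 : (PL ω g).card.descFactorial r = Fintype.card (Fin r ↪ (PL ω g)) := by
    rw [Fintype.card_embedding_eq]; simp
  rw [h1, ← Finset.card_univ, nF]
  refine Finset.card_le_card_of_injOn (fun φ i => (φ i : Submodule F V)) ?_ ?_
  · intro φ _
    have hφ : ∀ i, NDP ω (φ i : Submodule F V) ∧ (∀ v ∈ (φ i : Submodule F V), g v ∈ (φ i : Submodule F V)) ∧ ¬ NGd ω g (φ i) := by
      intro i; exact (Finset.mem_filter.1 (φ i).2).2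
    simp only [Finset.coe_filter, Set.mem_setOf_eq, FrS, Finset.mem_filter, Finset.mem_univ, true_and, and_true]
    refine ⟨⟨fun i => (hφ i).1, fun i j hij => ?_⟩, ?_⟩
    · refine good_orth h hg (hφ i).1 (hφ j).1 (hφ i).2.1 (hφ j).2.1 (hφ i).2.2 (hφ j).2.2 ?_
      intro hh; exact hij (φ.injective (Subtype.ext hh))
    · funext i; exact smul_sub_eq (hφ i).2.1
  · intro φ _ ψ _ hh
    ext i : 1
    exact Subtype.ext (congrFun hh i)

theorem two_le [FiniteDimensional F V] (h : Symp ω) {g : V ≃ₗ[F] V} (hg : g ∈ Sp ω) :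
    nF ω 2 (fun _ _ => True) g ≤ (PL ω g).card.descFactorial 2 + nF ω 2 (fun g p => NGd ω g (p 0)) g
      + nF ω 2 (fun g p => NGd ω g (p 1)) g := by
  have h1 : (PL ω g).card.descFactorial 2 = (PL ω g).offDiag.card := by
    rw [Finset.offDiag_card]; simp [Nat.descFactorial, Nat.mul_sub, Nat.mul_comm]
  have h2 : ((FrS ω 2).filter (fun p => g • p = p ∧ ¬ NGd ω g (p 0) ∧ ¬ NGd ω g (p 1))).card ≤ (PL ω g).offDiag.card := by
    refine Finset.card_le_card_of_injOn (fun p => (p 0, p 1)) ?_ ?_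
    · intro p hp
      simp only [Finset.coe_filter, Set.mem_setOf_eq, FrS, Finset.mem_filter, Finset.mem_univ, true_and, and_true] at hp
      obtain ⟨hF, hs, n0, n1⟩ := hp
      have hi : ∀ i, ∀ v ∈ p i, g v ∈ p i := (mem_Stb (ω := ω).1 ⟨hg, hs⟩).2
      simp only [Finset.mem_coe, Finset.mem_offDiag, PL, Finset.mem_filter, Finset.mem_univ, true_and]
      refine ⟨⟨hF.1 0, hi 0, n0⟩, ⟨hF.1 1, hi 1, n1⟩, fun hh => ?_⟩
      obtain ⟨e, f, hef, hp0⟩ := hF.1 0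
      have he : e ∈ p 0 := by rw [hp0]; exact Submodule.subset_span (by simp)
      have hf : f ∈ p 0 := by rw [hp0]; exact Submodule.subset_span (by simp)
      have := hF.2 0 1 (by simp) e he f (hh ▸ hf)
      rw [hef] at this; exact one_ne_zero this
    · intro p _ p' _ hh
      simp only [Prod.mk.injEq] at hh
      funext i; fin_cases i
      exacts [hh.1, hh.2]
  rw [h1]
  refine le_trans ?_ (Nat.add_le_add_right (Nat.add_le_add_right h2 _) _)
  rw [nF, nF, nF]
  refine le_trans (Finset.card_le_card ?_) ((Finset.card_union_le _ _).trans (Nat.add_le_add_right (Finset.card_union_le _ _) _))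
  intro p hp
  simp only [Finset.mem_filter, Finset.mem_union] at hp ⊢
  tauto

theorem nF_if (r : ℕ) (w : (V ≃ₗ[F] V) → Prop) (g : V ≃ₗ[F] V) :
    nF ω r (fun g _ => w g) g = if w g then nF ω r (fun _ _ => True) g else 0 := by
  unfold nF
  split_ifs with hw <;> simp [hw]

theorem plane_count [FiniteDimensional F V] (h : Symp ω) {m : ℕ} (hm : Module.finrank F V = 2 * m) (hm2 : 2 ≤ m)
    (w : (V ≃ₗ[F] V) → Prop) (κ δ : ℝ) (hκ : 0 ≤ κ) (hδ : 0 ≤ δ)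
    (hw1 : ∀ r (p : Fin r → Submodule F V), r ≤ 3 → Fr ω p → (cP (Stb ω p) w : ℝ) ≤ (κ + δ) * cG (Stb ω p))
    (hw2 : ∀ r (p : Fin r → Submodule F V), r ≤ 3 → Fr ω p → (κ - δ) * cG (Stb ω p) ≤ (cP (Stb ω p) w : ℝ)) :
    (κ / 3 - 3 * δ - 3 * (2 * m + 1) / Fintype.card F) * cG (Sp ω) ≤
      (cP (Sp ω) (fun g => w g ∧ ∀ U, NDP ω U → ¬ ∀ v ∈ U, g v ∈ U) : ℝ) := by
  have hq : (0 : ℝ) < Fintype.card F := by exact_mod_cast Fintype.card_pos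
  set N : ℝ := (2 * m + 1) / Fintype.card F with hN
  have hN0 : 0 ≤ N := by positivity
  have hfr : ∀ r ≤ m, ∃ p : Fin r → Submodule F V, Fr ω p := by
    intro r hr
    obtain ⟨e, f, H⟩ := h.exists_hyp hm
    exact ⟨_, (H.mono hr).fr h⟩
  have hng : ∀ r (p : Fin r → Submodule F V) (i : Fin r), Fr ω p → (cP (Stb ω p) (fun g => NGd ω g (p i)) : ℝ) ≤ N * cG (Stb ω p) := by
    intro r p i hp
    have := frame_ng h hp i
    rw [hm] at this
    rw [hN, div_mul_eq_mul_div, le_div_iff₀ hq]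
    exact_mod_cast this
  have b0 := nF_ge h 0 (fun g _ => w g) (κ - δ) (hfr 0 (by omega)) (fun p hp => hw2 0 p (by omega) hp)
  have b1 := nF_le h 1 (fun g _ => w g) (κ + δ) (by positivity) (fun p hp => hw1 1 p (by omega) hp)
  have b2 := nF_ge h 2 (fun g _ => w g) (κ - δ) (hfr 2 (by omega)) (fun p hp => hw2 2 p (by omega) hp)
  have b3 := nF_le h 3 (fun g _ => w g) (κ + δ) (by positivity) (fun p hp => hw1 3 p (by omega) hp)
  have c1 := nF_le h 1 (fun g p => NGd ω g (p 0)) N hN0 (fun p hp => hng 1 p 0 hp)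
  have c2 := nF_le h 2 (fun g p => NGd ω g (p 0)) N hN0 (fun p hp => hng 2 p 0 hp)
  have c3 := nF_le h 2 (fun g p => NGd ω g (p 1)) N hN0 (fun p hp => hng 2 p 1 hp)
  set S := Finset.univ.filter (fun g => g ∈ Sp ω) with hS
  have key : ∀ g ∈ S, (nF ω 0 (fun g _ => w g) g : ℝ) - nF ω 1 (fun g _ => w g) g + nF ω 2 (fun g _ => w g) g / 2
      - nF ω 3 (fun g _ => w g) g / 6 - nF ω 1 (fun g p => NGd ω g (p 0)) g - nF ω 2 (fun g p => NGd ω g (p 0)) g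
      - nF ω 2 (fun g p => NGd ω g (p 1)) g ≤ if (w g ∧ ∀ U, NDP ω U → ¬ ∀ v ∈ U, g v ∈ U) then 1 else 0 := by
    intro g hg
    have hg : g ∈ Sp ω := by simpa [hS] using hg
    have pos : ∀ a : ℕ, (0 : ℝ) ≤ a := fun a => Nat.cast_nonneg a
    rw [nF_if 0 w, nF_if 1 w, nF_if 2 w, nF_if 3 w]
    by_cases hw : w g
    · simp only [hw, if_true, true_and]
      have d1 : ((PL ω g).card.descFactorial 1 : ℝ) ≤ nF ω 1 (fun _ _ => True) g := by exact_mod_cast desc_le h hg 1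
      have d3 : ((PL ω g).card.descFactorial 3 : ℝ) ≤ nF ω 3 (fun _ _ => True) g := by exact_mod_cast desc_le h hg 3
      have d2 : (nF ω 2 (fun _ _ => True) g : ℝ) ≤ (PL ω g).card.descFactorial 2 + nF ω 2 (fun g p => NGd ω g (p 0)) g
        + nF ω 2 (fun g p => NGd ω g (p 1)) g := by exact_mod_cast two_le h hg
      have d0 : nF ω 0 (fun _ _ => True) g ≤ 1 := Finset.card_le_one_of_subsingleton _
      have d0 : (nF ω 0 (fun _ _ => True) g : ℝ) ≤ 1 := by exact_mod_cast d0
      have p0 := pos (nF ω 2 (fun g p => NGd ω g (p 0)) g)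
      have p1 := pos (nF ω 2 (fun g p => NGd ω g (p 1)) g)
      have p2 := pos (nF ω 1 (fun g p => NGd ω g (p 0)) g)
      rcases Nat.eq_zero_or_pos (PL ω g).card with hA | hA
      · rw [hA] at d1 d2 d3
        simp only [Nat.descFactorial_zero, Nat.zero_descFactorial_succ, Nat.cast_zero, Nat.cast_one] at d1 d2 d3
        split_ifs with hU
        · linarith
        · push Not at hU
          obtain ⟨U, hU1, hU2⟩ := hU
          have : 1 ≤ nF ω 1 (fun g p => NGd ω g (p 0)) g := by
            rw [nF, Nat.one_le_iff_ne_zero, ← Nat.pos_iff_ne_zero, Finset.card_pos]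
            refine ⟨fun _ => U, ?_⟩
            simp only [FrS, Finset.mem_filter, Finset.mem_univ, true_and]
            refine ⟨⟨fun _ => hU1, fun i j hij => absurd (Subsingleton.elim i j) hij⟩, ?_, ?_⟩
            · funext i; exact smul_sub_eq hU2
            · by_contra hc
              have : U ∈ PL ω g := by simp only [PL, Finset.mem_filter, Finset.mem_univ, true_and]; exact ⟨hU1, hU2, hc⟩
              rw [Finset.card_eq_zero] at hA
              simp [hA] at this
          have : (1 : ℝ) ≤ nF ω 1 (fun g p => NGd ω g (p 0)) g := by exact_mod_cast this
          linarith
      · have e1 : ((PL ω g).card.descFactorial 1 : ℝ) = (PL ω g).card := by simp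
        have e2 : ((PL ω g).card.descFactorial 2 : ℝ) = (PL ω g).card * ((PL ω g).card - 1) := by
          rw [Nat.cast_descFactorial_two]
        have e3 : ((PL ω g).card * ((PL ω g).card - 1) * ((PL ω g).card - 2) : ℝ) ≤ (PL ω g).card.descFactorial 3 := by
          rcases (by omega : (PL ω g).card = 1 ∨ 2 ≤ (PL ω g).card) with h1 | h1
          · rw [h1]; simp
          · obtain ⟨k, hk⟩ := Nat.exists_eq_add_of_le h1
            rw [hk]; simp only [Nat.descFactorial]
            rw [show 2 + k - 2 = k by omega, show 2 + k - 1 = k + 1 by omega, Nat.sub_zero]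
            push_cast
            exact le_of_eq (by ring)
        have hA1 : (1 : ℝ) ≤ (PL ω g).card := by exact_mod_cast hA
        have e4 : 0 ≤ ((PL ω g).card - 1 : ℝ) * ((PL ω g).card - 2) * ((PL ω g).card - 3) := by
          rcases (by omega : (PL ω g).card = 1 ∨ (PL ω g).card = 2 ∨ 3 ≤ (PL ω g).card) with h1 | h1 | h1
          · rw [h1]; simp
          · rw [h1]; simp
          · have : (3 : ℝ) ≤ (PL ω g).card := by exact_mod_cast h1
            apply mul_nonneg (mul_nonneg _ _) <;> linarith
        rw [e1] at d1
        rw [e2] at d2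
        have : (0 : ℝ) ≤ if (∀ U, NDP ω U → ¬ ∀ v ∈ U, g v ∈ U) then 1 else 0 := by split_ifs <;> simp
        refine le_trans ?_ this
        nlinarith
    · simp only [hw, if_false, false_and]
      have p0 := pos (nF ω 2 (fun g p => NGd ω g (p 0)) g)
      have p1 := pos (nF ω 2 (fun g p => NGd ω g (p 1)) g)
      have p2 := pos (nF ω 1 (fun g p => NGd ω g (p 0)) g)
      simp only [Nat.cast_zero]
      linarith
  have tot := Finset.sum_le_sum key
  have : (∑ g ∈ S, if (w g ∧ ∀ U, NDP ω U → ¬ ∀ v ∈ U, g v ∈ U) then (1:ℝ) else 0) =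
      (cP (Sp ω) (fun g => w g ∧ ∀ U, NDP ω U → ¬ ∀ v ∈ U, g v ∈ U) : ℝ) := by
    rw [Finset.sum_boole, hS, Finset.filter_filter]
    congr!
  rw [this] at tot
  simp only [Finset.sum_sub_distrib, Finset.sum_add_distrib, ← Finset.sum_div] at tot
  refine le_trans ?_ tot
  have hc : (0 : ℝ) ≤ cG (Sp ω) := Nat.cast_nonneg _
  have : 3 * (2 * (m:ℝ) + 1) / Fintype.card F = 3 * N := by rw [hN]; ring
  rw [this]
  nlinarith [mul_nonneg hδ hc, mul_nonneg hN0 hc]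

end P5

section P6
open Classical Pointwise

variable {F V : Type} [Field F] [AddCommGroup V] [Module F V] {ω : V →ₗ[F] V →ₗ[F] F}

structure QF (ω : V →ₗ[F] V →ₗ[F] F) (Q : V → F) : Prop where
  sm : ∀ (c : F) v, Q (c • v) = c ^ 2 * Q v
  ad : ∀ u v, Q (u + v) = Q u + Q v + ω u v

structure Chi (χ : F → ℤ) : Prop where
  ad : ∀ x y, χ (x + y) = χ x * χ y
  sq : ∀ x, χ (x ^ 2) = χ x
  pm : ∀ x, χ x = 1 ∨ χ x = -1
  nt : ∃ x, χ x = -1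

theorem card_root (p : Polynomial F) (hp : p ≠ 0) [Fintype F] (n : ℕ) (hn : p.natDegree ≤ n) :
    (Finset.univ.filter (fun x => p.eval x = 0)).card ≤ n := by
  refine le_trans (Finset.card_le_card (t := p.roots.toFinset) ?_) ((Multiset.toFinset_card_le _).trans ((Polynomial.card_roots' _).trans hn))
  intro x hx
  simp only [Finset.mem_filter, Finset.mem_univ, true_and] at hx
  rw [Multiset.mem_toFinset, Polynomial.mem_roots hp]; exact hx

theorem card_quad [Fintype F] (a b c : F) (h : a ≠ 0) :
    (Finset.univ.filter (fun x => a * x ^ 2 + b * x + c = 0)).card ≤ 2 := by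
  have := card_root (Polynomial.C a * Polynomial.X ^ 2 + Polynomial.C b * Polynomial.X + Polynomial.C c) ?_ 2 ?_
  · simpa using this
  · intro h0
    have := congrArg (fun p => Polynomial.coeff p 2) h0
    simp [Polynomial.coeff_X, Polynomial.coeff_C] at this
    exact h this
  · exact Polynomial.natDegree_quadratic_le

section exC
variable [Fintype F] [CharP F 2]
theorem exists_chi : ∃ χ : F → ℤ, Chi χ := by
  letI : Algebra (ZMod 2) F := ZMod.algebra F 2
  let t := Algebra.trace (ZMod 2) F
  have h01 : ∀ x : ZMod 2, x = 0 ∨ x = 1 := by decide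
  have hfs : ∀ x : F, t (x ^ 2) = t x := by
    intro x
    have := Algebra.trace_eq_of_algEquiv (FiniteField.frobeniusAlgEquivOfAlgebraic (ZMod 2) F) x
    simpa using this
  refine ⟨fun x => if t x = 0 then 1 else -1, ⟨?_, ?_, ?_, ?_⟩⟩
  · intro x y
    rcases h01 (t x) with h1 | h1 <;> rcases h01 (t y) with h2 | h2 <;> simp [h1, h2, map_add]
    decide
  · intro x; simp only [hfs]
  · intro x; by_cases h : t x = 0 <;> simp [h]
  · obtain ⟨x, hx⟩ := Algebra.trace_surjective (ZMod 2) F 1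
    exact ⟨x, by simp [t, hx]⟩
end exC

section chi
variable [Fintype F] {χ : F → ℤ} (hχ : Chi χ)
include hχ

theorem Chi.zero : χ 0 = 1 := by
  have := hχ.ad 0 0
  rw [add_zero] at this
  rcases hχ.pm 0 with h | h <;> rw [h] at this ⊢ <;> simp at this

theorem Chi.sum0 : ∑ x, χ x = 0 := by
  obtain ⟨x0, h0⟩ := hχ.nt
  have : ∑ x, χ x = ∑ x, χ (x + x0) := (Equiv.sum_comp (Equiv.addRight x0) χ).symm
  simp only [hχ.ad, h0, mul_neg, mul_one, Finset.sum_neg_distrib] at this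
  linarith

theorem Chi.half : 2 * (Finset.univ.filter (fun x => χ x = 1)).card = Fintype.card F := by
  have h1 := hχ.sum0
  have h2 : ∀ x, χ x = 2 * (if χ x = 1 then 1 else 0) - 1 := by
    intro x; rcases hχ.pm x with h | h <;> simp [h]
  rw [Finset.sum_congr rfl (fun x _ => h2 x), Finset.sum_sub_distrib, ← Finset.mul_sum, Finset.sum_boole] at h1
  simp at h1
  have : (2 * (Finset.univ.filter (fun x => χ x = 1)).card : ℤ) = Fintype.card F := by linarith
  exact_mod_cast this
end chi

noncomputable def ga [Fintype V] (χ : F → ℤ) (Q : V → F) : ℤ := ∑ v, χ (Q v)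

section c2
variable (h2 : (2 : F) = 0)
include h2

theorem ga_sq [Fintype F] [Fintype V] (h : Symp ω) {χ : F → ℤ} (hχ : Chi χ) {Q : V → F} (hQ : QF ω Q) :
    ga χ Q ^ 2 = Fintype.card V := by
  have e1 : ga χ Q ^ 2 = ∑ w, ∑ u, χ (Q w + ω u w) := by
    rw [sq, ga, Finset.sum_mul_sum, Finset.sum_comm' (s' := fun _ => Finset.univ) (t' := Finset.univ) (by simp)]
    rw [Finset.sum_comm]
    rw [Finset.sum_comm (f := fun w u => χ (Q w + ω u w))]
    refine Finset.sum_congr rfl fun u _ => ?_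
    rw [← Equiv.sum_comp (Equiv.addLeft u)]
    refine Finset.sum_congr rfl fun w _ => ?_
    rw [← hχ.ad]
    congr 1
    simp only [Equiv.coe_addLeft]
    rw [hQ.ad]; linear_combination (Q u) * h2
  rw [e1, Finset.sum_eq_single 0]
  · have : Q 0 = 0 := by simpa using hQ.sm 0 0
    simp [this, hχ.zero]
  · intro w _ hw
    obtain ⟨x0, hx0⟩ := hχ.nt
    obtain ⟨u0, hu0⟩ := h.nd' hw
    have : ω (-x0 • u0) w = x0 := by rw [h.neg]; simp [hu0]
    have e2 : ∑ u, χ (Q w + ω u w) = ∑ u, χ (Q w + ω (u + (-x0 • u0)) w) :=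
      (Equiv.sum_comp (Equiv.addRight (-x0 • u0)) (fun u => χ (Q w + ω u w))).symm
    have e3 : ∀ u, χ (Q w + ω (u + (-x0 • u0)) w) = - χ (Q w + ω u w) := by
      intro u
      rw [map_add, LinearMap.add_apply, this, ← add_assoc, hχ.ad, hx0]; ring
    simp only [e3, Finset.sum_neg_distrib] at e2
    linarith
  · simp

theorem QF.shift {Q : V → F} (hQ : QF ω Q) (w : V) : QF ω (fun v => Q v + ω v w ^ 2) := by
  refine ⟨fun c v => ?_, fun u v => ?_⟩
  · simp only [hQ.sm, map_smul, LinearMap.smul_apply, smul_eq_mul]; ring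
  · simp only [hQ.ad, map_add, LinearMap.add_apply]; linear_combination (ω u w * ω v w) * h2

theorem ga_shift [Fintype V] {χ : F → ℤ} (hχ : Chi χ) {Q : V → F} (hQ : QF ω Q) (w : V) :
    ga χ (fun v => Q v + ω v w ^ 2) = χ (Q w) * ga χ Q := by
  rw [ga, ga, ← Equiv.sum_comp (Equiv.addRight w) (fun v => χ (Q v)), Finset.mul_sum]
  refine Finset.sum_congr rfl fun v _ => ?_
  rw [hχ.ad, hχ.sq, ← hχ.ad, ← hχ.ad]
  congr 1
  simp only [Equiv.coe_addRight, hQ.ad]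
  linear_combination (- Q w) * h2

theorem QF.diff [Fintype F] [FiniteDimensional F V] (h : Symp ω) {Q Q' : V → F} (hQ : QF ω Q) (hQ' : QF ω Q') :
    ∃ w, ∀ v, Q' v = Q v + ω v w ^ 2 := by
  haveI : CharP F 2 := CharTwo.of_one_ne_zero_of_two_eq_zero one_ne_zero h2
  have hinj : ∀ a b : F, a ^ 2 = b ^ 2 → a = b := by
    intro a b hab
    have : (a - b) ^ 2 = 0 := by linear_combination hab + (b ^ 2 - a * b) * h2
    exact sub_eq_zero.1 (pow_eq_zero_iff two_ne_zero |>.1 this)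
  have hex : ∀ v, ∃ l : F, l ^ 2 = Q' v - Q v := fun v => by
    have := (Finite.injective_iff_surjective (f := fun a : F => a ^ 2)).1 (fun a b => hinj a b)
    exact this _
  choose l hl using hex
  let L : V →ₗ[F] F :=
    { toFun := l
      map_add' := fun u v => hinj _ _ (by
        have : (l u + l v) ^ 2 = l u ^ 2 + l v ^ 2 := by linear_combination (l u * l v) * h2
        rw [this, hl, hl, hl, hQ.ad, hQ'.ad]; ring)
      map_smul' := fun c v => hinj _ _ (by
        rw [smul_eq_mul, mul_pow, hl, RingHom.id_apply, hl, hQ.sm, hQ'.sm]; ring) }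
  have hsur : Function.Surjective ω := by
    have hfr : Module.finrank F V = Module.finrank F (V →ₗ[F] F) := (Subspace.dual_finrank_eq (K := F) (V := V)).symm
    rw [← LinearMap.injective_iff_surjective_of_finrank_eq_finrank hfr, ← LinearMap.ker_eq_bot, LinearMap.ker_eq_bot']
    intro v hv
    by_contra hv0
    obtain ⟨w, hw⟩ := h.nd' hv0
    rw [hv] at hw; simp at hw
  obtain ⟨w, hw⟩ := hsur L
  refine ⟨w, fun v => ?_⟩
  have : ω w v = l v := by rw [hw]; rfl
  rw [h.neg, this, neg_sq, hl]; ring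

theorem QF.base [FiniteDimensional F V] (h : Symp ω) {m : ℕ} (hm : Module.finrank F V = 2 * m) : ∃ Q, QF ω Q := by
  obtain ⟨e, f, H⟩ := h.exists_hyp hm
  refine ⟨fun v => ∑ i ∈ Finset.range m, ω v (f i) * ω (e i) v, ⟨fun c v => ?_, fun u v => ?_⟩⟩
  · rw [Finset.mul_sum]
    refine Finset.sum_congr rfl fun i _ => ?_
    simp only [map_smul, LinearMap.smul_apply, smul_eq_mul]; ring
  · have : ω u v = ∑ i ∈ Finset.range m, (ω u (f i) * ω (e i) v - ω (e i) u * ω v (f i)) := by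
      conv_lhs => rw [H.expand h hm u, hproj]
      rw [map_sum, LinearMap.sum_apply]
      refine Finset.sum_congr rfl fun i _ => ?_
      simp only [map_add, map_smul, LinearMap.add_apply, LinearMap.smul_apply, smul_eq_mul]
      rw [h.neg (f i) v]; ring
    rw [this, ← Finset.sum_add_distrib, ← Finset.sum_add_distrib]
    refine Finset.sum_congr rfl fun i _ => ?_
    simp only [map_add, LinearMap.add_apply]
    linear_combination (ω (e i) u * ω v (f i)) * h2

def noe (g : V ≃ₗ[F] V) : Prop := ∀ x, g x = x → x = 0

omit h2 in
theorem noe.inv {g : V ≃ₗ[F] V} (hg : noe g) : noe g⁻¹ := by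
  intro x hx
  apply hg
  conv_lhs => rw [← hx]
  simp

theorem add_self_V (x : V) : x + x = 0 := by rw [← two_smul F, h2, zero_smul]

/-- `x ↦ x + g⁻¹ x` is injective -/
theorem noe.inj {g : V ≃ₗ[F] V} (hg : noe g) {x y : V} (hxy : x + g⁻¹ x = y + g⁻¹ y) : x = y := by
  rw [← sub_eq_zero]
  apply hg.inv
  rw [map_sub]
  have : g⁻¹ x - g⁻¹ y = y - x := by
    rw [sub_eq_sub_iff_add_eq_add, add_comm, hxy, add_comm]
  rw [this, ← sub_eq_zero]
  have := add_self_V h2 (y - x)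
  rw [← this]; abel

theorem noe.ex [Fintype V] {g : V ≃ₗ[F] V} (hg : noe g) (v : V) : ∃ z, z + g⁻¹ z = v :=
  (Finite.injective_iff_surjective (f := fun z => z + g⁻¹ z)).1 (fun _ _ hxy => hg.inj h2 hxy) v

theorem form_unique [Fintype F] [FiniteDimensional F V] (h : Symp ω) {g : V ≃ₗ[F] V} (hg : g ∈ Sp ω) (hn : noe g) {Q Q' : V → F}
    (hQ : QF ω Q) (hQ' : QF ω Q') (h1 : ∀ v, Q (g v) = Q v) (h1' : ∀ v, Q' (g v) = Q' v) : ∀ v, Q' v = Q v := by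
  obtain ⟨w, hw⟩ := hQ.diff h2 h hQ'
  have : w = 0 := by
    apply hn.inv
    rw [← sub_eq_zero]
    by_contra hne
    obtain ⟨u, hu⟩ := h.nd' hne
    have e := hw (g u)
    rw [h1', h1, hw u, add_right_inj] at e
    have : (ω u w - ω (g u) w) ^ 2 = 0 := by linear_combination e + (ω (g u) w ^ 2 - ω u w * ω (g u) w) * h2
    have := pow_eq_zero_iff two_ne_zero |>.1 this
    rw [h.neg, map_sub, Sp_inv_right hg] at hu
    rw [sub_eq_zero.1 this] at hu
    simp at hu
  intro v; rw [hw, this]; simp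

theorem form_exists [Fintype F] [Fintype V] [FiniteDimensional F V] (h : Symp ω) {m : ℕ} (hm : Module.finrank F V = 2 * m)
    {g : V ≃ₗ[F] V} (hg : g ∈ Sp ω) (hn : noe g) : ∃ Q, QF ω Q ∧ ∀ v, Q (g v) = Q v := by
  obtain ⟨Q, hQ⟩ := QF.base h2 h hm
  have hQg : QF ω (fun v => Q (g v)) := ⟨fun c v => by simp only [map_smul, hQ.sm], fun u v => by simp only [map_add, hQ.ad, mem_Sp.1 hg]⟩
  obtain ⟨w, hw⟩ := hQ.diff h2 h hQg
  obtain ⟨x, hx⟩ := hn.ex h2 w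
  refine ⟨_, hQ.shift h2 x, fun v => ?_⟩
  have e1 : ω (g v) x = ω v (g⁻¹ x) := (Sp_inv_right hg _ _).symm
  have e2 := hw v
  rw [e2, e1, ← hx, map_add]
  linear_combination (ω v x * ω v (g⁻¹ x) + (ω v (g⁻¹ x)) ^ 2) * h2

end c2
end P6

section P7
open Classical Pointwise

variable {F V : Type} [Field F] [AddCommGroup V] [Module F V] {ω : V →ₗ[F] V →ₗ[F] F}
variable [Fintype F] [Fintype V] [Fintype (V ≃ₗ[F] V)]

/-- base form and transvection -/
theorem sign_tv [FiniteDimensional F V] (h2 : (2 : F) = 0) (h : Symp ω) {χ : F → ℤ} (hχ : Chi χ) {y : V ≃ₗ[F] V} (hy : y ∈ Sp ω)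
    {Q Q' : V → F} (hQ : QF ω Q) (hQ' : QF ω Q') (hyQ : ∀ v, Q (y v) = Q v) {v z : V} (hz : z + y⁻¹ z = v) (hz0 : Q z ≠ 0)
    {c : F} (hn : noe (y * tv h v c)) (hyQ' : ∀ x, Q' ((y * tv h v c) x) = Q' x) :
    1 + c * ω v z ≠ 0 ∧ ga χ Q' = χ (Q z * (c / (1 + c * ω v z))) * ga χ Q := by
  have hQ0 : Q 0 = 0 := by simpa using hQ.sm 0 0
  have hyz : y⁻¹ z = z + v := by
    rw [← hz, ← add_assoc, add_self_V h2, zero_add]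
  have hvz : Q v = ω v z := by
    have e1 : Q (y⁻¹ z) = Q z := by rw [← hyQ, le_inv_apply]
    rw [hyz, hQ.ad] at e1
    have e2 := h.neg v z
    linear_combination e1 - e2 + (-ω z v) * h2 + ω v z * h2 + ω z v * h2 - ω v z * h2
  have hne : 1 + c * ω v z ≠ 0 := by
    intro h0
    apply hz0
    have : z = 0 := by
      apply hn
      rw [LinearEquiv.mul_apply, tv_apply]
      have : c * ω v z = 1 := by linear_combination h0 - h2
      rw [this, one_smul, ← hyz, le_inv_apply]
    rw [this, hQ0]
  refine ⟨hne, ?_⟩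
  haveI : CharP F 2 := CharTwo.of_one_ne_zero_of_two_eq_zero one_ne_zero h2
  obtain ⟨κ, hκ⟩ : ∃ κ : F, κ ^ 2 = c / (1 + c * ω v z) := by
    have hinj : Function.Injective (fun a : F => a ^ 2) := by
      intro a b hab
      simp only at hab
      have : (a - b) ^ 2 = 0 := by linear_combination hab + (b ^ 2 - a * b) * h2
      exact sub_eq_zero.1 (pow_eq_zero_iff two_ne_zero |>.1 this)
    exact (Finite.injective_iff_surjective.1 hinj) _
  have hκ' : κ ^ 2 * (1 + c * ω v z) = c := by rw [hκ]; field_simp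
  have hpres : ∀ x, (fun x => Q x + ω x (κ • z) ^ 2) ((y * tv h v c) x) = (fun x => Q x + ω x (κ • z) ^ 2) x := by
    intro x
    simp only [LinearEquiv.mul_apply, hyQ]
    have e1 : ∀ u, ω (y u) (κ • z) = κ * (ω u z + ω u v) := by
      intro u
      rw [← Sp_inv_right hy, map_smul, hyz, map_smul, map_add, smul_eq_mul]
    rw [e1, tv_apply, hQ.ad, hQ.sm, hvz]
    simp only [map_add, map_smul, LinearMap.add_apply, LinearMap.smul_apply, smul_eq_mul, h.alt]
    rw [h.neg x v]
    linear_combination (ω v x^2*(1+c*ω v z))*hκ' + (c^2*ω v x^2*ω v z - 2*κ^2*ω v x^2*c*ω v z + κ^2*ω x z*ω v x*(c*ω v z-1))*h2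
  have hu := form_unique h2 h (mul_mem hy (tv_mem h v c)) hn hQ' (hQ.shift h2 (κ • z)) hyQ' hpres
  have : ga χ Q' = ga χ (fun x => Q x + ω x (κ • z) ^ 2) := by
    rw [ga, ga]; exact Finset.sum_congr rfl fun x _ => by rw [← hu x]
  rw [this, ga_shift h2 hχ hQ, hQ.sm, hκ, mul_comm (Q z)]

theorem zeros_le (h : Symp ω) {Q : V → F} (hQ : QF ω Q) {U : Submodule F V} (hU : ND ω U) (hne : ∃ u ∈ U, u ≠ 0) :
    (Finset.univ.filter (fun z => z ∈ U ∧ Q z = 0)).card * Fintype.card F ≤ 2 * (Finset.univ.filter (fun z => z ∈ U)).card := by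
  obtain ⟨u0, hu0, hq0⟩ : ∃ u ∈ U, Q u ≠ 0 := by
    by_contra hc
    push Not at hc
    obtain ⟨u, hu, h0⟩ := hne
    obtain ⟨v, hv, huv⟩ := hU u hu h0
    have := hQ.ad u v
    rw [hc _ (add_mem hu hv), hc _ hu, hc _ hv] at this
    apply huv; simpa using this.symm
  have h3 := Finset.sum_card_bipartiteAbove_eq_sum_card_bipartiteBelow
    (s := (Finset.univ : Finset F)) (t := Finset.univ.filter (fun z => z ∈ U)) (fun t z => Q (z + t • u0) = 0)
  simp only [Finset.bipartiteAbove, Finset.bipartiteBelow, Finset.filter_filter] at h3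
  have h4 : ∀ t ∈ (Finset.univ : Finset F), (Finset.univ.filter (fun z => z ∈ U ∧ Q (z + t • u0) = 0)).card =
      (Finset.univ.filter (fun z => z ∈ U ∧ Q z = 0)).card := by
    intro t _
    refine Finset.card_bij' (fun z _ => z + t • u0) (fun z _ => z - t • u0) ?_ ?_ ?_ ?_
    · intro z hz
      simp only [Finset.mem_filter, Finset.mem_univ, true_and] at hz ⊢
      exact ⟨add_mem hz.1 (U.smul_mem _ hu0), hz.2⟩
    · intro z hz
      simp only [Finset.mem_filter, Finset.mem_univ, true_and] at hz ⊢
      exact ⟨sub_mem hz.1 (U.smul_mem _ hu0), by simpa using hz.2⟩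
    · intro z _; simp
    · intro z _; simp
  rw [Finset.sum_congr rfl h4, Finset.sum_const, Finset.card_univ, smul_eq_mul, mul_comm] at h3
  rw [h3]
  refine (Finset.sum_le_sum (fun z _ => ?_)).trans (le_of_eq (by rw [Finset.sum_const, smul_eq_mul, mul_comm]))
  refine le_trans (le_of_eq ?_) (card_quad (Q u0) (ω z u0) (Q z) hq0)
  congr 1
  ext t
  simp only [Finset.mem_filter, Finset.mem_univ, true_and, hQ.ad, hQ.sm, map_smul, smul_eq_mul]
  constructor <;> intro hh <;> linear_combination hh

def sgn (ω : V →ₗ[F] V →ₗ[F] F) (χ : F → ℤ) (s : ℤ) (g : V ≃ₗ[F] V) : Prop :=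
  ∃ Q, QF ω Q ∧ (∀ v, Q (g v) = Q v) ∧ 0 < s * ga χ Q

theorem sign_count [FiniteDimensional F V] (h2 : (2 : F) = 0) (h : Symp ω) {χ : F → ℤ} (hχ : Chi χ)
    {St : Subgroup (V ≃ₗ[F] V)} {U : Submodule F V} (A : Act h St U) (hne : ∃ u ∈ U, u ≠ 0) (s : ℤ) :
    (cP St (fun g => noe g ∧ sgn ω χ s g) : ℝ) * (2 * (Fintype.card F - 2)) ≤ Fintype.card F * cG St := by
  let L : Finset (V × F) := (Finset.univ.filter (fun v => v ∈ U)) ×ˢ Finset.univ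
  let P : (V ≃ₗ[F] V) → V × F → Prop := fun g l => noe g ∧ ∃ Q z, QF ω Q ∧ (∀ v, Q (g v) = Q v) ∧ 0 < s * ga χ Q ∧
    z + g⁻¹ z = l.1 ∧ Q z ≠ 0
  set n : ℕ := (Finset.univ.filter (fun v => v ∈ U)).card with hn
  have hn0 : 0 < n := Finset.card_pos.2 ⟨0, by simp⟩
  have hmain := avg (E := V ≃ₗ[F] V) St L (fun l => tv h l.1 l.2) (fun l hl => A.tr _ (by simp [L] at hl; exact hl) _) P
    (n * Fintype.card F / 2) ?_
  · have hlow : (cP St (fun g => noe g ∧ sgn ω χ s g) : ℝ) * (Fintype.card F * (n - 2 * n / Fintype.card F)) ≤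
        ∑ l ∈ L, ((Finset.univ.filter (fun g => g ∈ St ∧ P g l)).card : ℝ) := by
      have h3 := Finset.sum_card_bipartiteAbove_eq_sum_card_bipartiteBelow
        (s := L) (t := Finset.univ.filter (fun g => g ∈ St)) (fun l g => P g l)
      simp only [Finset.bipartiteAbove, Finset.bipartiteBelow, Finset.filter_filter] at h3
      rw [← Nat.cast_sum, h3, Nat.cast_sum]
      have hsub : Finset.univ.filter (fun g => g ∈ St ∧ (noe g ∧ sgn ω χ s g)) ⊆ Finset.univ.filter (fun g => g ∈ St) := by
        intro g; simp only [Finset.mem_filter, Finset.mem_univ, true_and]; exact fun hh => hh.1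
      refine le_trans ?_ (Finset.sum_le_sum_of_subset_of_nonneg hsub (fun _ _ _ => Nat.cast_nonneg _))
      rw [cP, ← nsmul_eq_mul]
      refine le_trans (le_of_eq ?_) (Finset.card_nsmul_le_sum (Finset.univ.filter (fun g => g ∈ St ∧ (noe g ∧ sgn ω χ s g))) _ ((Fintype.card F:ℝ) * (n - 2 * n / Fintype.card F)) ?_)
      · congr!
      intro g hg
      simp only [Finset.mem_filter, Finset.mem_univ, true_and] at hg
      obtain ⟨hgS, hgn, Q, hQ, hgQ, hs⟩ := hg
      have hz := zeros_le h hQ A.nd hne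
      have hcard : (Finset.univ.filter (fun z => z ∈ U ∧ Q z ≠ 0)).card * Fintype.card F ≤ (L.filter (fun l => P g l)).card := by
        rw [← Finset.card_univ (α := F), ← Finset.card_product]
        refine Finset.card_le_card_of_injOn (fun t => (t.1 + g⁻¹ t.1, t.2)) ?_ ?_
        · rintro ⟨z, c⟩ ht
          simp only [Finset.coe_product, Finset.coe_filter, Finset.coe_univ, Finset.mem_univ, true_and, Set.mem_prod, Set.mem_setOf_eq, Set.mem_univ, and_true] at ht
          simp only [Finset.coe_filter, Set.mem_setOf_eq, L, Finset.mem_product, Finset.mem_filter, Finset.mem_univ, true_and, and_true, P]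
          exact ⟨add_mem ht.1 (A.pr _ (inv_mem hgS) _ ht.1), hgn, Q, z, hQ, hgQ, hs, rfl, ht.2⟩
        · rintro ⟨z, c⟩ _ ⟨z', c'⟩ _ hh
          simp only [Prod.mk.injEq] at hh
          rw [hgn.inj h2 hh.1, hh.2]
      have hsplit : (Finset.univ.filter (fun z => z ∈ U ∧ Q z = 0)).card + (Finset.univ.filter (fun z => z ∈ U ∧ Q z ≠ 0)).card = n := by
        rw [hn, ← Finset.card_filter_add_card_filter_not (s := Finset.univ.filter (fun v => v ∈ U)) (fun z => Q z = 0), Finset.filter_filter, Finset.filter_filter]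
      have hq : (0 : ℝ) < Fintype.card F := by exact_mod_cast Fintype.card_pos
      refine le_trans ?_ (Nat.cast_le.2 hcard)
      rw [← hn] at hz
      have hz' : ((Finset.univ.filter (fun z => z ∈ U ∧ Q z = 0)).card : ℝ) * Fintype.card F ≤ 2 * n := by exact_mod_cast hz
      have hsplit' : ((Finset.univ.filter (fun z => z ∈ U ∧ Q z = 0)).card : ℝ) + (Finset.univ.filter (fun z => z ∈ U ∧ Q z ≠ 0)).card = n := by exact_mod_cast hsplit
      rw [← le_div_iff₀ hq] at hz'
      push_cast
      rw [mul_comm]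
      exact mul_le_mul_of_nonneg_right (by linarith) hq.le
    have hq : (0 : ℝ) < Fintype.card F := by exact_mod_cast Fintype.card_pos
    have hnr : (0 : ℝ) < n := by exact_mod_cast hn0
    have := hlow.trans (le_trans (le_of_eq (by congr!)) hmain)
    have e1 : (Fintype.card F : ℝ) * (n - 2 * n / Fintype.card F) = n * (Fintype.card F - 2) := by field_simp
    rw [e1] at this
    have h5 : (n : ℝ) * ((cP St (fun g => noe g ∧ sgn ω χ s g) : ℝ) * (2 * (Fintype.card F - 2))) ≤ n * (Fintype.card F * cG St) := by
      have h6 : (n : ℝ) * Fintype.card F / 2 * (cG St : ℝ) * 2 = n * (Fintype.card F * cG St) := by ring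
      rw [← h6]
      calc _ = (cP St (fun g => noe g ∧ sgn ω χ s g) : ℝ) * (n * (Fintype.card F - 2)) * 2 := by ring
        _ ≤ _ := mul_le_mul_of_nonneg_right this (by norm_num)
    exact le_of_mul_le_mul_left h5 hnr
  · intro g hg
    have hper : ∀ v ∈ U, 2 * (Finset.univ.filter (fun c : F => P (g * tv h v c) (v, c))).card ≤ Fintype.card F := by
      intro v hv
      by_cases hex : ∃ c0, P (g * tv h v c0) (v, c0)
      · obtain ⟨c0, hn0, Q, z, hQ, hyQ, hs, hz, hz0⟩ := hex
        rw [← hχ.half]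
        apply Nat.mul_le_mul_left
        have hy : g * tv h v c0 ∈ Sp ω := A.sp (mul_mem hg (A.tr v hv c0))
        have hc : ∀ c, P (g * tv h v c) (v, c) → 1 + (c - c0) * ω v z ≠ 0 ∧ χ (Q z * ((c - c0) / (1 + (c - c0) * ω v z))) = 1 := by
          rintro c ⟨hn1, Q1, z1, hQ1, hyQ1, hs1, -, -⟩
          have e : g * tv h v c = (g * tv h v c0) * tv h v (c - c0) := by
            rw [mul_assoc, tv_mul]; congr 2; ring
          rw [e] at hn1 hyQ1
          obtain ⟨k1, k2⟩ := sign_tv h2 h hχ hy hQ hQ1 hyQ hz hz0 hn1 hyQ1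
          refine ⟨k1, ?_⟩
          rcases hχ.pm (Q z * ((c - c0) / (1 + (c - c0) * ω v z))) with k3 | k3
          · exact k3
          · exfalso; rw [k2, k3] at hs1; linarith
        refine Finset.card_le_card_of_injOn (fun c => Q z * ((c - c0) / (1 + (c - c0) * ω v z))) ?_ ?_
        · intro c hcc
          simp only [Finset.coe_filter, Finset.mem_univ, true_and, Set.mem_setOf_eq] at hcc ⊢
          exact (hc c hcc).2
        · intro c hcc d hdd hh
          simp only [Finset.coe_filter, Finset.mem_univ, true_and, Set.mem_setOf_eq] at hcc hdd
          have k1 := (hc c hcc).1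
          have k2 := (hc d hdd).1
          have k3 := mul_left_cancel₀ hz0 hh
          rw [div_eq_div_iff k1 k2] at k3
          linear_combination k3
      · push Not at hex
        simp [hex]
    have e : (L.filter (fun l => P (g * tv h l.1 l.2) l)).card = ∑ v ∈ Finset.univ.filter (fun v => v ∈ U),
        (Finset.univ.filter (fun c : F => P (g * tv h v c) (v, c))).card := by
      rw [Finset.card_filter, Finset.sum_product]
      refine Finset.sum_congr rfl fun v _ => ?_
      rw [Finset.card_filter]
    refine le_trans (le_of_eq (congrArg Nat.cast (Eq.trans (by congr!) e))) ?_
    rw [Nat.cast_sum]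
    calc _ ≤ ∑ v ∈ Finset.univ.filter (fun v => v ∈ U), (Fintype.card F : ℝ) / 2 := by
          refine Finset.sum_le_sum fun v hv => ?_
          have := hper v (by simpa using hv)
          have : (2 : ℝ) * (Finset.univ.filter (fun c : F => P (g * tv h v c) (v, c))).card ≤ Fintype.card F := by exact_mod_cast this
          linarith
      _ = _ := by rw [Finset.sum_const, nsmul_eq_mul, ← hn]; ring

end P7

section P8
open Classical Pointwise

variable {F V : Type} [Field F] [AddCommGroup V] [Module F V] {ω : V →ₗ[F] V →ₗ[F] F}
variable [Fintype F] [Fintype V] [Fintype (V ≃ₗ[F] V)]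

structure Yc (ω : V →ₗ[F] V →ₗ[F] F) (χ : F → ℤ) (m : ℕ) (g : V ≃ₗ[F] V) : Prop where
  eig : ∀ v, v ≠ 0 → ∀ a : F, g v ≠ a • v
  pl : 2 ≤ m → ∀ U, NDP ω U → ¬ ∀ v ∈ U, g v ∈ U
  tr : LinearMap.trace F V g.toLinearMap ≠ 0
  fm : 2 ≤ m → (2 : F) = 0 → ¬ sgn ω χ (-1) g

theorem w_bounds [FiniteDimensional F V] (h : Symp ω) {m : ℕ} (hm : Module.finrank F V = 2 * m) (hm1 : 1 ≤ m)
    {χ : F → ℤ} (h2 : (2 : F) = 0) (hχ : Chi χ) (hq : 100 ≤ Fintype.card F) {r : ℕ} {p : Fin r → Submodule F V}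
    (hr : r ≤ 3) (hp : Fr ω p) :
    (cP (Stb ω p) (fun g => noe g ∧ ¬ sgn ω χ (-1) g) : ℝ) ≤ (1 / 2 + 6 / Fintype.card F) * cG (Stb ω p) ∧
    (1 / 2 - 6 / Fintype.card F : ℝ) * cG (Stb ω p) ≤ (cP (Stb ω p) (fun g => noe g ∧ ¬ sgn ω χ (-1) g) : ℝ) := by
  obtain ⟨U, A, hne⟩ : ∃ U, Act h (Stb ω p) U ∧ ∃ u ∈ U, u ≠ 0 := by
    by_cases h0 : r = 0
    · subst h0
      refine ⟨_, Act.perp h hp, ?_⟩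
      haveI : Nontrivial V := Module.nontrivial_of_finrank_pos (R := F) (by omega)
      obtain ⟨v, hv⟩ := exists_ne (0 : V)
      exact ⟨v, fun i => i.elim0, hv⟩
    · refine ⟨_, Act.frame h hp ⟨0, by omega⟩, ?_⟩
      obtain ⟨e, f, hef, hU⟩ := hp.1 ⟨0, by omega⟩
      refine ⟨e, by rw [hU]; exact Submodule.subset_span (by simp), ?_⟩
      rintro rfl; simp at hef
  have s1 := sign_count h2 h hχ A hne 1
  have s2 := sign_count h2 h hχ A hne (-1)
  have s3 := frame_fix h hp
  have s4 : cG (Stb ω p) ≤ cP (Stb ω p) (fun g => noe g ∧ ¬ sgn ω χ (-1) g) +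
      (cP (Stb ω p) (fun g => noe g ∧ sgn ω χ (-1) g) + cP (Stb ω p) (fun g => ∃ x, x ≠ 0 ∧ g x = x)) := by
    rw [← cP_not (P := fun g => noe g ∧ ¬ sgn ω χ (-1) g)]
    refine Nat.add_le_add_left (le_trans (cP_mono ?_) cP_or) _
    intro g hg hh
    by_cases hn : noe g
    · left; exact ⟨hn, by tauto⟩
    · right; simp only [noe] at hn; push Not at hn; obtain ⟨x, hx⟩ := hn; exact ⟨x, hx.2, hx.1⟩
  have s5 : cP (Stb ω p) (fun g => noe g ∧ ¬ sgn ω χ (-1) g) ≤ cP (Stb ω p) (fun g => noe g ∧ sgn ω χ 1 g) := by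
    apply cP_mono
    rintro g hg ⟨hn, hs⟩
    refine ⟨hn, ?_⟩
    obtain ⟨Q, hQ, hgQ⟩ := form_exists h2 h hm (mem_Stb.1 hg).1 hn
    refine ⟨Q, hQ, hgQ, ?_⟩
    have : ga χ Q ≠ 0 := by
      intro h0
      have := ga_sq h2 h hχ hQ
      rw [h0] at this
      have h5 : 0 < Fintype.card V := Fintype.card_pos
      have h6 : (0:ℤ) < Fintype.card V := by exact_mod_cast h5
      rw [← this] at h6; simp at h6
    by_contra hc
    apply hs
    refine ⟨Q, hQ, hgQ, ?_⟩
    rcases lt_or_gt_of_ne this with h6 | h6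
    · linarith
    · exfalso; apply hc; linarith
  generalize hA : cP (Stb ω p) (fun g => noe g ∧ ¬ sgn ω χ (-1) g) = a at *
  generalize hB : cP (Stb ω p) (fun g => noe g ∧ sgn ω χ (-1) g) = b at *
  generalize hC : cP (Stb ω p) (fun g => noe g ∧ sgn ω χ 1 g) = c at *
  generalize hD : cP (Stb ω p) (fun g => ∃ x, x ≠ 0 ∧ g x = x) = d at *
  generalize hN : cG (Stb ω p) = n at *
  generalize hQ : Fintype.card F = q at *
  have hqr : (100 : ℝ) ≤ q := by exact_mod_cast hq
  have s3' : (d : ℝ) * (q - 1) ≤ 4 * n := by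
    have : d * (q - 1) ≤ 4 * n := s3.trans (Nat.mul_le_mul_right _ (by omega))
    have h6 : ((q - 1 : ℕ) : ℝ) = q - 1 := by rw [Nat.cast_sub (by omega)]; simp
    rw [← h6]; exact_mod_cast this
  have s4' : (n : ℝ) ≤ a + (b + d) := by exact_mod_cast s4
  have s5' : (a : ℝ) ≤ c := by exact_mod_cast s5
  have hn0 : (0 : ℝ) ≤ n := Nat.cast_nonneg _
  have key : ∀ b : ℝ, b * (2 * (q - 2)) ≤ q * n → b ≤ (1 / 2 + 1.1 / q) * n := by
    intro b hb
    have h1 : b ≤ q * n / (2 * (q - 2)) := by rw [le_div_iff₀ (by linarith)]; exact hb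
    refine h1.trans ?_
    rw [div_le_iff₀ (by linarith)]
    have h7 : (q : ℝ) ≤ (1 / 2 + 1.1 / q) * (2 * (q - 2)) := by
      have e : (1 / 2 + 1.1 / (q:ℝ)) * (2 * (q - 2)) = q + (0.2 - 4.4 / q) := by field_simp; ring
      rw [e]
      have : 4.4 / (q:ℝ) ≤ 0.2 := by rw [div_le_iff₀ (by linarith)]; linarith
      linarith
    nlinarith
  have k1 := key c s1
  have k2 := key b s2
  have k3 : (d : ℝ) ≤ 4.5 / q * n := by
    have h1 : (d : ℝ) ≤ 4 * n / (q - 1) := by rw [le_div_iff₀ (by linarith)]; exact s3'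
    refine h1.trans ?_
    rw [div_le_iff₀ (by linarith)]
    have h7 : (4 : ℝ) ≤ 4.5 / q * (q - 1) := by
      have e : 4.5 / (q:ℝ) * (q - 1) = 4 + (0.5 - 4.5 / q) := by field_simp; ring
      rw [e]
      have : 4.5 / (q:ℝ) ≤ 0.5 := by rw [div_le_iff₀ (by linarith)]; linarith
      linarith
    nlinarith
  have e1 : 1.1 / (q:ℝ) = 1.1 * (1 / q) := by ring
  have e2 : 4.5 / (q:ℝ) = 4.5 * (1 / q) := by ring
  have e3 : 6 / (q:ℝ) = 6 * (1 / q) := by ring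
  have hi : (0:ℝ) ≤ 1 / q * n := by positivity
  rw [e1] at k1 k2; rw [e2] at k3; rw [e3]
  constructor <;> nlinarith

theorem eig_cases [FiniteDimensional F V] (h : Symp ω) {g : V ≃ₗ[F] V} (hg : g ∈ Sp ω) {v : V} (hv : v ≠ 0) {a : F} (e : g v = a • v) :
    ((∃ x ∈ (⊤ : Submodule F V), x ≠ 0 ∧ g x = (1:F) • x) ∨ (∃ x ∈ (⊤ : Submodule F V), x ≠ 0 ∧ g x = (-1:F) • x)) ∨
    ((∃ (a : F) (v w : V), a ≠ 0 ∧ v ≠ 0 ∧ (∀ c : F, w ≠ c • v) ∧ ω v w = 0 ∧ g v = a • v ∧ g w = a⁻¹ • w) ∨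
    (∃ (a : F) (v w : V), a ≠ 0 ∧ a ≠ a⁻¹ ∧ ω v w = 1 ∧ g v = a • v ∧ g w = a⁻¹ • w)) := by
  obtain ⟨ha, w, hw, ew⟩ := inv_eig h hg hv e
  by_cases h1 : a = 1
  · left; left; exact ⟨v, trivial, hv, by rw [e, h1]⟩
  by_cases h2 : a = -1
  · left; right; exact ⟨v, trivial, hv, by rw [e, h2]⟩
  have h3 : a ≠ a⁻¹ := by
    intro h3
    have : (a - 1) * (a + 1) = 0 := by
      have : a * a = 1 := by nth_rewrite 2 [h3]; exact mul_inv_cancel₀ ha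
      linear_combination this
    rcases mul_eq_zero.1 this with h4 | h4
    · exact h1 (sub_eq_zero.1 h4)
    · exact h2 (by linear_combination h4)
  right
  by_cases h4 : ω v w = 0
  · left
    refine ⟨a, v, w, ha, hv, ?_, h4, e, ew⟩
    rintro c rfl
    rw [map_smul, e, smul_smul, smul_smul, mul_comm] at ew
    have hc : c ≠ 0 := by rintro rfl; simp at hw
    have := smul_left_injective F hv ew
    exact h3 (mul_right_cancel₀ hc this)
  · right
    refine ⟨a, v, (ω v w)⁻¹ • w, ha, h3, ?_, e, ?_⟩
    · rw [map_smul, smul_eq_mul, inv_mul_cancel₀ h4]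
    · rw [map_smul, ew, smul_comm]

theorem Y_count [FiniteDimensional F V] [Fintype (Submodule F V)] (h : Symp ω) {m : ℕ} (hm : Module.finrank F V = 2 * m) (hm1 : 1 ≤ m)
    {χ : F → ℤ} (hχ : (2 : F) = 0 → Chi χ) (hq : 100 ≤ Fintype.card F) :
    (1 / 6 - (50 * m) / Fintype.card F : ℝ) * cG (Sp ω) ≤ (cP (Sp ω) (Yc ω χ m) : ℝ) := by
  haveI : Nontrivial V := Module.nontrivial_of_finrank_pos (R := F) (by omega)
  have b1 := (Act.top h).eig (a := 1) one_ne_zero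
  have b2 := (Act.top h).eig (a := -1) (neg_ne_zero.2 one_ne_zero)
  have b3 := iso_count h
  have b4 := trace_count h
  have b5 := hyp_count h
  have hq0 : (0 : ℝ) < Fintype.card F := by exact_mod_cast Fintype.card_pos
  have main : ∃ W : (V ≃ₗ[F] V) → Prop, (1 / 6 - (40 * m) / Fintype.card F : ℝ) * cG (Sp ω) ≤ (cP (Sp ω) W : ℝ) ∧
      cP (Sp ω) W ≤ cP (Sp ω) (Yc ω χ m) + ((cP (Sp ω) (fun g => ∃ x ∈ (⊤ : Submodule F V), x ≠ 0 ∧ g x = (1:F) • x) +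
       cP (Sp ω) (fun g => ∃ x ∈ (⊤ : Submodule F V), x ≠ 0 ∧ g x = (-1:F) • x)) +
       (cP (Sp ω) (fun g => ∃ (a : F) (v w : V), a ≠ 0 ∧ v ≠ 0 ∧ (∀ c : F, w ≠ c • v) ∧ ω v w = 0 ∧ g v = a • v ∧ g w = a⁻¹ • w) +
       cP (Sp ω) (fun g => LinearMap.trace F V g.toLinearMap = 0))) := by
    have hq' : (0:ℝ) ≤ cG (Sp ω) := Nat.cast_nonneg _
    by_cases hm2 : 2 ≤ m
    · refine ⟨fun g => ((2 : F) = 0 → noe g ∧ ¬ sgn ω χ (-1) g) ∧ ∀ U, NDP ω U → ¬ ∀ v ∈ U, g v ∈ U, ?_, ?_⟩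
      · by_cases h2 : (2 : F) = 0
        · have := plane_count h hm hm2 (fun g => ((2 : F) = 0 → noe g ∧ ¬ sgn ω χ (-1) g)) (1 / 2) (6 / Fintype.card F) (by norm_num) (by positivity)
            (fun r p hr hp => by
              simp only [h2, forall_true_left]
              exact (w_bounds h hm hm1 h2 (hχ h2) hq hr hp).1)
            (fun r p hr hp => by
              simp only [h2, forall_true_left]
              exact (w_bounds h hm hm1 h2 (hχ h2) hq hr hp).2)
          refine le_trans (mul_le_mul_of_nonneg_right ?_ hq') this
          have hmr : (2 : ℝ) ≤ m := by exact_mod_cast hm2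
          have e : (1 / 2 / 3 - 3 * (6 / (Fintype.card F:ℝ)) - 3 * (2 * m + 1) / Fintype.card F) = 1 / 6 - (6 * m + 21) / Fintype.card F := by ring
          rw [e]
          gcongr
          linarith
        · have := plane_count h hm hm2 (fun g => ((2 : F) = 0 → noe g ∧ ¬ sgn ω χ (-1) g)) 1 0 (by norm_num) (by norm_num)
            (fun r p hr hp => by
              simp only [h2, false_imp_iff, add_zero, one_mul, Nat.cast_le]
              apply Finset.card_le_card
              intro g; simp)
            (fun r p hr hp => by
              simp only [h2, false_imp_iff, sub_zero, one_mul, Nat.cast_le]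
              apply Finset.card_le_card
              intro g; simp)
          refine le_trans (mul_le_mul_of_nonneg_right ?_ hq') this
          have hmr : (2 : ℝ) ≤ m := by exact_mod_cast hm2
          have e : (1 / 3 - 3 * 0 - 3 * (2 * m + 1) / (Fintype.card F:ℝ)) = 1 / 3 - (6 * m + 3) / Fintype.card F := by ring
          rw [e]
          gcongr
          · norm_num
          · linarith
      · refine le_trans (cP_mono ?_) (cP_or.trans (Nat.add_le_add_left (cP_or.trans (Nat.add_le_add cP_or cP_or)) _))
        rintro g hg ⟨h5, h6⟩
        by_contra hc
        simp only [not_or] at hc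
        refine hc.1 ⟨?_, fun _ => h6, hc.2.2.2, fun _ h2 => (h5 h2).2⟩
        intro v hv a e
        rcases eig_cases h hg hv e with (h7 | h7) | h7 | ⟨b, x, y, hb, hbb, hxy, ex, ey⟩
        · exact hc.2.1.1 h7
        · exact hc.2.1.2 h7
        · exact hc.2.2.1 h7
        · refine h6 _ ⟨x, y, hxy, rfl⟩ ?_
          intro z hz
          obtain ⟨s, t, rfl⟩ := mem_sp_pair.1 hz
          rw [map_add, map_smul, map_smul, ex, ey]
          exact mem_sp_pair.2 ⟨s * b, t * b⁻¹, by simp [smul_smul]⟩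
    · refine ⟨fun g => ¬ (∃ (a : F) (v w : V), a ≠ 0 ∧ a ≠ a⁻¹ ∧ ω v w = 1 ∧ g v = a • v ∧ g w = a⁻¹ • w), ?_, ?_⟩
      · have h6 := cP_not (St := Sp ω) (P := (fun g => ∃ (a : F) (v w : V), a ≠ 0 ∧ a ≠ a⁻¹ ∧ ω v w = 1 ∧ g v = a • v ∧ g w = a⁻¹ • w))
        have h7 : (cG (Sp ω) : ℝ) ≤ 2 * (cP (Sp ω) (fun g => ¬ ∃ (a : F) (v w : V), a ≠ 0 ∧ a ≠ a⁻¹ ∧ ω v w = 1 ∧ g v = a • v ∧ g w = a⁻¹ • w) : ℕ) := by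
          have h9 : ∀ a b c : ℕ, a + b = c → 2 * a ≤ c → (c:ℝ) ≤ 2 * (b : ℕ) := by
            intro a b c h1 h2; exact_mod_cast (by omega : c ≤ 2 * b)
          exact h9 _ _ _ h6 b5
        have h8 : (0 : ℝ) ≤ (40 * m) / Fintype.card F := by positivity
        nlinarith
      · refine le_trans (cP_mono ?_) (cP_or.trans (Nat.add_le_add_left (cP_or.trans (Nat.add_le_add cP_or cP_or)) _))
        intro g hg h5
        by_contra hc
        simp only [not_or] at hc
        refine hc.1 ⟨?_, fun hh => absurd hh hm2, hc.2.2.2, fun hh => absurd hh hm2⟩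
        intro v hv a e
        rcases eig_cases h hg hv e with (h7 | h7) | h7 | h7
        · exact hc.2.1.1 h7
        · exact hc.2.1.2 h7
        · exact hc.2.2.1 h7
        · exact h5 h7
  obtain ⟨W, w1, w2⟩ := main
  generalize cP (Sp ω) (fun g => ∃ x ∈ (⊤ : Submodule F V), x ≠ 0 ∧ g x = (1:F) • x) = a at *
  generalize cP (Sp ω) (fun g => ∃ x ∈ (⊤ : Submodule F V), x ≠ 0 ∧ g x = (-1:F) • x) = b at *
  generalize cP (Sp ω) (fun g => ∃ (a : F) (v w : V), a ≠ 0 ∧ v ≠ 0 ∧ (∀ c : F, w ≠ c • v) ∧ ω v w = 0 ∧ g v = a • v ∧ g w = a⁻¹ • w) = c at *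
  generalize cP (Sp ω) (fun g => LinearMap.trace F V g.toLinearMap = 0) = d at *
  generalize cP (Sp ω) (Yc ω χ m) = y at *
  generalize cP (Sp ω) W = w at *
  generalize cG (Sp ω) = n at *
  generalize Fintype.card F = q at *
  have hqr : (100 : ℝ) ≤ q := by exact_mod_cast hq
  have hmr : (1 : ℝ) ≤ m := by exact_mod_cast hm1
  have key : ∀ b : ℕ, b * (q - 1) ≤ n → (b : ℝ) ≤ 2 / q * n := by
    intro b hb
    have h6 : ((q - 1 : ℕ) : ℝ) = q - 1 := by rw [Nat.cast_sub (by omega)]; simp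
    have hb' : (b : ℝ) * (q - 1) ≤ n := by rw [← h6]; exact_mod_cast hb
    have hbb : (0 : ℝ) ≤ b := Nat.cast_nonneg _
    have e : 2 / (q:ℝ) * n = 2 * n / q := by ring
    rw [e, le_div_iff₀ (by linarith)]
    nlinarith
  have k1 := key _ b1
  have k2 := key _ b2
  have k3 := key _ b3
  have k4 : (d : ℝ) ≤ 2 / q * n := by
    have e : 2 / (q:ℝ) * n = 2 * n / q := by ring
    rw [e, le_div_iff₀ (by linarith)]
    exact_mod_cast b4
  have w2' : (w : ℝ) ≤ y + ((a + b) + (c + d)) := by exact_mod_cast w2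
  have e1 : (50 * m : ℝ) / q = 50 * m * (1 / q) := by ring
  have e2 : (40 * m : ℝ) / q = 40 * m * (1 / q) := by ring
  have e3 : (2 : ℝ) / q = 2 * (1 / q) := by ring
  have hi : (0:ℝ) ≤ 1 / q * n := by positivity
  rw [e1]; rw [e2] at w1; rw [e3] at k1 k2 k3 k4
  nlinarith

end P8

section P9
open Classical Pointwise

variable {F V : Type} [Field F] [AddCommGroup V] [Module F V] {ω : V →ₗ[F] V →ₗ[F] F}

/-- H contains the torus element with parameter a of the pair (u,u') -/
def Tor (ω : V →ₗ[F] V →ₗ[F] F) (H : Subgroup (V ≃ₗ[F] V)) (u u' : V) (a : F) : Prop :=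
  ∃ g ∈ H, ∀ v, g v = v + ((a - 1) * ω v u') • u + ((a⁻¹ - 1) * ω u v) • u'

theorem Tor.map {H : Subgroup (V ≃ₗ[F] V)} (hH : H ≤ Sp ω) {u u' : V} {a : F} (T : Tor ω H u u' a) {k : V ≃ₗ[F] V} (hk : k ∈ H) :
    Tor ω H (k u) (k u') a := by
  obtain ⟨g, hg, e⟩ := T
  refine ⟨k * g * k⁻¹, mul_mem (mul_mem hk hg) (inv_mem hk), fun v => ?_⟩
  rw [LinearEquiv.mul_apply, LinearEquiv.mul_apply, e, map_add, map_add, map_smul, map_smul, le_inv_apply,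
    Sp_inv_left (hH hk), Sp_inv_right (hH hk)]

theorem Tor.swap (h : Symp ω) {H : Subgroup (V ≃ₗ[F] V)} {u u' : V} {a : F} (T : Tor ω H u u' a) : Tor ω H u' (-u) a⁻¹ := by
  obtain ⟨g, hg, e⟩ := T
  refine ⟨g, hg, fun v => ?_⟩
  rw [e, map_neg, ← h.neg, h.neg v u', inv_inv]
  module

theorem Tor.scale {H : Subgroup (V ≃ₗ[F] V)} {u u' : V} {a c : F} (hc : c ≠ 0) (T : Tor ω H u u' a) : Tor ω H (c • u) (c⁻¹ • u') a := by
  obtain ⟨g, hg, e⟩ := T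
  refine ⟨g, hg, fun v => ?_⟩
  rw [e]
  simp only [map_smul, LinearMap.smul_apply, smul_smul, smul_eq_mul]
  have e1 : (a - 1) * (c⁻¹ * ω v u') * c = (a - 1) * ω v u' := by field_simp
  have e2 : (a⁻¹ - 1) * (c * ω u v) * c⁻¹ = (a⁻¹ - 1) * ω u v := by field_simp
  rw [e1, e2]

def pk (ω : V →ₗ[F] V →ₗ[F] F) (u u' z : V) : V := z - ω z u' • u - ω u z • u'

theorem perp_nd (h : Symp ω) {u u' z : V} (h1 : ω u u' = 1) (hz : pk ω u u' z ≠ 0) :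
    ∃ k, ω k u = 0 ∧ ω k u' = 0 ∧ ω k z ≠ 0 := by
  obtain ⟨x, hx⟩ := h.nd' hz
  have h2 : ω u' u = -1 := by rw [h.neg, h1]
  refine ⟨pk ω u u' x, ?_, ?_, ?_⟩
  · simp only [pk, map_sub, map_smul, LinearMap.sub_apply, LinearMap.smul_apply, smul_eq_mul, h.alt, h2]
    rw [h.neg x u]; ring
  · simp only [pk, map_sub, map_smul, LinearMap.sub_apply, LinearMap.smul_apply, smul_eq_mul, h.alt, h1]
    ring
  · have : ω (pk ω u u' x) z = - ω (pk ω u u' z) x := by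
      simp only [pk, map_sub, map_smul, LinearMap.sub_apply, LinearMap.smul_apply, smul_eq_mul]
      rw [h.neg x z, h.neg x u', h.neg z u']; ring
    rw [this, hx]; simp

structure PrS (ω : V →ₗ[F] V →ₗ[F] F) (H : Subgroup (V ≃ₗ[F] V)) (A : Finset F) (Pr : V → V → Prop) : Prop where
  one : ∀ u u', Pr u u' → ω u u' = 1
  sw : ∀ u u', Pr u u' → Pr u' (-u)
  act : ∀ u u', Pr u u' → ∀ g ∈ H, Pr (g u) (g u')
  sc : ∀ u u', Pr u u' → ∀ c : F, c ≠ 0 → Pr (c • u) (c⁻¹ • u')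
  tor : ∀ u u', Pr u u' → ∀ a ∈ A, Tor ω H u u' a
  uq : ∀ u u' v v', Pr u u' → Pr v v' → ∀ c : F, v = c • u → v' = c⁻¹ • u'
  A0 : (0 : F) ∉ A

variable {H : Subgroup (V ≃ₗ[F] V)} {A : Finset F} {Pr : V → V → Prop}

theorem PrS.caseA (h : Symp ω) (P : PrS ω H A Pr) {u u' v v' : V} (hu : Pr u u') (hv : Pr v v') (h0 : ω u v = 0)
    (ha : ω v u' = 0) (hA : 2 ≤ A.card) : ω u v' = 0 ∧ ω v' u' = 0 := by
  obtain ⟨a, haA, ha1⟩ := Finset.exists_mem_ne (by omega : 1 < A.card) (1 : F)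
  obtain ⟨g, hg, e⟩ := P.tor u u' hu a haA
  have e1 : g v = v := by rw [e, ha, h0]; simp
  have e2 := P.uq v v' _ _ hv (P.act v v' hv g hg) 1 (by rw [e1, one_smul])
  have a0 : a ≠ 0 := by rintro rfl; exact P.A0 haA
  rw [inv_one, one_smul, e] at e2
  have h1 := P.one u u' hu
  have e3 := congrArg (fun z => ω u z) e2
  have e4 := congrArg (fun z => ω z u') e2
  simp only [map_add, map_smul, LinearMap.add_apply, LinearMap.smul_apply, smul_eq_mul, h.alt, h1] at e3 e4
  have a2 : a⁻¹ - 1 ≠ 0 := by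
    intro h5
    apply ha1
    have := sub_eq_zero.1 h5
    rw [inv_eq_one] at this
    exact this
  have a3 : a - 1 ≠ 0 := sub_ne_zero.2 ha1
  constructor
  · have : (a⁻¹ - 1) * ω u v' = 0 := by linear_combination e3
    exact (mul_eq_zero.1 this).resolve_left a2
  · have : (a - 1) * ω v' u' = 0 := by linear_combination e4
    exact (mul_eq_zero.1 this).resolve_left a3

theorem PrS.L1 [Fintype F] (h : Symp ω) (P : PrS ω H A Pr) {u u' v v' : V} (hu : Pr u u') (hv : Pr v v') (h0 : ω u v = 0)
    (hA : 3 * Fintype.card F < A.card * (A.card - 2)) :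
    (∃ c : F, v = c • u) ∨ (ω v u' = 0 ∧ ω u v' = 0 ∧ ω v' u' = 0) := by
  have hA3 : 3 ≤ A.card := by by_contra hc; rw [show A.card - 2 = 0 by omega] at hA; simp at hA
  by_cases hα : ω v u' = 0
  · right; exact ⟨hα, P.caseA h hu hv h0 hα (by omega)⟩
  by_cases hδ : ω u v' = 0
  · exfalso
    have := (P.caseA h hv hu (by rw [h.neg, h0, neg_zero]) hδ (by omega)).1
    exact hα this
  by_cases hw : pk ω u u' v = 0
  · left
    refine ⟨ω v u', ?_⟩
    rw [pk, h0] at hw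
    simpa [sub_eq_zero] using hw
  exfalso
  have h1 := P.one u u' hu
  have h1' := P.one v v' hv
  set α := ω v u' with hαd
  set δ := ω u v' with hδd
  have hvu : ω v u = 0 := by rw [h.neg, h0, neg_zero]
  have hu'v : ω u' v = -α := by rw [h.neg]
  choose! s hsH hs using P.tor u u' hu
  choose! t htH ht using P.tor v v' hv
  have ne0 : ∀ a ∈ A, a ≠ 0 := by rintro a ha rfl; exact P.A0 ha
  let A' := A.filter (fun d => d ≠ 1 ∧ 1 + (d - 1) * (α * δ) ≠ 0)
  have hX : α * δ ≠ 0 := mul_ne_zero hα hδ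
  have hA' : A.card - 2 ≤ A'.card := by
    have : A ⊆ A' ∪ {1, 1 - (α * δ)⁻¹} := by
      intro d hd
      by_cases hd1 : d = 1
      · simp [hd1]
      by_cases hd2 : 1 + (d - 1) * (α * δ) = 0
      · have : d = 1 - (α * δ)⁻¹ := by field_simp; linear_combination hd2
        rw [← this]; simp
      · simp only [A', Finset.mem_union, Finset.mem_filter]
        left; exact ⟨hd, hd1, hd2⟩
    have h3 := (Finset.card_le_card this).trans (Finset.card_union_le _ _)
    have h4 : ({1, 1 - (α * δ)⁻¹} : Finset F).card ≤ 2 := Finset.card_le_two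
    omega
  -- formula
  have form : ∀ a ∈ A, ∀ d ∈ A', s a (t d u) = (a * (1 + (d - 1) * (α * δ))) • u + ((d - 1) * δ) • pk ω u u' v := by
    intro a ha d hd
    simp only [A', Finset.mem_filter] at hd
    rw [hs a ha, ht d hd.1]
    simp only [map_add, map_smul, LinearMap.add_apply, LinearMap.smul_apply, smul_eq_mul, h.alt, h1, hvu, h0, ← hαd, ← hδd, pk]
    module
  have uK : ∀ a ∈ A, ∀ d ∈ A', ω u (s a (t d u')) = a⁻¹ * (1 + (d⁻¹ - 1) * (α * δ)) := by
    intro a ha d hd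
    simp only [A', Finset.mem_filter] at hd
    rw [hs a ha, ht d hd.1]
    simp only [map_add, map_smul, LinearMap.add_apply, LinearMap.smul_apply, smul_eq_mul, h.alt, h1, hvu, h0, ← hαd, ← hδd]
    ring
  have kK : ∀ k, ω k u = 0 → ω k u' = 0 → ∀ a ∈ A, ∀ d ∈ A', ω k (s a (t d u')) = (d - 1) * ω u' v' * ω k v + (d⁻¹ - 1) * α * ω k v' := by
    intro k hk hk' a ha d hd
    simp only [A', Finset.mem_filter] at hd
    rw [hs a ha, ht d hd.1]
    simp only [map_add, map_smul, LinearMap.add_apply, LinearMap.smul_apply, smul_eq_mul, h.alt, h1, hvu, h0, ← hαd, ← hδd, hk, hk']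
    ring
  let f : F × F → F := fun x => x.1 * (1 + (x.2 - 1) * (α * δ)) / (x.2 - 1)
  have hcard := Finset.card_le_mul_card_image_of_maps_to (s := A ×ˢ A') (t := (Finset.univ : Finset F)) (f := f) (by simp) 3 ?_
  · rw [Finset.card_product, Finset.card_univ] at hcard
    have := Nat.mul_le_mul_left A.card hA'
    omega
  intro c _
  rcases Finset.eq_empty_or_nonempty ((A ×ˢ A').filter (fun x => f x = c)) with he | ⟨⟨a1, d1⟩, hr⟩
  · rw [he]; simp
  simp only [Finset.mem_filter, Finset.mem_product, f] at hr
  obtain ⟨⟨ha1, hd1⟩, hr⟩ := hr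
  have hd1' := hd1
  simp only [A', Finset.mem_filter] at hd1'
  have d1n := sub_ne_zero.2 hd1'.2.1
  have inj : Set.InjOn (fun x : F × F => x.2) ((A ×ˢ A').filter (fun x => f x = c)) := by
    rintro ⟨a, d⟩ hx ⟨a', d'⟩ hx' (rfl : d = d')
    simp only [Finset.coe_filter, Set.mem_setOf_eq, Finset.mem_product, A', Finset.mem_filter, f] at hx hx'
    have e := hx.2.trans hx'.2.symm
    have dn := sub_ne_zero.2 hx.1.2.2.1
    rw [div_left_inj' dn] at e
    rw [mul_right_cancel₀ hx.1.2.2.2 e]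
  suffices hp : ∃ p : Polynomial F, p ≠ 0 ∧ p.natDegree ≤ 3 ∧ ∀ x ∈ (A ×ˢ A').filter (fun x => f x = c), p.eval x.2 = 0 by
    obtain ⟨p, hp0, hp3, hpr⟩ := hp
    refine le_trans (Finset.card_le_card_of_injOn (fun x : F × F => x.2) ?_ inj) (card_root p hp0 3 hp3)
    intro x hx
    simp only [Finset.coe_filter, Finset.mem_univ, true_and, Set.mem_setOf_eq]
    exact hpr x hx
  have part : ∀ x ∈ (A ×ˢ A').filter (fun x => f x = c), (x.2 - 1) • s x.1 (t x.2 u') = (d1 - 1) • s a1 (t d1 u') := by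
    rintro ⟨a, d⟩ hx
    simp only [Finset.mem_filter, Finset.mem_product, f] at hx
    obtain ⟨⟨ha, hd⟩, hx⟩ := hx
    have hd' := hd
    simp only [A', Finset.mem_filter] at hd'
    have dn := sub_ne_zero.2 hd'.2.1
    have := P.uq _ _ _ _ (P.act _ _ (P.act _ _ hu _ (htH d1 hd1'.1)) _ (hsH a1 ha1)) (P.act _ _ (P.act _ _ hu _ (htH d hd'.1)) _ (hsH a ha))
      ((d - 1) / (d1 - 1)) ?_
    · simp only at this ⊢
      rw [this, smul_smul]
      congr 1; field_simp
    · rw [form a ha d hd, form a1 ha1 d1 hd1, smul_add, smul_smul, smul_smul]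
      have e := hx.trans hr.symm
      congr 2
      · rw [div_eq_div_iff dn d1n] at e
        field_simp; linear_combination e
      · field_simp
  by_cases hX1 : α * δ = 1
  · obtain ⟨k, hk, hk', hne⟩ : ∃ k, ω k u = 0 ∧ ω k u' = 0 ∧ (ω u' v' * ω k v ≠ 0 ∨ ω k v' ≠ 0) := by
      by_cases hw' : pk ω u u' v' = 0
      · by_cases hγ : ω u' v' = 0
        · exfalso
          apply hw
          have e : v' = δ • u' := by
            have : ω v' u' = 0 := by rw [h.neg, hγ, neg_zero]
            rw [pk, this, ← hδd] at hw'
            simpa [sub_eq_zero] using hw'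
          have e2 := P.uq _ _ _ _ (P.sw _ _ hu) (P.sw _ _ hv) _ e
          rw [smul_neg, neg_inj] at e2
          rw [pk, h0, ← hαd, e2, eq_inv_of_mul_eq_one_left hX1]; simp
        · obtain ⟨k, h3, h4, h5⟩ := perp_nd h h1 hw
          exact ⟨k, h3, h4, Or.inl (mul_ne_zero hγ h5)⟩
      · obtain ⟨k, h3, h4, h5⟩ := perp_nd h h1 hw'
        exact ⟨k, h3, h4, Or.inr h5⟩
    set κ := ω u' v' * ω k v with hκ
    set μ := ω k v' with hμ
    set C := (d1 - 1) * ((d1 - 1) * ω u' v' * ω k v + (d1⁻¹ - 1) * α * ω k v') with hC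
    refine ⟨(Polynomial.X - 1) ^ 2 * (Polynomial.C κ * Polynomial.X - Polynomial.C (α * μ)) - Polynomial.C C * Polynomial.X, ?_, ?_, ?_⟩
    · intro hp
      have e0 := congrArg (fun p => Polynomial.coeff p 0) hp
      have e3 := congrArg (fun p => Polynomial.coeff p 3) hp
      obtain ⟨p2, p1, e4⟩ : ∃ p2 p1 : F, ((Polynomial.X - 1) ^ 2 * (Polynomial.C κ * Polynomial.X - Polynomial.C (α * μ)) - Polynomial.C C * Polynomial.X : Polynomial F) =
        Polynomial.C κ * Polynomial.X ^ 3 + Polynomial.C p2 * Polynomial.X ^ 2 + Polynomial.C p1 * Polynomial.X + Polynomial.C (-(α * μ)) := by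
        refine ⟨-(κ + κ) - α * μ, κ + (α * μ + α * μ) - C, ?_⟩
        simp only [Polynomial.C_add, Polynomial.C_sub, Polynomial.C_mul, Polynomial.C_neg]
        ring
      rw [e4] at e0 e3
      simp [Polynomial.coeff_X, Polynomial.coeff_C] at e0 e3
      rcases hne with h5 | h5
      · exact h5 e3
      · exact e0.elim hα h5
    · compute_degree
    · intro x hx
      have e := congrArg (fun z => ω k z) (part x hx)
      simp only [Finset.mem_filter, Finset.mem_product] at hx
      simp only [map_smul, smul_eq_mul] at e
      rw [kK k hk hk' _ hx.1.1 _ hx.1.2, kK k hk hk' _ ha1 _ hd1, ← hC] at e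
      have hd' := hx.1.2
      simp only [A', Finset.mem_filter] at hd'
      have x0 := ne0 _ hd'.1
      simp only [Polynomial.eval_sub, Polynomial.eval_mul, Polynomial.eval_pow, Polynomial.eval_X, Polynomial.eval_one, Polynomial.eval_C]
      rw [← e, hκ, hμ]
      field_simp
      ring
  · set Z := d1 + d1⁻¹ with hZ
    refine ⟨Polynomial.X ^ 2 - Polynomial.C Z * Polynomial.X + 1, ?_, ?_, ?_⟩
    · intro hp
      have e3 := congrArg (fun p => Polynomial.coeff p 2) hp
      simp [Polynomial.coeff_X, Polynomial.coeff_one] at e3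
    · have : (Polynomial.X ^ 2 - Polynomial.C Z * Polynomial.X + 1 : Polynomial F).natDegree ≤ 2 := by compute_degree
      omega
    · intro x hx
      have e := congrArg (fun z => ω u z) (part x hx)
      simp only [Finset.mem_filter, Finset.mem_product] at hx
      simp only [map_smul, smul_eq_mul] at e
      rw [uK _ hx.1.1 _ hx.1.2, uK _ ha1 _ hd1] at e
      have hd' := hx.1.2
      simp only [A', Finset.mem_filter] at hd'
      have x0 := ne0 _ hd'.1
      have x1 := ne0 _ hx.1.1
      have y0 := ne0 _ hd1'.1
      have y1 := ne0 _ ha1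
      have e2 := hx.2.trans hr.symm
      have dn := sub_ne_zero.2 hd'.2.1
      simp only [f] at e2
      have e3 : (1 + (x.2 - 1) * (α * δ)) * (1 + (x.2⁻¹ - 1) * (α * δ)) = (1 + (d1 - 1) * (α * δ)) * (1 + (d1⁻¹ - 1) * (α * δ)) := by
        have l1 : (1 + (x.2 - 1) * (α * δ)) * (1 + (x.2⁻¹ - 1) * (α * δ)) =
          (x.1 * (1 + (x.2 - 1) * (α * δ)) / (x.2 - 1)) * ((x.2 - 1) * (x.1⁻¹ * (1 + (x.2⁻¹ - 1) * (α * δ)))) := by field_simp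
        have l2 : (1 + (d1 - 1) * (α * δ)) * (1 + (d1⁻¹ - 1) * (α * δ)) =
          (a1 * (1 + (d1 - 1) * (α * δ)) / (d1 - 1)) * ((d1 - 1) * (a1⁻¹ * (1 + (d1⁻¹ - 1) * (α * δ)))) := by field_simp
        rw [l1, l2, e, e2]
      have i1 : x.2 * x.2⁻¹ = 1 := mul_inv_cancel₀ x0
      have i2 : d1 * d1⁻¹ = 1 := mul_inv_cancel₀ y0
      have e4 : (α * δ) * (1 - α * δ) * (x.2 + x.2⁻¹ - Z) = 0 := by
        rw [hZ]
        linear_combination e3 - (α * δ)^2 * i1 + (α * δ)^2 * i2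
      have e5 : x.2 + x.2⁻¹ = Z := by
        rcases mul_eq_zero.1 e4 with h6 | h6
        · rcases mul_eq_zero.1 h6 with h7 | h7
          · exact absurd h7 hX
          · exact absurd (sub_eq_zero.1 h7).symm hX1
        · exact sub_eq_zero.1 h6
      simp only [Polynomial.eval_add, Polynomial.eval_sub, Polynomial.eval_mul, Polynomial.eval_pow, Polynomial.eval_X, Polynomial.eval_one, Polynomial.eval_C]
      rw [← e5]
      linear_combination -i1

end P9

section P10
open Classical Pointwise

variable {F V : Type} [Field F] [AddCommGroup V] [Module F V] {ω : V →ₗ[F] V →ₗ[F] F}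

theorem perm_trace [FiniteDimensional F V] (y : V ≃ₗ[F] V) (𝒩 : Set (Submodule F V)) (hy : ∀ N ∈ 𝒩, N.map y.toLinearMap ∈ 𝒩)
    (hne : ∀ N ∈ 𝒩, N.map y.toLinearMap ≠ N) (hi : sSupIndep 𝒩) (ht : sSup 𝒩 = ⊤) : LinearMap.trace F V y.toLinearMap = 0 := by
  have hi' : iSupIndep (fun N : 𝒩 => (N : Submodule F V)) := (sSupIndep_iff _).1 hi
  have hint : DirectSum.IsInternal (fun N : 𝒩 => (N : Submodule F V)) :=
    DirectSum.isInternal_submodule_of_iSupIndep_of_iSup_eq_top hi' (by rw [← sSup_eq_iSup', ht])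
  refine LinearMap.trace_eq_zero_of_mapsTo_ne hint (fun N => ⟨_, hy N.1 N.2⟩) (fun N hN => hne N.1 N.2 (congrArg Subtype.val hN)) ?_
  intro N x hx
  exact Submodule.mem_map_of_mem hx

variable {H : Subgroup (V ≃ₗ[F] V)} {A : Finset F} {Pr : V → V → Prop}
variable [Fintype F] [Fintype V]

theorem PrS.T_card [FiniteDimensional F V] (P : PrS ω H A Pr)
    (hL : ∀ u u' v v', Pr u u' → Pr v v' → ω u v = 0 → (∃ c : F, v = c • u) ∨ (ω v u' = 0))
    (Λ : Submodule F V) (hΛ : ∀ u ∈ Λ, ∀ v ∈ Λ, ω u v = 0) :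
    (Finset.univ.filter (fun v => (∃ v', Pr v v') ∧ v ∈ Λ)).card ≤ Module.finrank F Λ * (Fintype.card F - 1) := by
  set T := Finset.univ.filter (fun v => (∃ v', Pr v v') ∧ v ∈ Λ) with hT
  have hne : ∀ v ∈ T, v ≠ 0 := by
    rintro v hv rfl
    simp only [hT, Finset.mem_filter, Finset.mem_univ, true_and] at hv
    obtain ⟨⟨v', hv'⟩, _⟩ := hv
    have := P.one _ _ hv'
    simp at this
  have h1 := Finset.card_le_mul_card_image (f := fun v : V => Submodule.span F {v}) T (Fintype.card F - 1) ?_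
  · refine h1.trans ?_
    rw [mul_comm]
    apply Nat.mul_le_mul_right
    have hex : ∀ L : (T.image fun v : V => Submodule.span F {v}), ∃ v v', Pr v v' ∧ v ∈ Λ ∧ Submodule.span F {v} = L.1 := by
      rintro ⟨L, hL⟩
      obtain ⟨v, hv, rfl⟩ := Finset.mem_image.1 hL
      simp only [hT, Finset.mem_filter, Finset.mem_univ, true_and] at hv
      obtain ⟨⟨v', hv'⟩, hv2⟩ := hv
      exact ⟨v, v', hv', hv2, rfl⟩
    choose r r' hr hrΛ hrL using hex
    have li : LinearIndependent F (fun L => (⟨r L, hrΛ L⟩ : Λ)) := by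
      rw [Fintype.linearIndependent_iff]
      intro c hc L
      have hc' := congrArg (fun z : Λ => ω z.1 (r' L)) hc
      simp only [Submodule.coe_sum, Submodule.coe_smul, map_sum, map_smul, LinearMap.sum_apply, LinearMap.smul_apply, smul_eq_mul,
        Submodule.coe_zero, map_zero, LinearMap.zero_apply] at hc'
      rw [Finset.sum_eq_single L] at hc'
      · rwa [P.one _ _ (hr L), mul_one] at hc'
      · intro M _ hM
        rcases hL _ _ _ _ (hr L) (hr M) (hΛ _ (hrΛ L) _ (hrΛ M)) with ⟨d, hd⟩ | h3
        · exfalso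
          apply hM
          have hd0 : d ≠ 0 := by
            rintro rfl
            have := P.one _ _ (hr M)
            rw [hd] at this; simp at this
          apply Subtype.ext
          rw [← hrL, ← hrL, hd]
          exact Submodule.span_singleton_smul_eq (IsUnit.mk0 d hd0) _
        · rw [h3, mul_zero]
      · simp
    have := li.fintype_card_le_finrank
    rwa [Fintype.card_coe] at this
  · intro L hL
    obtain ⟨v, hv, rfl⟩ := Finset.mem_image.1 hL
    have : Fintype.card F - 1 = (Finset.univ.filter (fun c : F => c ≠ 0)).card := by
      rw [Finset.filter_ne', Finset.card_erase_of_mem (Finset.mem_univ _), Finset.card_univ]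
    rw [this]
    refine le_trans (Finset.card_le_card ?_) (Finset.card_image_le (f := fun c : F => c • v))
    intro z hz
    simp only [Finset.mem_filter] at hz
    have hz1 : z ∈ Submodule.span F {v} := by rw [← hz.2]; exact Submodule.mem_span_singleton_self z
    obtain ⟨c, rfl⟩ := Submodule.mem_span_singleton.1 hz1
    simp only [Finset.mem_image, Finset.mem_filter, Finset.mem_univ, true_and]
    refine ⟨c, ?_, rfl⟩
    rintro rfl
    exact hne _ hz.1 (by simp)

theorem PrS.O_card [FiniteDimensional F V] [Fintype (V ≃ₗ[F] V)] (h : Symp ω) {m : ℕ} (hm : Module.finrank F V = 2 * m) (hm1 : 1 ≤ m) (P : PrS ω H A Pr)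
    (hL : ∀ u u' v v', Pr u u' → Pr v v' → ω u v = 0 → (∃ c : F, v = c • u) ∨ (ω v u' = 0)) :
    (Finset.univ.filter (fun v => ∃ v', Pr v v')).card ≤ m * (Fintype.card F - 1) * (Fintype.card F ^ m + 1) := by
  set O := Finset.univ.filter (fun v => ∃ v', Pr v v') with hO
  obtain ⟨e, f, Hy⟩ := h.exists_hyp hm
  set Λ : Submodule F V := Submodule.span F (Set.range (fun i : Fin m => e i)) with hΛd
  have lie : LinearIndependent F (fun i : Fin m => e i) := (Hy.li h).comp Sum.inl Sum.inl_injective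
  have hΛr : Module.finrank F Λ = m := by
    rw [hΛd, finrank_span_eq_card lie, Fintype.card_fin]
  have hΛ : ∀ u ∈ Λ, ∀ v ∈ Λ, ω u v = 0 := by
    intro u hu v hv
    induction hu using Submodule.span_induction with
    | mem x hx =>
      obtain ⟨i, rfl⟩ := hx
      induction hv using Submodule.span_induction with
      | mem x hx => obtain ⟨j, rfl⟩ := hx; exact Hy.ee _ i.2 _ j.2
      | zero => simp
      | add x y _ _ h1 h2 => simp [h1, h2]
      | smul c x _ h1 => simp [h1]
    | zero => simp
    | add x y _ _ h1 h2 => simp [h1, h2]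
    | smul c x _ h1 => simp [h1]
  have h3 := Finset.sum_card_bipartiteAbove_eq_sum_card_bipartiteBelow
    (s := Finset.univ.filter (fun g => g ∈ Sp ω)) (t := O) (fun (g : V ≃ₗ[F] V) v => g v ∈ Λ)
  simp only [Finset.bipartiteAbove, Finset.bipartiteBelow, Finset.filter_filter] at h3
  have h4 : ∀ g ∈ Finset.univ.filter (fun g => g ∈ Sp ω), (O.filter (fun v => g v ∈ Λ)).card ≤ m * (Fintype.card F - 1) := by
    intro g hg
    simp only [Finset.mem_filter, Finset.mem_univ, true_and] at hg
    have hmem : ∀ v, v ∈ Λ.map (g⁻¹ : V ≃ₗ[F] V).toLinearMap ↔ g v ∈ Λ := by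
      intro v
      rw [Submodule.mem_map]
      constructor
      · rintro ⟨x, hx, rfl⟩; simpa using hx
      · intro hv; exact ⟨g v, hv, by simp⟩
    have := P.T_card hL (Λ.map (g⁻¹ : V ≃ₗ[F] V).toLinearMap) (by
      intro u hu v hv
      rw [← mem_Sp.1 hg]; exact hΛ _ ((hmem u).1 hu) _ ((hmem v).1 hv))
    have e5 : Module.finrank F (Λ.map (g⁻¹ : V ≃ₗ[F] V).toLinearMap) = m := by
      rw [LinearEquiv.finrank_map_eq, hΛr]
    rw [e5] at this
    refine le_trans (le_of_eq ?_) this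
    congr 1
    ext v
    simp only [hO, Finset.mem_filter, Finset.mem_univ, true_and, hmem]
  have h5 : ∀ v ∈ O, (Finset.univ.filter (fun g : V ≃ₗ[F] V => g ∈ Sp ω ∧ g v ∈ Λ)).card * (Fintype.card F ^ (2 * m) - 1) =
      (Fintype.card F ^ m - 1) * cG (Sp ω) := by
    intro v hv
    simp only [hO, Finset.mem_filter, Finset.mem_univ, true_and] at hv
    obtain ⟨v', hv'⟩ := hv
    have hv0 : v ≠ 0 := by rintro rfl; have := P.one _ _ hv'; simp at this
    have e1 : (nzU (⊤ : Submodule F V)).card = Fintype.card F ^ (2 * m) - 1 := by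
      rw [← hm, ← Module.card_eq_pow_finrank (K := F) (V := V)]
      have : nzU (⊤ : Submodule F V) = Finset.univ.erase 0 := by ext x; simp [mem_nzU]
      rw [this, Finset.card_erase_of_mem (Finset.mem_univ _), Finset.card_univ]
    have e2 : (nzU Λ).card = Fintype.card F ^ m - 1 := by
      rw [← hΛr, ← Module.card_eq_pow_finrank (K := F) (V := Λ)]
      have : nzU Λ = (Finset.univ.filter (fun x => x ∈ Λ)).erase 0 := by ext x; simp [mem_nzU, and_comm]
      rw [this, Finset.card_erase_of_mem (by simp), Fintype.card_subtype]
    have e3 : Finset.univ.filter (fun g : V ≃ₗ[F] V => g ∈ Sp ω ∧ g v ∈ Λ) =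
        (nzU Λ).biUnion (fun x => Finset.univ.filter (fun g : V ≃ₗ[F] V => g ∈ Sp ω ∧ g v = x)) := by
      ext g
      simp only [Finset.mem_filter, Finset.mem_univ, true_and, Finset.mem_biUnion, mem_nzU]
      constructor
      · rintro ⟨h1, h2⟩; exact ⟨g v, ⟨h2, by simpa using hv0⟩, h1, rfl⟩
      · rintro ⟨x, h1, h2, rfl⟩; exact ⟨h2, h1.1⟩
    rw [e3, Finset.card_biUnion, Finset.sum_mul, ← e1, Finset.sum_congr rfl (g := fun _ => cG (Sp ω)), Finset.sum_const, e2, smul_eq_mul]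
    · intro x hx
      rw [mem_nzU] at hx
      exact (Act.top h).fib trivial trivial hv0 hx.2
    · intro x _ z _ hxz
      rw [Function.onFun, Finset.disjoint_left]
      intro g hg hg'
      simp only [Finset.mem_filter, Finset.mem_univ, true_and] at hg hg'
      exact hxz (hg.2.symm.trans hg'.2)
  have h6 := Finset.sum_le_sum h4
  rw [h3, Finset.sum_const, smul_eq_mul] at h6
  have h7 := Nat.mul_le_mul_right (Fintype.card F ^ (2 * m) - 1) h6
  rw [Finset.sum_mul, Finset.sum_congr rfl h5, Finset.sum_const, smul_eq_mul] at h7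
  have hG : 0 < cG (Sp ω) := Finset.card_pos.2 ⟨1, by simp [one_mem]⟩
  have hq1 : 1 < Fintype.card F := Fintype.one_lt_card
  have hqm : 0 < Fintype.card F ^ m - 1 := Nat.sub_pos_of_lt (Nat.one_lt_pow (by omega) hq1)
  have e8 : Fintype.card F ^ (2 * m) - 1 = (Fintype.card F ^ m - 1) * (Fintype.card F ^ m + 1) := by
    rw [mul_comm 2 m, pow_mul, mul_comm, ← Nat.sq_sub_sq, one_pow]
  rw [e8] at h7
  have h9 : O.card * ((Fintype.card F ^ m - 1) * cG (Sp ω)) ≤ (m * (Fintype.card F - 1) * (Fintype.card F ^ m + 1)) * ((Fintype.card F ^ m - 1) * cG (Sp ω)) := by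
    calc _ ≤ _ := h7
      _ = _ := by ring
  exact Nat.le_of_mul_le_mul_right h9 (Nat.mul_pos hqm hG)

end P10

section P11
open Classical Pointwise

variable {F V : Type} [Field F] [AddCommGroup V] [Module F V] {ω : V →ₗ[F] V →ₗ[F] F}
variable {H : Subgroup (V ≃ₗ[F] V)} {A : Finset F} {Pr : V → V → Prop}

theorem PrS.L3 [Fintype F] [Fintype V] (h : Symp ω) (P : PrS ω H A Pr) (hH : H ≤ Sp ω) {e f v v' : V} (hu : Pr e f) (hv : Pr v v')
    (hβ : ω e v ≠ 0) (hδ : ω e v' ≠ 0) (hα : ω v f ≠ 0) (hγ : ω v' f ≠ 0) (B : Finset (V ≃ₗ[F] V))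
    (hB : ∀ b ∈ B, b ∈ H ∧ b e = e ∧ b f = f) (D : Finset F) (hDA : D ⊆ A)
    (hD : ∀ d ∈ D, d ^ 2 ≠ 1 ∧ 1 + (d - 1) * (ω e v' * ω v f) - (d⁻¹ - 1) * (ω e v * ω v' f) ≠ 0 ∧
      ∀ b ∈ B, ∀ b' ∈ B, b (((d - 1) * ω e v') • pk ω e f v - ((d⁻¹ - 1) * ω e v) • pk ω e f v') =
        b' (((d - 1) * ω e v') • pk ω e f v - ((d⁻¹ - 1) * ω e v) • pk ω e f v') → b = b')
    (R : V → Prop) (hR : ∀ b ∈ B, ∀ p q r s c : F, R (c • b (p • e + q • f + r • v + s • v'))) :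
    (Fintype.card F - 1) * (B.card * (A.card * D.card)) ≤ 8 * (Finset.univ.filter (fun x => (∃ x', Pr x x') ∧ R x)).card := by
  have h1 := P.one e f hu
  have h1' := P.one v v' hv
  have hfe : ω f e = -1 := by rw [h.neg, h1]
  have hve : ω v e = -ω e v := h.neg _ _
  have hfv' : ω f v' = -ω v' f := h.neg _ _
  choose! s hsH hs using P.tor e f hu
  choose! t htH ht using P.tor v v' hv
  have ne0 : ∀ a ∈ A, a ≠ 0 := by rintro a ha rfl; exact P.A0 ha
  set α := ω v f
  set β := ω e v
  set γ := ω v' f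
  set δ := ω e v'
  let k : F → V := fun d => ((d - 1) * δ) • pk ω e f v - ((d⁻¹ - 1) * β) • pk ω e f v'
  let αd : F → F := fun d => 1 + (d - 1) * (δ * α) - (d⁻¹ - 1) * (β * γ)
  have form : ∀ a ∈ A, ∀ d ∈ A, s a (t d e) = (a * αd d) • e + (a⁻¹ * (β * δ * (d - d⁻¹))) • f + k d := by
    intro a ha d hd
    rw [hs a ha, ht d hd]
    simp only [map_add, map_smul, LinearMap.add_apply, LinearMap.smul_apply, smul_eq_mul, h.alt, h1, hve, pk, k, αd]
    change e + _ + _ + ((a - 1) * (1 + (d - 1) * δ * α + (d⁻¹ - 1) * -β * γ)) • e + ((a⁻¹ - 1) * (0 + (d - 1) * δ * β + (d⁻¹ - 1) * -β * δ)) • f = _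
    module
  have form' : ∀ a ∈ A, ∀ d ∈ A, ω (s a (t d f)) f = a * (- (α * γ) * (d - d⁻¹)) := by
    intro a ha d hd
    rw [hs a ha, ht d hd]
    simp only [map_add, map_smul, LinearMap.add_apply, LinearMap.smul_apply, smul_eq_mul, h.alt, h1, hfv']
    change 0 + (d - 1) * -γ * α + (d⁻¹ - 1) * α * γ + (a - 1) * (0 + (d - 1) * -γ * α + (d⁻¹ - 1) * α * γ) * 1 + _ * 0 = _
    ring
  have kp : ∀ x, ω e (pk ω e f x) = 0 ∧ ω (pk ω e f x) f = 0 := by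
    intro x
    constructor <;> simp [pk, h.alt, h1]
  have kd : ∀ d, ω e (k d) = 0 ∧ ω (k d) f = 0 := by
    intro d
    constructor <;> simp [k, (kp v).1, (kp v).2, (kp v').1, (kp v').2]
  let X : F × (V ≃ₗ[F] V) × F × F → V := fun i => i.1 • i.2.1 (s i.2.2.1 (t i.2.2.2 e))
  let I := (Finset.univ.erase (0 : F)) ×ˢ (B ×ˢ (A ×ˢ D))
  have hI : ∀ i, i ∈ I ↔ i.1 ≠ 0 ∧ i.2.1 ∈ B ∧ i.2.2.1 ∈ A ∧ i.2.2.2 ∈ D := by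
    intro i; simp [I, Finset.mem_product]
  have hPr : ∀ i ∈ I, Pr (X i) (i.1⁻¹ • i.2.1 (s i.2.2.1 (t i.2.2.2 f))) := by
    intro i hi
    obtain ⟨i1, i2, i3, i4⟩ := (hI i).1 hi
    exact P.sc _ _ (P.act _ _ (P.act _ _ (P.act _ _ hu _ (htH _ (hDA i4))) _ (hsH _ i3)) _ (hB _ i2).1) _ i1
  have c1 : ∀ b ∈ B, ∀ x, ω e (b x) = ω e x := fun b hb x => by
    conv_lhs => rw [← (hB b hb).2.1, mem_Sp.1 (hH (hB b hb).1)]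
  have c2 : ∀ b ∈ B, ∀ x, ω (b x) f = ω x f := fun b hb x => by
    conv_lhs => rw [← (hB b hb).2.2, mem_Sp.1 (hH (hB b hb).1)]
  have E : ∀ i ∈ I, ω e (X i) = i.1 * (i.2.2.1⁻¹ * (β * δ * (i.2.2.2 - i.2.2.2⁻¹))) ∧ ω (X i) f = i.1 * (i.2.2.1 * αd i.2.2.2) ∧
      ω (i.1⁻¹ • i.2.1 (s i.2.2.1 (t i.2.2.2 f))) f = i.1⁻¹ * (i.2.2.1 * (- (α * γ) * (i.2.2.2 - i.2.2.2⁻¹))) := by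
    intro i hi
    obtain ⟨i1, i2, i3, i4⟩ := (hI i).1 hi
    simp only [X, map_smul, LinearMap.smul_apply, smul_eq_mul, c1 _ i2, c2 _ i2, form' _ i3 _ (hDA i4), form _ i3 _ (hDA i4)]
    simp [h.alt, h1, (kd _).1, (kd _).2]
  have hcard := Finset.card_le_mul_card_image_of_maps_to (s := I) (t := Finset.univ.filter (fun x => (∃ x', Pr x x') ∧ R x)) (f := X) ?_ 8 ?_
  · rw [Finset.card_product, Finset.card_product, Finset.card_product, Finset.card_erase_of_mem (Finset.mem_univ _), Finset.card_univ] at hcard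
    exact hcard
  · intro i hi
    obtain ⟨i1, i2, i3, i4⟩ := (hI i).1 hi
    rw [Finset.mem_filter]; refine ⟨Finset.mem_univ _, ?_⟩
    refine ⟨⟨_, hPr i hi⟩, ?_⟩
    have e2 : ∃ p q r w : F, s i.2.2.1 (t i.2.2.2 e) = p • e + q • f + r • v + w • v' := by
      rw [hs _ i3]
      generalize (i.2.2.1 - 1) * _ = y1
      generalize (i.2.2.1⁻¹ - 1) * _ = y2
      rw [ht _ (hDA i4)]
      generalize (i.2.2.2 - 1) * _ = y3
      generalize (i.2.2.2⁻¹ - 1) * _ = y4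
      exact ⟨1 + y1, y2, y3, y4, by module⟩
    obtain ⟨p, q, r, w, e2⟩ := e2
    simp only [X, e2]
    exact hR _ i2 _ _ _ _ _
  intro x hx
  rcases Finset.eq_empty_or_nonempty (I.filter (fun i => X i = x)) with he | ⟨j, hj⟩
  · rw [he]; simp
  rw [Finset.mem_filter] at hj
  obtain ⟨hj, rfl⟩ := hj
  obtain ⟨E1, E2, E3⟩ := E j hj
  have dne : ∀ d ∈ D, d - d⁻¹ ≠ 0 := by
    intro d hd h0
    have := ne0 d (hDA hd)
    apply (hD d hd).1
    field_simp at h0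
    linear_combination h0
  set k1 := ω e (X j)
  set k2 := ω (X j) f
  set c := (j.2.2.2 - j.2.2.2⁻¹) ^ 2 with hc
  have k10 : k1 ≠ 0 := by
    obtain ⟨i1, i2, i3, i4⟩ := (hI j).1 hj
    rw [E1]
    exact mul_ne_zero i1 (mul_ne_zero (inv_ne_zero (ne0 _ i3)) (mul_ne_zero (mul_ne_zero hβ hδ) (dne _ i4)))
  have U : (Finset.univ.filter (fun d : F => (Polynomial.X ^ 4 - Polynomial.C (2 + c) * Polynomial.X ^ 2 + 1 : Polynomial F).eval d = 0)).card ≤ 4 := by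
    apply card_root _ _ _ (by compute_degree)
    intro hp
    have e3 := congrArg (Polynomial.eval 0) hp
    simp at e3
  set U4 := Finset.univ.filter (fun d : F => (Polynomial.X ^ 4 - Polynomial.C (2 + c) * Polynomial.X ^ 2 + 1 : Polynomial F).eval d = 0) with hU4
  have U2 : ((U4.filter (· ∈ D)).biUnion (fun d => (Finset.univ.filter (fun a : F => αd d * k1 * a ^ 2 + 0 * a + (-(k2 * (β * δ * (d - d⁻¹)))) = 0)).image
      (fun a => (a, d)))).card ≤ (U4.filter (· ∈ D)).card * 2 := by
    apply Finset.card_biUnion_le_card_mul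
    intro d hd
    rw [Finset.mem_filter] at hd
    exact Finset.card_image_le.trans (card_quad _ _ _ (mul_ne_zero (hD d hd.2).2.1 k10))
  have U3 := Finset.card_le_card (Finset.filter_subset (· ∈ D) U4)
  refine le_trans (Finset.card_le_card_of_injOn (fun i : F × (V ≃ₗ[F] V) × F × F => i.2.2) ?_ ?_) (U2.trans (by omega))
  · intro i hi
    simp only [Finset.coe_filter, Set.mem_setOf_eq] at hi
    obtain ⟨hi, hij⟩ := hi
    obtain ⟨i1, i2, i3, i4⟩ := (hI i).1 hi
    obtain ⟨D1, D2, D3⟩ := E i hi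
    have e5 := P.uq _ _ _ _ (hPr j hj) (hPr i hi) 1 (by rw [one_smul, hij])
    rw [inv_one, one_smul] at e5
    rw [e5, E3] at D3
    rw [hij] at D1 D2
    change k1 = _ at D1
    change k2 = _ at D2
    have a0 := ne0 _ i3
    have d0 := ne0 _ (hDA i4)
    have e6 : (i.2.2.2 - i.2.2.2⁻¹) ^ 2 = c := by
      obtain ⟨j1, j2, j3, j4⟩ := (hI j).1 hj
      have b0 := ne0 _ j3
      have d0 := ne0 _ (hDA j4)
      have l := congrArg₂ (· * ·) (E1.symm.trans D1) D3
      have l2 : (β * δ * α * γ) * (i.2.2.2 - i.2.2.2⁻¹) ^ 2 = (β * δ * α * γ) * c := by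
        rw [hc]
        have r1 : ∀ l a d : F, l ≠ 0 → a ≠ 0 → l * (a⁻¹ * (β * δ * d)) * (l⁻¹ * (a * (-(α * γ) * d))) = - ((β * δ * α * γ) * d ^ 2) := by
          intro l a d hl ha
          field_simp
        rw [r1 _ _ _ j1 b0, r1 _ _ _ i1 a0] at l
        exact (neg_inj.1 l).symm
      exact mul_left_cancel₀ (mul_ne_zero (mul_ne_zero (mul_ne_zero hβ hδ) hα) hγ) l2
    simp only [Finset.coe_biUnion, Set.mem_iUnion, Finset.coe_image, Set.mem_image, Finset.coe_filter, Set.mem_setOf_eq, hU4, Finset.mem_filter, Finset.mem_univ, true_and]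
    refine ⟨i.2.2.2, ⟨?_, i4⟩, i.2.2.1, ?_, rfl⟩
    · simp
      rw [← e6]; field_simp; ring
    · rw [D1, D2]; field_simp; ring
  · rintro ⟨l, b, a, d⟩ hi ⟨l', b', a', d'⟩ hi' hh
    obtain ⟨rfl, rfl⟩ := Prod.mk.inj hh
    simp only [Finset.coe_filter, Set.mem_setOf_eq] at hi hi'
    obtain ⟨i1, i2, i3, i4⟩ := (hI _).1 hi.1
    obtain ⟨i1', i2', i3', i4'⟩ := (hI _).1 hi'.1
    simp only at i1 i2 i3 i4 i1' i2' i3' i4'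
    have D1 := (E _ hi.1).2.1
    have D1' := (E _ hi'.1).2.1
    rw [hi.2] at D1
    rw [hi'.2, D1] at D1'
    simp only at D1'
    have ll := mul_right_cancel₀ (mul_ne_zero (ne0 _ i3) (hD d i4).2.1) D1'
    subst ll
    have e7 := hi.2.trans hi'.2.symm
    simp only [X, form _ i3 _ (hDA i4)] at e7
    have e8 := smul_right_injective _ i1 e7
    simp only [map_add, map_smul, (hB _ i2).2.1, (hB _ i2).2.2, (hB _ i2').2.1, (hB _ i2').2.2, add_right_inj] at e8
    rw [(hD d i4).2.2 b i2 b' i2' e8]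

end P11

section P12
open Classical Pointwise

variable {F V : Type} [Field F] [AddCommGroup V] [Module F V] {ω : V →ₗ[F] V →ₗ[F] F}

theorem pk_K (h : Symp ω) {e f : V} (h1 : ω e f = 1) (x : V) : ω e (pk ω e f x) = 0 ∧ ω f (pk ω e f x) = 0 := by
  have hfe : ω f e = -1 := by rw [h.neg, h1]
  constructor
  · simp [pk, h.alt, h1]
  · simp only [pk, map_sub, map_smul, smul_eq_mul, h.alt, hfe]; rw [h.neg f x]; ring

theorem pk_eq (e f x : V) : x = ω x f • e + ω e x • f + pk ω e f x := by simp [pk]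

structure GD [Fintype F] (ω : V →ₗ[F] V →ₗ[F] F) (H : Subgroup (V ≃ₗ[F] V)) (e f : V) (A : Finset F) (B : Finset (V ≃ₗ[F] V)) (m : ℕ) : Prop where
  hH : H ≤ Sp ω
  ef : ω e f = 1
  A0 : (0 : F) ∉ A
  A1 : (1 : F) ∈ A
  Am : ∀ a ∈ A, ∀ b ∈ A, a * b ∈ A
  Ai : ∀ a ∈ A, a⁻¹ ∈ A
  tor : ∀ a ∈ A, Tor ω H e f a
  B1 : ∀ b ∈ B, b ∈ H ∧ b e = e ∧ b f = f
  Bf : ∀ b ∈ B, ∀ b' ∈ B, ∀ k, ω e k = 0 → ω f k = 0 → k ≠ 0 → b k = b' k → b = b'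
  Bi : ∀ U : Submodule F V, (∀ u ∈ U, ω e u = 0 ∧ ω f u = 0) → (∀ b ∈ B, ∀ u ∈ U, b u ∈ U) → (∃ u ∈ U, u ≠ 0) →
    ∀ k, ω e k = 0 → ω f k = 0 → k ∈ U
  n1 : 8 * m * (Fintype.card F ^ m + 1) < A.card * (A.card - 5) * B.card
  n2 : 8 * (Fintype.card F + 1) < A.card * (A.card - 5)
  n3 : (∃ k, (ω e k = 0 ∧ ω f k = 0) ∧ k ≠ 0) → 2 ≤ B.card

variable {H : Subgroup (V ≃ₗ[F] V)} {A : Finset F} {e f : V} {B : Finset (V ≃ₗ[F] V)} {m : ℕ} [Fintype F]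

theorem GD.swap (h : Symp ω) (G : GD ω H e f A B m) : GD ω H f (-e) A B m where
  hH := G.hH
  ef := by rw [map_neg, ← h.neg, G.ef]
  A0 := G.A0
  A1 := G.A1
  Am := G.Am
  Ai := G.Ai
  tor a ha := by simpa using (G.tor _ (G.Ai a ha)).swap h
  B1 b hb := ⟨(G.B1 b hb).1, (G.B1 b hb).2.2, by rw [map_neg, (G.B1 b hb).2.1]⟩
  Bf b hb b' hb' k h1 h2 := G.Bf b hb b' hb' k (by simpa using h2) h1
  Bi U h1 h2 h3 k hk hk' := G.Bi U (fun u hu => ⟨by simpa using (h1 u hu).2, (h1 u hu).1⟩) h2 h3 k (by simpa using hk') hk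
  n1 := G.n1
  n2 := G.n2
  n3 := fun ⟨k, ⟨h1, h2⟩, h3⟩ => G.n3 ⟨k, ⟨by simpa using h2, h1⟩, h3⟩

theorem GD.exA (G : GD ω H e f A B m) : ∃ a ∈ A, a ≠ 0 ∧ a ^ 2 ≠ 1 := by
  by_contra hc
  push Not at hc
  have : A ⊆ {1, -1} := by
    intro a ha
    have := hc a ha (by rintro rfl; exact G.A0 ha)
    rw [sq, mul_self_eq_one_iff] at this
    simpa using this
  have h2 := (Finset.card_le_card this).trans Finset.card_le_two
  have := G.n2
  rw [show A.card - 5 = 0 by omega] at this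
  omega

theorem GD.irr1 (h : Symp ω) (G : GD ω H e f A B m) {y : V ≃ₗ[F] V} (hy : y ∈ H)
    (hpl : (∃ k, ω e k = 0 ∧ ω f k = 0 ∧ k ≠ 0) → ¬ ∀ v ∈ Submodule.span F {e, f}, y v ∈ Submodule.span F {e, f})
    (W : Submodule F V) (hW : ∀ g ∈ H, ∀ w ∈ W, g w ∈ W) (he : e ∈ W) (hf : f ∈ W) : W = ⊤ := by
  have hpk : ∀ x ∈ W, pk ω e f x ∈ W := fun x hx => W.sub_mem (W.sub_mem hx (W.smul_mem _ he)) (W.smul_mem _ hf)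
  have hK : ∀ k, ω e k = 0 → ω f k = 0 → k ∈ W := by
    intro k h1 h2
    by_cases hc : ∃ u ∈ W, ω e u = 0 ∧ ω f u = 0 ∧ u ≠ 0
    · obtain ⟨u, hu, hu1, hu2, hu0⟩ := hc
      refine (G.Bi (W ⊓ (LinearMap.ker (ω e) ⊓ LinearMap.ker (ω f))) (fun u hu => hu.2) ?_ ⟨u, ⟨hu, hu1, hu2⟩, hu0⟩ k h1 h2).1
      rintro b hb u ⟨hu, hu1, hu2⟩
      obtain ⟨b1, b2, b3⟩ := G.B1 b hb
      simp only [LinearMap.mem_ker, SetLike.mem_coe] at hu1 hu2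
      refine ⟨hW b b1 u hu, ?_, ?_⟩
      · change ω e (b u) = 0; rw [← hu1, ← mem_Sp.1 (G.hH b1) e u, b2]
      · change ω f (b u) = 0; rw [← hu2, ← mem_Sp.1 (G.hH b1) f u, b3]
    · by_contra hkW
      have hk0 : k ≠ 0 := by rintro rfl; exact hkW W.zero_mem
      apply hpl ⟨k, h1, h2, hk0⟩
      intro v hv
      push Not at hc
      have hyv : y v ∈ W := by
        apply hW y hy
        refine Submodule.span_le.2 ?_ hv
        rintro x (rfl | rfl)
        exacts [he, hf]
      have := hc _ (hpk _ hyv) (pk_K h G.ef _).1 (pk_K h G.ef _).2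
      rw [mem_sp_pair]
      refine ⟨ω (y v) f, ω e (y v), ?_⟩
      conv_lhs => rw [pk_eq (ω := ω) e f (y v), this, add_zero]
  rw [eq_top_iff]
  intro x _
  rw [pk_eq (ω := ω) e f x]
  exact W.add_mem (W.add_mem (W.smul_mem _ he) (W.smul_mem _ hf)) (hK _ (pk_K h G.ef _).1 (pk_K h G.ef _).2)

def PrH (H : Subgroup (V ≃ₗ[F] V)) (e f u u' : V) : Prop :=
  ∃ g ∈ H, ∃ c : F, c ≠ 0 ∧ ((u = c • g e ∧ u' = c⁻¹ • g f) ∨ (u = c • g f ∧ u' = -(c⁻¹ • g e)))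

theorem GD.mixed (h : Symp ω) (G : GD ω H e f A B m) (hs : ∀ g ∈ H, (∃ c : F, g e = c • e) → ∃ c : F, g f = c • f)
    {g : V ≃ₗ[F] V} (hg : g ∈ H) {s : F} (hge : g e = s • f) : g f = -(s⁻¹ • e) := by
  obtain ⟨a, ha, a0, ha2⟩ := G.exA
  obtain ⟨t, ht, et⟩ := G.tor a ha
  have hfe : ω f e = -1 := by rw [h.neg, G.ef]
  have k1 := mem_Sp.1 (G.hH hg) e f
  rw [hge, G.ef, map_smul, LinearMap.smul_apply, smul_eq_mul] at k1
  obtain ⟨c, hc⟩ := hs (g⁻¹ * t * g) (mul_mem (mul_mem (inv_mem hg) ht) hg) ⟨a⁻¹, by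
    rw [LinearEquiv.mul_apply, LinearEquiv.mul_apply, hge, et, map_smul, map_smul, LinearMap.smul_apply, h.alt, G.ef]
    have : s • f + ((a - 1) * (s • (0 : F))) • e + ((a⁻¹ - 1) * (s • (1 : F))) • f = a⁻¹ • g e := by rw [hge]; simp only [smul_eq_mul]; module
    rw [this]; simp⟩
  have hc2 : t (g f) = c • g f := by rw [← map_smul, ← hc]; simp
  rw [et] at hc2
  have q1 := congrArg (fun x => ω x f) hc2
  have q2 := congrArg (fun x => ω e x) hc2
  simp only [map_add, map_smul, LinearMap.add_apply, LinearMap.smul_apply, smul_eq_mul, h.alt, G.ef] at q1 q2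
  rw [h.neg] at k1
  have α0 : ω (g f) f ≠ 0 := by intro h0; rw [h0] at k1; simp at k1
  have ca : c = a := by
    apply mul_right_cancel₀ α0; linear_combination -q1
  subst ca
  have hb : ω e (g f) = 0 := by
    have i : c * c⁻¹ = 1 := mul_inv_cancel₀ a0
    have : (1 - c ^ 2) * ω e (g f) = 0 := by linear_combination c * q2 - ω e (g f) * i
    exact (mul_eq_zero.1 this).resolve_left (sub_ne_zero.2 (Ne.symm ha2))
  rw [hb, mul_zero, zero_smul, add_zero] at hc2
  have c1 : c - 1 ≠ 0 := by intro h0; apply ha2; rw [sub_eq_zero.1 h0, one_pow]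
  have h5 : (c - 1) • (g f - ω (g f) f • e) = 0 := by rw [sub_smul, one_smul, smul_sub, ← hc2]; module
  have h6 := sub_eq_zero.1 ((smul_eq_zero.1 h5).resolve_left c1)
  have s0 : s ≠ 0 := by rintro rfl; simp at k1
  conv_lhs => rw [h6]
  rw [← neg_smul]
  congr 1
  field_simp
  linear_combination -k1

theorem GD.PrS (h : Symp ω) (G : GD ω H e f A B m) (hs : ∀ g ∈ H, ((∃ c : F, g e = c • e) ↔ ∃ c : F, g f = c • f)) :
    PrS ω H A (PrH H e f) where
  A0 := G.A0
  one := by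
    rintro _ _ ⟨g, hg, c, hc, ⟨rfl, rfl⟩ | ⟨rfl, rfl⟩⟩ <;>
    simp only [map_smul, map_neg, LinearMap.smul_apply, smul_eq_mul, mem_Sp.1 (G.hH hg), G.ef]
    · field_simp
    · rw [h.neg f e, G.ef]; field_simp
  sw := by
    rintro _ _ ⟨g, hg, c, hc, ⟨rfl, rfl⟩ | ⟨rfl, rfl⟩⟩
    · exact ⟨g, hg, c⁻¹, inv_ne_zero hc, Or.inr ⟨rfl, by rw [inv_inv]⟩⟩
    · exact ⟨g, hg, -c⁻¹, neg_ne_zero.2 (inv_ne_zero hc), Or.inl ⟨by rw [neg_smul], by rw [inv_neg, inv_inv, neg_smul]⟩⟩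
  act := by
    rintro _ _ ⟨g, hg, c, hc, ⟨rfl, rfl⟩ | ⟨rfl, rfl⟩⟩ k hk
    · exact ⟨k * g, mul_mem hk hg, c, hc, Or.inl (by simp)⟩
    · exact ⟨k * g, mul_mem hk hg, c, hc, Or.inr (by simp)⟩
  sc := by
    rintro _ _ ⟨g, hg, c, hc, ⟨rfl, rfl⟩ | ⟨rfl, rfl⟩⟩ d hd
    · exact ⟨g, hg, d * c, mul_ne_zero hd hc, Or.inl ⟨by rw [smul_smul], by rw [smul_smul, mul_inv]⟩⟩
    · exact ⟨g, hg, d * c, mul_ne_zero hd hc, Or.inr ⟨by rw [smul_smul], by rw [smul_neg, smul_smul, mul_inv]⟩⟩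
  tor := by
    rintro _ _ ⟨g, hg, c, hc, ⟨rfl, rfl⟩ | ⟨rfl, rfl⟩⟩ a ha
    · exact ((G.tor a ha).map G.hH hg).scale hc
    · rw [← smul_neg]
      exact (by simpa using ((G.tor _ (G.Ai a ha)).swap h).map G.hH hg : Tor ω H (g f) (-(g e)) a).scale hc
  uq := by
    have key : ∀ g1 ∈ H, ∀ g2 ∈ H, ∀ s : F, (g1 e = s • g2 e → g1 f = s⁻¹ • g2 f) ∧ (g1 f = s • g2 f → g1 e = s⁻¹ • g2 e) ∧
        (g1 e = s • g2 f → g1 f = -(s⁻¹ • g2 e)) ∧ (g1 f = s • g2 e → g1 e = -(s⁻¹ • g2 f)) := by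
      intro g1 h1 g2 h2 s
      have hg := mul_mem (inv_mem h2) h1
      have tr : ∀ x y : V, g1 x = g2 y ↔ (g2⁻¹ * g1) x = y := by
        intro x y
        rw [LinearEquiv.mul_apply]
        constructor
        · intro hx; rw [hx]; simp
        · rintro rfl; simp
      simp only [← map_smul, ← map_neg, tr]
      set g := g2⁻¹ * g1
      have kk := mem_Sp.1 (G.hH hg) e f
      have G' := G.swap h
      refine ⟨fun hh => ?_, fun hh => ?_, G.mixed h (fun g hg => (hs g hg).1) hg, fun hh => ?_⟩
      · obtain ⟨c, hc⟩ := (hs g hg).1 ⟨s, hh⟩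
        rw [hh, hc, G.ef, map_smul, map_smul, LinearMap.smul_apply, G.ef, smul_eq_mul, smul_eq_mul, mul_one] at kk
        rw [hc, eq_inv_of_mul_eq_one_left kk]
      · obtain ⟨c, hc⟩ := (hs g hg).2 ⟨s, hh⟩
        rw [hh, hc, G.ef, map_smul, map_smul, LinearMap.smul_apply, G.ef, smul_eq_mul, smul_eq_mul, mul_one] at kk
        rw [hc, eq_inv_of_mul_eq_one_right kk]
      · have := G'.mixed h (fun g hg ⟨c, hc⟩ => ?_) hg (s := -s) (by rw [hh]; simp)
        · rw [map_neg, neg_inj, inv_neg] at this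
          rw [this, neg_smul]
        · obtain ⟨d, hd⟩ := (hs g hg).2 ⟨c, hc⟩
          exact ⟨d, by rw [map_neg, hd, smul_neg]⟩
    rintro _ _ _ _ ⟨g, hg, c, hc, hu⟩ ⟨k, hk, d, hd, hv⟩ r hr
    have key := key k hk g hg (d⁻¹ * (r * c))
    have cv : ∀ x y : V, d • x = r • c • y → x = (d⁻¹ * (r * c)) • y := by
      intro x y hxy
      rw [mul_smul, mul_smul, ← hxy, smul_smul, inv_mul_cancel₀ hd, one_smul]
    rcases hu with ⟨rfl, rfl⟩ | ⟨rfl, rfl⟩ <;> rcases hv with ⟨rfl, rfl⟩ | ⟨rfl, rfl⟩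
    · rw [key.1 (cv _ _ hr), smul_smul, smul_smul]; congr 1; field_simp
    · rw [key.2.2.2 (cv _ _ hr), smul_neg, neg_neg, smul_smul, smul_smul]; congr 1; field_simp
    · rw [key.2.2.1 (cv _ _ hr), smul_neg, smul_neg, smul_smul, smul_smul]; congr 2; field_simp
    · rw [key.2.1 (cv _ _ hr), smul_neg, smul_smul, smul_smul]; congr 2; field_simp

end P12

section P13
open Classical Pointwise

variable {F V : Type} [Field F] [AddCommGroup V] [Module F V] {ω : V →ₗ[F] V →ₗ[F] F}
variable {H : Subgroup (V ≃ₗ[F] V)} {A : Finset F} {e f : V} {B : Finset (V ≃ₗ[F] V)} {m : ℕ} [Fintype F] [Fintype V] [Fintype (V ≃ₗ[F] V)]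

theorem GD.tri [FiniteDimensional F V] (h : Symp ω) (hm : Module.finrank F V = 2 * m) (hm1 : 1 ≤ m) (G : GD ω H e f A B m)
    (hs : ∀ g ∈ H, ((∃ c : F, g e = c • e) ↔ ∃ c : F, g f = c • f)) {v v' : V} (hv : PrH H e f v v') :
    (∃ c : F, v = c • e) ∨ (∃ c : F, v = c • f) ∨ (ω e v = 0 ∧ ω v f = 0) := by
  have P := G.PrS h hs
  have hef : PrH H e f e f := ⟨1, one_mem _, 1, one_ne_zero, Or.inl (by simp)⟩
  have n4 : 3 * Fintype.card F < A.card * (A.card - 2) := by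
    have := G.n2
    have : A.card * (A.card - 5) ≤ A.card * (A.card - 2) := Nat.mul_le_mul_left _ (by omega)
    omega
  by_cases hβ : ω e v = 0
  · rcases P.L1 h hef hv hβ n4 with h1 | h1
    · exact Or.inl h1
    · exact Or.inr (Or.inr ⟨hβ, h1.1⟩)
  by_cases hα : ω v f = 0
  · rcases P.L1 h (P.sw _ _ hef) hv (by rw [h.neg, hα, neg_zero]) n4 with h1 | h1
    · exact Or.inr (Or.inl h1)
    · exfalso; apply hβ; rw [h.neg, ← map_neg]; exact h1.1
  by_cases hδ : ω e v' = 0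
  · rcases P.L1 h hef (P.sw _ _ hv) hδ n4 with ⟨c, h1⟩ | h1
    · have := P.uq _ _ _ _ hef (P.sw _ _ hv) c h1
      exact Or.inr (Or.inl ⟨-c⁻¹, by rw [neg_smul, ← this, neg_neg]⟩)
    · exfalso; apply hβ; simpa using h1.2.1
  by_cases hγ : ω v' f = 0
  · rcases P.L1 h (P.sw _ _ hef) (P.sw _ _ hv) (by rw [h.neg, hγ, neg_zero]) n4 with ⟨c, h1⟩ | h1
    · have := P.uq _ _ _ _ (P.sw _ _ hef) (P.sw _ _ hv) c h1
      rw [smul_neg, neg_inj] at this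
      exact Or.inl ⟨_, this⟩
    · exfalso; apply hα; rw [h.neg, ← map_neg]; exact h1.2.1
  exfalso
  have q1 : 0 < Fintype.card F - 1 := Nat.sub_pos_of_lt Fintype.one_lt_card
  let al : F → F := fun d => 1 + (d - 1) * (ω e v' * ω v f) - (d⁻¹ - 1) * (ω e v * ω v' f)
  have c1 : (Finset.univ.filter (fun d : F => (ω e v' * ω v f) * d ^ 2 + (1 - ω e v' * ω v f + ω e v * ω v' f) * d + -(ω e v * ω v' f) = 0)).card ≤ 2 :=
    card_quad _ _ _ (mul_ne_zero hδ hα)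
  have c2 : ({1, -1} : Finset F).card ≤ 2 := Finset.card_le_two
  have ex : ∀ d ∈ A, d ^ 2 = 1 ∨ al d = 0 → d ∈ ({1, -1} : Finset F) ∪ (Finset.univ.filter (fun d : F => (ω e v' * ω v f) * d ^ 2 + (1 - ω e v' * ω v f + ω e v * ω v' f) * d + -(ω e v * ω v' f) = 0)) := by
    intro d hd hh
    have d0 : d ≠ 0 := by rintro rfl; exact G.A0 hd
    rw [Finset.mem_union]
    rcases hh with hh | hh
    · left; rw [sq, mul_self_eq_one_iff] at hh; simpa using hh
    · right
      rw [Finset.mem_filter]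
      refine ⟨Finset.mem_univ _, ?_⟩
      simp only [al] at hh
      have i : d * d⁻¹ = 1 := mul_inv_cancel₀ d0
      linear_combination d * hh + (ω e v * ω v' f) * i
  by_cases hw : pk ω e f v = 0 ∧ pk ω e f v' = 0
  · let D := A.filter (fun d => d ^ 2 ≠ 1 ∧ al d ≠ 0)
    have hD : A.card - 5 ≤ D.card := by
      have : A ⊆ D ∪ (({1, -1} : Finset F) ∪ (Finset.univ.filter (fun d : F => (ω e v' * ω v f) * d ^ 2 + (1 - ω e v' * ω v f + ω e v * ω v' f) * d + -(ω e v * ω v' f) = 0))) := by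
        intro d hd
        by_cases hh : d ^ 2 = 1 ∨ al d = 0
        · exact Finset.mem_union_right _ (ex d hd hh)
        · push Not at hh
          exact Finset.mem_union_left _ (Finset.mem_filter.2 ⟨hd, hh⟩)
      have h3 := (Finset.card_le_card this).trans ((Finset.card_union_le _ _).trans (Nat.add_le_add_left (Finset.card_union_le _ _) _))
      omega
    have h3 := P.L3 h G.hH hef hv hβ hδ hα hγ {1} (by simp [one_mem]) D (Finset.filter_subset _ _) (by
      intro d hd
      have := (Finset.mem_filter.1 hd).2
      refine ⟨this.1, this.2, ?_⟩
      intro b hb b' hb' _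
      rw [Finset.mem_singleton.1 hb, Finset.mem_singleton.1 hb']) (fun x => x ∈ Submodule.span F {e, f}) (by
      intro b hb p q r s c
      rw [Finset.mem_singleton.1 hb]
      have e1 := pk_eq (ω := ω) e f v
      have e2 := pk_eq (ω := ω) e f v'
      rw [hw.1, add_zero] at e1
      rw [hw.2, add_zero] at e2
      apply Submodule.smul_mem
      have m1 : e ∈ Submodule.span F {e, f} := Submodule.subset_span (by simp)
      have m2 : f ∈ Submodule.span F {e, f} := Submodule.subset_span (by simp)
      change p • e + q • f + r • v + s • v' ∈ _
      have m3 : ∀ a b : F, a • e + b • f ∈ Submodule.span F {e, f} := fun a b => mem_sp_pair.2 ⟨a, b, rfl⟩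
      rw [e1, e2]
      exact Submodule.add_mem _ (Submodule.add_mem _ (m3 _ _) (Submodule.smul_mem _ _ (m3 _ _))) (Submodule.smul_mem _ _ (m3 _ _)))
    have h4 : (Finset.univ.filter (fun x => (∃ x', PrH H e f x x') ∧ x ∈ Submodule.span F {e, f})).card ≤ Fintype.card F ^ 2 - 1 := by
      have : Fintype.card F ^ 2 - 1 = ((Finset.univ : Finset (F × F)).erase 0).card := by
        rw [Finset.card_erase_of_mem (Finset.mem_univ _), Finset.card_univ, Fintype.card_prod, sq]
      rw [this]
      refine le_trans (Finset.card_le_card ?_) (Finset.card_image_le (f := fun x : F × F => x.1 • e + x.2 • f))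
      intro x hx
      rw [Finset.mem_filter] at hx
      obtain ⟨_, ⟨x', hx'⟩, hx⟩ := hx
      obtain ⟨a, b, rfl⟩ := mem_sp_pair.1 hx
      rw [Finset.mem_image]
      refine ⟨(a, b), ?_, rfl⟩
      simp only [Finset.mem_erase, Finset.mem_univ, and_true]
      intro h0
      rw [Prod.mk_eq_zero] at h0
      have := P.one _ _ hx'
      rw [h0.1, h0.2] at this
      simp at this
    have h5 := h3.trans (Nat.mul_le_mul_left 8 h4)
    have e8 : Fintype.card F ^ 2 - 1 = (Fintype.card F - 1) * (Fintype.card F + 1) := by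
      rw [mul_comm, ← Nat.sq_sub_sq, one_pow]
    rw [e8, mul_left_comm 8, Finset.card_singleton, one_mul] at h5
    have h6 := Nat.le_of_mul_le_mul_left h5 q1
    have := G.n2
    have := Nat.mul_le_mul_left A.card hD
    omega
  · let x : F → V := fun d => ω e v' • pk ω e f v + (d⁻¹ * ω e v) • pk ω e f v'
    let D := A.filter (fun d => (d ^ 2 ≠ 1 ∧ al d ≠ 0) ∧ x d ≠ 0)
    have c3 : (A.filter (fun d => x d = 0)).card ≤ 1 := by
      rw [Finset.card_le_one]
      intro d hd d' hd'
      rw [Finset.mem_filter] at hd hd'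
      by_contra hne
      apply hw
      have e1 : (d⁻¹ * ω e v - d'⁻¹ * ω e v) • pk ω e f v' = 0 := by
        rw [sub_smul, sub_eq_zero]
        exact add_left_cancel (hd.2.trans hd'.2.symm)
      have e2 : pk ω e f v' = 0 := by
        refine (smul_eq_zero.1 e1).resolve_left ?_
        rw [← sub_mul]
        exact mul_ne_zero (sub_ne_zero.2 (fun hh => hne (inv_injective hh))) hβ
      have := hd.2
      simp only [x, e2, smul_zero, add_zero] at this
      exact ⟨(smul_eq_zero.1 this).resolve_left hδ, e2⟩
    have hD : A.card - 5 ≤ D.card := by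
      have : A ⊆ D ∪ ((({1, -1} : Finset F) ∪ (Finset.univ.filter (fun d : F => (ω e v' * ω v f) * d ^ 2 + (1 - ω e v' * ω v f + ω e v * ω v' f) * d + -(ω e v * ω v' f) = 0))) ∪ A.filter (fun d => x d = 0)) := by
        intro d hd
        by_cases hx : x d = 0
        · exact Finset.mem_union_right _ (Finset.mem_union_right _ (Finset.mem_filter.2 ⟨hd, hx⟩))
        by_cases hh : d ^ 2 = 1 ∨ al d = 0
        · exact Finset.mem_union_right _ (Finset.mem_union_left _ (ex d hd hh))
        · push Not at hh
          exact Finset.mem_union_left _ (Finset.mem_filter.2 ⟨hd, hh, hx⟩)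
      have h3 := (Finset.card_le_card this).trans ((Finset.card_union_le _ _).trans (Nat.add_le_add_left ((Finset.card_union_le _ _).trans (Nat.add_le_add_right (Finset.card_union_le _ _) _)) _))
      omega
    have h3 := P.L3 h G.hH hef hv hβ hδ hα hγ B G.B1 D (Finset.filter_subset _ _) (by
      intro d hd
      have hd := Finset.mem_filter.1 hd
      refine ⟨hd.2.1.1, hd.2.1.2, ?_⟩
      intro b hb b' hb'
      have d0 : d ≠ 0 := by rintro rfl; exact G.A0 hd.1
      have d1 : d - 1 ≠ 0 := by intro h0; apply hd.2.1.1; rw [sub_eq_zero.1 h0, one_pow]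
      have e1 : ((d - 1) * ω e v') • pk ω e f v - ((d⁻¹ - 1) * ω e v) • pk ω e f v' = (d - 1) • x d := by
        have i : (d⁻¹ - 1) = - ((d - 1) * d⁻¹) := by field_simp; ring
        simp only [x, i]; module
      rw [e1]
      refine G.Bf b hb b' hb' _ ?_ ?_ (smul_ne_zero d1 hd.2.2)
      · simp [x, (pk_K h G.ef _).1]
      · simp [x, (pk_K h G.ef _).2]) (fun _ => True) (by intros; trivial)
    have h4 := P.O_card h hm hm1 (fun u u' v v' hu hv h0 => (P.L1 h hu hv h0 n4).imp id (fun h => h.1))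
    simp only [and_true] at h3
    have h5 := h3.trans (Nat.mul_le_mul_left 8 (le_trans (le_of_eq (by congr!)) h4))
    rw [show 8 * (m * (Fintype.card F - 1) * (Fintype.card F ^ m + 1)) = (Fintype.card F - 1) * (8 * m * (Fintype.card F ^ m + 1)) by ring] at h5
    have h6 := Nat.le_of_mul_le_mul_left h5 q1
    have := G.n1
    have := Nat.mul_le_mul_left B.card (Nat.mul_le_mul_left A.card hD)
    rw [mul_comm B.card] at this
    omega

theorem GD.stage1 [FiniteDimensional F V] (h : Symp ω) (hm : Module.finrank F V = 2 * m) (hm1 : 1 ≤ m) (G : GD ω H e f A B m)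
    {y : V ≃ₗ[F] V} (hy : y ∈ H) (heig : ∀ v, v ≠ 0 → ∀ a : F, y v ≠ a • v) (htr : LinearMap.trace F V y.toLinearMap ≠ 0)
    (hpl : (∃ k, ω e k = 0 ∧ ω f k = 0 ∧ k ≠ 0) → ¬ ∀ v ∈ Submodule.span F {e, f}, y v ∈ Submodule.span F {e, f}) :
    ∃ g ∈ H, ¬ ((∃ c : F, g e = c • e) ↔ ∃ c : F, g f = c • f) := by
  by_contra hc
  push Not at hc
  have P := G.PrS h hc
  have hef : PrH H e f e f := ⟨1, one_mem _, 1, one_ne_zero, Or.inl (by simp)⟩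
  have tri : ∀ u u' v v', PrH H e f u u' → PrH H e f v v' → (∃ c : F, v = c • u) ∨ ω v u' = 0 := by
    rintro _ _ v v' ⟨g, hg, c, hc0, hu⟩ hv
    have hv' := G.tri h hm hm1 hc (P.act _ _ hv g⁻¹ (inv_mem hg))
    have gi : ∀ x, g⁻¹ v = x → v = g x := by rintro x rfl; simp
    have o1 : ω v (g f) = ω (g⁻¹ v) f := (Sp_inv_left (G.hH hg) _ _).symm
    have o2 : ω v (g e) = - ω e (g⁻¹ v) := by rw [Sp_inv_right (G.hH hg), h.neg]
    rcases hu with ⟨rfl, rfl⟩ | ⟨rfl, rfl⟩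
    · rw [map_smul, o1]
      rcases hv' with ⟨d, hd⟩ | ⟨d, hd⟩ | hd
      · left; refine ⟨d * c⁻¹, ?_⟩; rw [gi _ hd, map_smul, smul_smul]; congr 1; field_simp
      · right; rw [hd]; simp [h.alt]
      · right; rw [hd.2, smul_zero]
    · rw [map_neg, map_smul, o2]
      rcases hv' with ⟨d, hd⟩ | ⟨d, hd⟩ | hd
      · right; rw [hd]; simp [h.alt]
      · left; refine ⟨d * c⁻¹, ?_⟩; rw [gi _ hd, map_smul, smul_smul]; congr 1; field_simp
      · right; rw [hd.1]; simp
  apply htr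
  let 𝒩 : Set (Submodule F V) := {N | ∃ u u', PrH H e f u u' ∧ N = Submodule.span F {u}}
  have mp : ∀ (g : V ≃ₗ[F] V) (u : V), (Submodule.span F {u}).map g.toLinearMap = Submodule.span F {g u} := by
    intro g u; rw [Submodule.map_span]; simp
  apply perm_trace y 𝒩
  · rintro _ ⟨u, u', hu, rfl⟩
    exact ⟨y u, y u', P.act _ _ hu y hy, mp _ _⟩
  · rintro _ ⟨u, u', hu, rfl⟩ he
    rw [mp] at he
    have : y u ∈ Submodule.span F {u} := by rw [← he]; exact Submodule.mem_span_singleton_self _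
    obtain ⟨c, hc⟩ := Submodule.mem_span_singleton.1 this
    refine heig u ?_ c hc.symm
    rintro rfl; have := P.one _ _ hu; simp at this
  · rintro _ ⟨u, u', hu, rfl⟩
    have : sSup (𝒩 \ {Submodule.span F {u}}) ≤ LinearMap.ker (ω.flip u') := by
      apply sSup_le
      rintro _ ⟨⟨v, v', hv, rfl⟩, hne⟩
      rw [Submodule.span_singleton_le_iff_mem]
      rcases tri _ _ _ _ hu hv with ⟨c, rfl⟩ | h0
      · exfalso; apply hne
        have c0 : c ≠ 0 := by rintro rfl; have := P.one _ _ hv; simp at this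
        exact Submodule.span_singleton_smul_eq (IsUnit.mk0 c c0) _
      · exact h0
    rw [Submodule.disjoint_def]
    intro x hx hx2
    obtain ⟨c, rfl⟩ := Submodule.mem_span_singleton.1 hx
    have h0 := this hx2
    change ω (c • u) u' = 0 at h0
    rw [map_smul, LinearMap.smul_apply, P.one _ _ hu, smul_eq_mul, mul_one] at h0
    rw [h0, zero_smul]
  · have mem : ∀ u u', PrH H e f u u' → u ∈ sSup 𝒩 := fun u u' hu =>
      (le_sSup (show Submodule.span F {u} ∈ 𝒩 from ⟨u, u', hu, rfl⟩)) (Submodule.mem_span_singleton_self u)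
    refine G.irr1 h hy hpl _ ?_ (mem _ _ hef) (mem _ _ (P.sw _ _ hef))
    intro g hg w hw
    have : sSup 𝒩 ≤ (sSup 𝒩).comap g.toLinearMap := by
      apply sSup_le
      rintro _ ⟨u, u', hu, rfl⟩
      rw [Submodule.span_singleton_le_iff_mem]
      exact mem _ _ (P.act _ _ hu g hg)
    exact this hw

end P13

section P14
open Classical Pointwise

variable {F V : Type} [Field F] [AddCommGroup V] [Module F V] {ω : V →ₗ[F] V →ₗ[F] F}
variable {H : Subgroup (V ≃ₗ[F] V)} {A : Finset F} {e f : V} {B : Finset (V ≃ₗ[F] V)} {m : ℕ}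

/-- unipotent element with parameters (w,z) at u -/
def RR (ω : V →ₗ[F] V →ₗ[F] F) (H : Subgroup (V ≃ₗ[F] V)) (u w : V) (z : F) : Prop :=
  ∃ g ∈ H, ∀ v, g v = v + ω u v • (w + z • u) + ω w v • u

theorem RR.map (hH : H ≤ Sp ω) {u w : V} {z : F} (T : RR ω H u w z) {k : V ≃ₗ[F] V} (hk : k ∈ H) : RR ω H (k u) (k w) z := by
  obtain ⟨g, hg, e⟩ := T
  refine ⟨k * g * k⁻¹, mul_mem (mul_mem hk hg) (inv_mem hk), fun v => ?_⟩
  simp only [LinearEquiv.mul_apply, e, map_add, map_smul, le_inv_apply, Sp_inv_right (hH hk)]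

theorem RR.scale {c : F} {u w : V} {z : F} (T : RR ω H (c • u) w z) : RR ω H u (c • w) (c ^ 2 * z) := by
  obtain ⟨g, hg, e⟩ := T
  refine ⟨g, hg, fun v => ?_⟩
  simp only [e, map_smul, LinearMap.smul_apply, smul_eq_mul]
  module

theorem RR.zero (u : V) : RR ω H u 0 0 := ⟨1, one_mem _, fun v => by simp⟩

theorem RR.add (h : Symp ω) {u w w' : V} {z z' : F} (T : RR ω H u w z) (T' : RR ω H u w' z') (h1 : ω u w = 0) (h2 : ω u w' = 0) :
    RR ω H u (w + w') (z + z' + ω w w') := by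
  obtain ⟨g, hg, e⟩ := T
  obtain ⟨g', hg', e'⟩ := T'
  refine ⟨g * g', mul_mem hg hg', fun v => ?_⟩
  have h3 : ω w u = 0 := by rw [h.neg, h1, neg_zero]
  simp only [LinearEquiv.mul_apply, e, e', map_add, map_smul, LinearMap.add_apply, smul_eq_mul, h2, h3, h.alt]
  module

theorem RR.neg (h : Symp ω) {u w : V} {z : F} (T : RR ω H u w z) (h1 : ω u w = 0) : RR ω H u (-w) (-z) := by
  obtain ⟨g, hg, e⟩ := T
  refine ⟨g⁻¹, inv_mem hg, fun v => ?_⟩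
  have h3 : ω w u = 0 := by rw [h.neg, h1, neg_zero]
  have : g (v + ω u v • (-w + -z • u) + ω (-w) v • u) = v := by
    simp only [e, map_add, map_smul, map_neg, LinearMap.neg_apply, smul_eq_mul, h1, h3, h.alt]
    module
  apply g.injective
  rw [this]; simp

theorem Tor.diff (h : Symp ω) {f' : V} {a : F} (a0 : a ≠ 0) (T : Tor ω H e f a⁻¹) (T' : Tor ω H e f' a) (h1 : ω e f = 1) (h2 : ω e f' = 1) :
    RR ω H e ((1 - a) • pk ω e f f') (ω f' f * (1 - a ^ 2)) := by
  obtain ⟨g, hg, E⟩ := T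
  obtain ⟨g', hg', E'⟩ := T'
  refine ⟨g' * g, mul_mem hg' hg, fun v => ?_⟩
  have e1 : ω f f' = -ω f' f := h.neg _ _
  have e2 : ω v f' = - ω f' v := h.neg _ _
  have e3 : ω v f = - ω f v := h.neg _ _
  simp only [LinearEquiv.mul_apply, E, E', map_add, map_sub, map_smul, LinearMap.add_apply, LinearMap.sub_apply, LinearMap.smul_apply, smul_eq_mul, h1, h2, h.alt, pk, e1, e2, e3, inv_inv]
  match_scalars <;> field_simp <;> ring

theorem stab_all [Fintype F] {M : Type} [AddCommGroup M] [Module F M] (N : AddSubgroup M) (T : Finset F)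
    (hT : ∀ a ∈ T, ∀ n ∈ N, a • n ∈ N) (hc : Fintype.card F < T.card ^ 2) (c : F) : ∀ n ∈ N, c • n ∈ N := by
  let S : Subring F :=
    { carrier := {c | ∀ n ∈ N, c • n ∈ N}
      one_mem' := fun n hn => by simpa using hn
      mul_mem' := fun {a b} ha hb n hn => by rw [mul_smul]; exact ha _ (hb _ hn)
      zero_mem' := fun n hn => by simpa using N.zero_mem
      add_mem' := fun {a b} ha hb n hn => by rw [add_smul]; exact N.add_mem (ha _ hn) (hb _ hn)
      neg_mem' := fun {a} ha n hn => by rw [neg_smul]; exact N.neg_mem (ha _ hn) }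
  change c ∈ S
  by_contra hcS
  have hinj : Set.InjOn (fun x : F × F => x.1 + x.2 * c) (T ×ˢ T : Finset (F × F)) := by
    rintro ⟨x, y⟩ hx ⟨x', y'⟩ hx' hxy
    simp only [Finset.coe_product, Set.mem_prod, Finset.mem_coe] at hx hx' hxy
    have hy : y = y' := by
      by_contra hne
      apply hcS
      have d0 : y - y' ≠ 0 := sub_ne_zero.2 hne
      have hi : (y - y')⁻¹ ∈ S := by
        have : (y - y')⁻¹ = (y - y') ^ (Fintype.card F - 2) := by
          symm; apply eq_inv_of_mul_eq_one_left
          rw [← pow_succ, show Fintype.card F - 2 + 1 = Fintype.card F - 1 by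
            have := Fintype.one_lt_card (α := F); omega]
          exact FiniteField.pow_card_sub_one_eq_one _ d0
        rw [this]; exact pow_mem (sub_mem (show y ∈ S from hT _ hx.2) (show y' ∈ S from hT _ hx'.2)) _
      have : c = (x' - x) * (y - y')⁻¹ := by field_simp; linear_combination hxy
      rw [this]; exact mul_mem (sub_mem (show x' ∈ S from hT _ hx'.1) (show x ∈ S from hT _ hx.1)) hi
    subst hy
    simpa using hxy
  have := Finset.card_le_card_of_injOn _ (t := Finset.univ) (by simp) hinj
  rw [Finset.card_product, Finset.card_univ, ← sq] at this
  omega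

theorem K_nd (h : Symp ω) (h1 : ω e f = 1) {w : V} (hw : ω e w = 0 ∧ ω f w = 0) (w0 : w ≠ 0) : ∃ k, (ω e k = 0 ∧ ω f k = 0) ∧ ω k w ≠ 0 := by
  obtain ⟨k, k1, k2, k3⟩ := perp_nd h h1 (z := w) (by rw [pk, hw.1, h.neg w, hw.2]; simpa using w0)
  exact ⟨k, ⟨by rw [h.neg, k1, neg_zero], by rw [h.neg, k2, neg_zero]⟩, k3⟩

variable [Fintype F]

theorem GD.RRs (h : Symp ω) (G : GD ω H e f A B m) {a : F} (ha : a ∈ A) {w : V} (hw : ω e w = 0 ∧ ω f w = 0) {z : F} (T : RR ω H e w z) :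
    RR ω H e (a • w) (a ^ 2 * z) := by
  obtain ⟨g, hg, E⟩ := G.tor a ha
  have := T.map G.hH hg
  rw [E, E w, hw.1, h.neg w f, hw.2, h.alt, G.ef] at this
  apply RR.scale
  convert this using 1
  · module
  · simp

theorem GD.bK (h : Symp ω) (G : GD ω H e f A B m) {b : V ≃ₗ[F] V} (hb : b ∈ B) {w : V} (hw : ω e w = 0 ∧ ω f w = 0) : ω e (b w) = 0 ∧ ω f (b w) = 0 := by
  obtain ⟨b1, b2, b3⟩ := G.B1 b hb
  constructor
  · rw [← hw.1, ← mem_Sp.1 (G.hH b1) e w, b2]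
  · rw [← hw.2, ← mem_Sp.1 (G.hH b1) f w, b3]

theorem GD.stage2 (h : Symp ω) (G : GD ω H e f A B m) {w : V} {z : F} (hw : ω e w = 0 ∧ ω f w = 0) (T : RR ω H e w z) (hne : w ≠ 0 ∨ z ≠ 0) :
    (∀ w z, ω e w = 0 ∧ ω f w = 0 → RR ω H e w z) ∨
    (∃ k, (ω e k = 0 ∧ ω f k = 0) ∧ k ≠ 0) ∧
    ((∀ z, RR ω H e 0 z) ∧ (∀ w z, ω e w = 0 ∧ ω f w = 0 → RR ω H e w z → w = 0) ∨
     (2 : F) = 0 ∧ (∀ w, ω e w = 0 ∧ ω f w = 0 → ∃ z, RR ω H e w z) ∧ ∀ z, RR ω H e 0 z → z = 0) := by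
  have n4 : 4 * Fintype.card F < A.card ^ 2 := by
    have := G.n2
    have : A.card * (A.card - 5) ≤ A.card * A.card := Nat.mul_le_mul_left _ (by omega)
    rw [sq]; omega
  have K0 : ω e (0 : V) = 0 ∧ ω f (0 : V) = 0 := by simp
  have KA : ∀ w w', (ω e w = 0 ∧ ω f w = 0) → (ω e w' = 0 ∧ ω f w' = 0) → (ω e (w + w') = 0 ∧ ω f (w + w') = 0) := by
    intro w w' h1 h2; simp [h1, h2]
  have KN : ∀ w, (ω e w = 0 ∧ ω f w = 0) → (ω e (-w) = 0 ∧ ω f (-w) = 0) := by intro w h1; simp [h1]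
  have hW : (∃ w, (ω e w = 0 ∧ ω f w = 0) ∧ (∃ z, RR ω H e w z) ∧ w ≠ 0) → ∀ w, (ω e w = 0 ∧ ω f w = 0) → ∃ z, RR ω H e w z := by
    rintro ⟨w1, hw1, hz1, hw10⟩ k hk
    let N : AddSubgroup V :=
      { carrier := {w | (ω e w = 0 ∧ ω f w = 0) ∧ ∃ z, RR ω H e w z}
        zero_mem' := ⟨K0, 0, RR.zero e⟩
        add_mem' := fun {a b} ha hb => ⟨KA _ _ ha.1 hb.1, by
          obtain ⟨z, hz⟩ := ha.2
          obtain ⟨z', hz'⟩ := hb.2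
          exact ⟨_, hz.add h hz' ha.1.1 hb.1.1⟩⟩
        neg_mem' := fun {a} ha => ⟨KN _ ha.1, by
          obtain ⟨z, hz⟩ := ha.2
          exact ⟨_, hz.neg h ha.1.1⟩⟩ }
    have hN := stab_all N A (fun a ha n hn => ⟨by simp [hn.1], by
      obtain ⟨z, hz⟩ := hn.2
      exact ⟨_, G.RRs h ha hn.1 hz⟩⟩) (by omega)
    let U : Submodule F V := { N with smul_mem' := fun c x hx => hN c x hx }
    refine (G.Bi U (fun u hu => hu.1) (fun b hb u hu => ⟨G.bK h hb hu.1, ?_⟩) ⟨w1, ⟨hw1, hz1⟩, hw10⟩ k hk.1 hk.2).2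
    obtain ⟨z, hz⟩ := hu.2
    obtain ⟨b1, b2, b3⟩ := G.B1 b hb
    have := hz.map G.hH b1
    rw [b2] at this
    exact ⟨z, this⟩
  have hZ : (∃ z, z ≠ 0 ∧ RR ω H e 0 z) → ∀ z, RR ω H e 0 z := by
    rintro ⟨z1, hz1, hr⟩ z
    let N : AddSubgroup F :=
      { carrier := {z | RR ω H e 0 z}
        zero_mem' := RR.zero e
        add_mem' := fun {a b} ha hb => by simpa using RR.add h ha hb K0.1 K0.1
        neg_mem' := fun {a} ha => by simpa using RR.neg h ha K0.1 }
    have hc : A.card ≤ 2 * (A.image (fun a => a ^ 2)).card := by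
      refine Finset.card_le_mul_card_image (f := fun a : F => a ^ 2) A 2 ?_
      intro b _
      refine le_trans (Finset.card_le_card ?_) (card_quad 1 0 (-b) one_ne_zero)
      intro x hx
      rw [Finset.mem_filter] at hx ⊢
      exact ⟨Finset.mem_univ _, by rw [← hx.2]; ring⟩
    have hN := stab_all N (A.image (fun a => a ^ 2)) (by
      intro a ha n hn
      obtain ⟨b, hb, rfl⟩ := Finset.mem_image.1 ha
      have := G.RRs h hb K0 hn
      rw [smul_zero] at this
      exact this) (by nlinarith) (z / z1) z1 hr
    rwa [smul_eq_mul, div_mul_cancel₀ _ hz1] at hN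
  by_cases hzc : ∃ z, z ≠ 0 ∧ RR ω H e 0 z
  · have hz := hZ hzc
    by_cases hwc : ∃ w, (ω e w = 0 ∧ ω f w = 0) ∧ (∃ z, RR ω H e w z) ∧ w ≠ 0
    · left
      intro w z hw
      obtain ⟨z', hz'⟩ := hW hwc w hw
      simpa using hz'.add h (hz (z - z')) hw.1 K0.1
    · push Not at hwc
      by_cases hk : ∃ k, (ω e k = 0 ∧ ω f k = 0) ∧ k ≠ 0
      · exact Or.inr ⟨hk, Or.inl ⟨hz, fun w z hw hr => hwc w hw ⟨z, hr⟩⟩⟩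
      · push Not at hk
        left; intro w z hw; rw [hk w hw]; exact hz z
  · have hzc' : ∀ z, RR ω H e 0 z → z = 0 := by
      intro z hz; by_contra h0; exact hzc ⟨z, h0, hz⟩
    have w0 : w ≠ 0 := by
      rintro rfl
      rcases hne with h0 | h0
      · exact h0 rfl
      · exact h0 (hzc' z T)
    have hwc := hW ⟨w, hw, ⟨z, T⟩, w0⟩
    obtain ⟨k, hk, hkw⟩ := K_nd h G.ef hw w0
    refine Or.inr ⟨⟨w, hw, w0⟩, Or.inr ⟨?_, hwc, hzc'⟩⟩
    obtain ⟨z', T'⟩ := hwc k hk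
    have := (T.add h T' hw.1 hk.1).add h ((T'.add h T hk.1 hw.1).neg h (KA _ _ hk hw).1) (KA _ _ hw hk).1 (KN _ (KA _ _ hk hw)).1
    rw [show w + k + -(k + w) = 0 by abel] at this
    have := hzc' _ this
    have e1 : ω w k = - ω k w := h.neg _ _
    simp only [map_add, map_neg, LinearMap.add_apply, h.alt, e1] at this
    have h3 : (2 : F) * ω k w = 0 := by linear_combination -this
    exact (mul_eq_zero.1 h3).resolve_right hkw

end P14

section P15
open Classical Pointwise

variable {F V : Type} [Field F] [AddCommGroup V] [Module F V] {ω : V →ₗ[F] V →ₗ[F] F}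
variable {H : Subgroup (V ≃ₗ[F] V)} {A : Finset F} {e f : V} {B : Finset (V ≃ₗ[F] V)} {m : ℕ}

def OL (H : Subgroup (V ≃ₗ[F] V)) (e v : V) : Prop := ∃ g ∈ H, ∃ s : F, v = s • g e

theorem OL.map {v : V} (T : OL H e v) {k : V ≃ₗ[F] V} (hk : k ∈ H) : OL H e (k v) := by
  obtain ⟨g, hg, s, rfl⟩ := T
  exact ⟨k * g, mul_mem hk hg, s, by simp⟩

theorem OL.smul {v : V} (T : OL H e v) (c : F) : OL H e (c • v) := by
  obtain ⟨g, hg, s, rfl⟩ := T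
  exact ⟨g, hg, c * s, by rw [mul_smul]⟩

theorem OL.self : OL H e e := ⟨1, one_mem _, 1, by simp⟩

theorem OL.tv (hH : H ≤ Sp ω) (h : Symp ω) (hz : ∀ z, RR ω H e 0 z) {v : V} (T : OL H e v) (c : F) : _root_.tv h v c ∈ H := by
  obtain ⟨g, hg, s, rfl⟩ := T
  obtain ⟨k, hk, E⟩ := hz (c * s ^ 2)
  have : _root_.tv h (s • g e) c = g * k * g⁻¹ := by
    have h1 : k = _root_.tv h e (c * s ^ 2) := by
      ext v; rw [E, tv_apply]; simp [smul_smul]; ring_nf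
    rw [h1, tv_conj h (hH hg)]
    ext v
    simp only [tv_apply, map_smul, LinearMap.smul_apply, smul_eq_mul]
    module
  rw [this]; exact mul_mem (mul_mem hg hk) (inv_mem hg)

variable [Fintype F]

theorem GD.irr2 (h : Symp ω) (G : GD ω H e f A B m) {y : V ≃ₗ[F] V} (hy : y ∈ H) (heig : ∀ a : F, y e ≠ a • e) :
    ∃ g ∈ H, ω e (g e) ≠ 0 := by
  by_contra! hc
  let U : Submodule F V :=
    { carrier := {v | (ω e v = 0 ∧ ω f v = 0) ∧ ∀ g ∈ H, ω e (g v) = 0}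
      zero_mem' := by simp
      add_mem' := fun {a b} ha hb => ⟨by simp [ha.1, hb.1], fun g hg => by simp [ha.2 g hg, hb.2 g hg]⟩
      smul_mem' := fun c x hx => ⟨by simp [hx.1], fun g hg => by simp [hx.2 g hg]⟩ }
  have e0 : ω e (y e) = 0 := hc y hy
  have hw : pk ω e f (y e) = y e - ω (y e) f • e := by rw [pk, e0]; simp
  have hU : pk ω e f (y e) ∈ U := ⟨pk_K h G.ef _, fun g hg => by
    have := hc _ (mul_mem hg hy)
    rw [hw, map_sub, map_sub, map_smul, map_smul, hc g hg, smul_zero, sub_zero]; exact this⟩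
  have w0 : pk ω e f (y e) ≠ 0 := by
    rw [hw]; intro h0; exact heig _ (sub_eq_zero.1 h0)
  obtain ⟨k, hk, hkw⟩ := K_nd h G.ef (pk_K h G.ef _) w0
  have hkU := G.Bi U (fun u hu => hu.1) (fun b hb u hu => ⟨G.bK h hb hu.1, fun g hg => hu.2 _ (mul_mem hg (G.B1 b hb).1)⟩) ⟨_, hU, w0⟩ k hk.1 hk.2
  apply hkw
  have := hkU.2 y⁻¹ (inv_mem hy)
  rw [Sp_inv_right (G.hH hy)] at this
  rw [hw, map_sub, map_smul, h.neg k e, hk.1, h.neg k, this]; simp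

theorem GD.caseA [FiniteDimensional F V] (h : Symp ω) (hm : Module.finrank F V = 2 * m) (G : GD ω H e f A B m)
    (hR : ∀ w z, ω e w = 0 ∧ ω f w = 0 → RR ω H e w z) {g0 : V ≃ₗ[F] V} (hg0 : g0 ∈ H) (h0 : ω e (g0 e) ≠ 0) : Sp ω ≤ H := by
  have hz : ∀ z, RR ω H e 0 z := fun z => hR 0 z (by simp)
  have hO1 : ∀ v, ω e v ≠ 0 → OL H e v := by
    intro v hv
    set o := g0 e
    have ho : OL H e o := OL.self.map hg0
    set d := (ω e o / ω e v) • v - o with hd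
    have hd0 : ω e d = 0 := by
      rw [hd, map_sub, map_smul, smul_eq_mul]; field_simp; ring
    have hpd : d = ω d f • e + pk ω e f d := by
      conv_lhs => rw [pk_eq (ω := ω) e f d, hd0, zero_smul, add_zero]
    obtain ⟨g, hg, E⟩ := hR ((ω e o)⁻¹ • pk ω e f d) ((ω d f - ω ((ω e o)⁻¹ • pk ω e f d) o) / ω e o)
      (by simp [pk_K h G.ef d])
    have : g o = (ω e o / ω e v) • v := by
      have h1 : (ω e o / ω e v) • v = o + d := by rw [hd]; abel
      rw [h1, E]
      conv_rhs => rw [hpd]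
      match_scalars <;> field_simp <;> ring
    have h2 : v = (ω e v / ω e o) • g o := by
      rw [this, smul_smul]; field_simp; simp
    rw [h2]
    exact (ho.map hg).smul _
  have hO2 : ∀ v, OL H e v := by
    intro v
    by_cases v0 : v = 0
    · exact ⟨1, one_mem _, 0, by simp [v0]⟩
    have : ∃ x, ω e x ≠ 0 ∧ ω x v ≠ 0 := by
      by_cases h1 : ω f v = 0
      · obtain ⟨x, hx⟩ := h.nd' v0
        have hx' : ω x v = -1 := by rw [h.neg, hx]
        by_cases h2 : ω e x = 0
        · exact ⟨x + f, by simp [h2, G.ef], by simp [hx', h1]⟩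
        · exact ⟨x, h2, by simp [hx']⟩
      · exact ⟨f, by simp [G.ef], h1⟩
    obtain ⟨x, hx, hxv⟩ := this
    obtain ⟨g, hg, s, rfl⟩ := hO1 x hx
    have := hO1 (g⁻¹ v) (by
      rw [Sp_inv_right (G.hH hg)]; intro h3; apply hxv; simp [h3])
    simpa using this.map hg
  refine (Sp_le_Tv h hm).trans ?_
  rw [Tv, Subgroup.closure_le]
  rintro _ ⟨v, _, c, rfl⟩
  exact (hO2 v).tv G.hH h hz c

theorem GD.caseB [FiniteDimensional F V] (h : Symp ω) (G : GD ω H e f A B m)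
    (hz : ∀ z, RR ω H e 0 z) (hw : ∀ w z, ω e w = 0 ∧ ω f w = 0 → RR ω H e w z → w = 0)
    {g0 : V ≃ₗ[F] V} (hg0 : g0 ∈ H) (h0 : ω e (g0 e) ≠ 0)
    {y : V ≃ₗ[F] V} (hy : y ∈ H) (htr : LinearMap.trace F V y.toLinearMap ≠ 0)
    (hpl : ∀ U, NDP ω U → ¬ ∀ v ∈ U, y v ∈ U) : False := by
  have hfe : ω f e = -1 := by rw [h.neg, G.ef]
  set P := Submodule.span F {e, f} with hP
  have hPn : NDP ω P := ⟨e, f, G.ef, rfl⟩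
  have heP : e ∈ P := mem_sp_pair.2 ⟨1, 0, by simp⟩
  have hfP : f ∈ P := mem_sp_pair.2 ⟨0, 1, by simp⟩
  have b0 : ∀ o, OL H e o → ω e o ≠ 0 → ∀ a b : F, OL H e (a • e + b • o) := by
    intro o ho h1 a b
    by_cases hb : b = 0
    · rw [hb, zero_smul, add_zero]; exact OL.self.smul a
    · have := (ho.smul b).map (OL.self.tv G.hH h hz (a / (b * ω e o)))
      rw [tv_apply, map_smul, smul_eq_mul, div_mul_cancel₀ _ (mul_ne_zero hb h1), add_comm] at this
      exact this
  have b1 : ∀ o, OL H e o → ω e o ≠ 0 → o ∈ P := by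
    intro o ho h1
    obtain ⟨o', ho'⟩ : ∃ o', o' = (ω e o)⁻¹ • o := ⟨_, rfl⟩
    have h2 : ω e o' = 1 := by simp [ho', h1]
    have h2' : ω o' e = -1 := by rw [h.neg, h2]
    have hT : Tv h (Submodule.span F {e, o'}) ≤ H := by
      rw [Tv, Subgroup.closure_le]
      rintro _ ⟨v, hv, c, rfl⟩
      obtain ⟨a, b, rfl⟩ := mem_sp_pair.1 hv
      exact (b0 o' (ho' ▸ ho.smul _) (by simp [h2]) a b).tv G.hH h hz c
    obtain ⟨a, ha, a0, a2⟩ := G.exA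
    have k1 : e ∈ Submodule.span F {e, o'} := mem_sp_pair.2 ⟨1, 0, by simp⟩
    have k2 : o' ∈ Submodule.span F {e, o'} := mem_sp_pair.2 ⟨0, 1, by simp⟩
    obtain ⟨g, hg, g1, g2⟩ := Tv_pair h (NDP.nd h ⟨e, o', h2, rfl⟩) k1 k2 (Submodule.smul_mem _ a k1) (Submodule.smul_mem _ a⁻¹ k2) h2
      (by simp [h2, a0])
    have T' : Tor ω H e o' a := ⟨g, hT hg, fun v => by
      have h3 := Tv_fix h (x := pk ω e o' v) (by
        intro k hk
        obtain ⟨a, b, rfl⟩ := mem_sp_pair.1 hk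
        simp [pk_K h h2 v]) hg
      have h4 := pk_eq (ω := ω) e o' v
      have h5 : g v = ω v o' • a • e + ω e v • a⁻¹ • o' + pk ω e o' v := by
        conv_lhs => rw [h4]
        rw [map_add, map_add, map_smul, map_smul, g1, g2, h3]
      rw [h5, pk]; module⟩
    have := hw _ _ (by simp [pk_K h G.ef o']) (Tor.diff h a0 (G.tor _ (G.Ai a ha)) T' G.ef h2)
    have a1 : 1 - a ≠ 0 := by
      intro h6; apply a2; rw [← sub_eq_zero.1 h6]; ring
    have h7 := (smul_eq_zero.1 this).resolve_left a1
    have h8 : o' ∈ P := by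
      rw [pk_eq (ω := ω) e f o', h7, add_zero]; exact mem_sp_pair.2 ⟨_, _, rfl⟩
    have h9 : o = ω e o • o' := by rw [ho', smul_smul, mul_inv_cancel₀ h1, one_smul]
    rw [h9]; exact P.smul_mem _ h8
  have b2 : ∀ p ∈ P, OL H e p := by
    intro p hp
    have ho : OL H e (g0 e) := OL.self.map hg0
    obtain ⟨α, β, hab⟩ := mem_sp_pair.1 (b1 _ ho h0)
    have hβ : β ≠ 0 := by
      rintro rfl; apply h0; rw [hab]; simp [h.alt]
    obtain ⟨a, b, rfl⟩ := mem_sp_pair.1 hp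
    have := b0 _ ho h0 (a - b * α / β) (b / β)
    convert this using 1
    rw [hab]; match_scalars <;> field_simp; ring
  have bD : ∀ g ∈ H, g e ∈ P → ∀ v ∈ P, g v ∈ P := by
    intro g hg hge
    have hgf : g f ∈ P := by
      obtain ⟨α, β, hab⟩ := mem_sp_pair.1 hge
      by_cases h1 : ω e (g f) = 0
      · by_cases hβ : β = 0
        · exfalso
          have := mem_Sp.1 (G.hH hg) e f
          rw [hab, hβ, G.ef] at this
          simp [h1] at this
        · have := b1 _ ((b2 (f + e) (P.add_mem hfP heP)).map hg) (by rw [map_add, map_add, h1, hab]; simpa [h.alt, G.ef] using hβ)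
          rw [map_add] at this
          exact (P.add_mem_iff_left hge).1 this
      · exact b1 _ ((b2 f hfP).map hg) h1
    intro v hv
    obtain ⟨a, b, rfl⟩ := mem_sp_pair.1 hv
    rw [map_add, map_smul, map_smul]
    exact P.add_mem (P.smul_mem _ hge) (P.smul_mem _ hgf)
  have bE : ∀ g ∈ H, ∀ p ∈ P, ∀ p' ∈ P, ω p (g p') ≠ 0 → ∀ v ∈ P, g v ∈ P := by
    intro g hg p hp p' hp' hne
    have hgp : g p' ∈ P := by
      obtain ⟨g1, hg1, s, hs⟩ := b2 p hp
      have s0 : s ≠ 0 := by rintro rfl; apply hne; simp [hs]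
      have h1 : g1 e = s⁻¹ • p := by rw [hs, smul_smul, inv_mul_cancel₀ s0, one_smul]
      have h2 := b1 _ (((b2 p' hp').map hg).map (inv_mem hg1)) (by
        rw [Sp_inv_right (G.hH hg1), h1]; simp [s0, hne])
      have := bD g1 hg1 (by rw [h1]; exact P.smul_mem _ hp) _ h2
      simpa using this
    obtain ⟨g1, hg1, s, hs⟩ := b2 p' hp'
    have s0 : s ≠ 0 := by rintro rfl; apply hne; simp [hs]
    have h1 : g1 e = s⁻¹ • p' := by rw [hs, smul_smul, inv_mul_cancel₀ s0, one_smul]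
    have h2 := smul_sub_eq (bD g1 hg1 (by rw [h1]; exact P.smul_mem _ hp'))
    have h3 := bD (g * g1) (mul_mem hg hg1) (by rw [LinearEquiv.mul_apply, h1, map_smul]; exact P.smul_mem _ hgp)
    intro v hv
    rw [← h2] at hv
    obtain ⟨v', hv', rfl⟩ := (Submodule.mem_smul_pointwise_iff_exists _ _ _).1 hv
    exact h3 v' hv'
  have hsm : ∀ (g : V ≃ₗ[F] V) x, x ∈ g • P ↔ ∃ p ∈ P, g p = x := fun g x => Submodule.mem_smul_pointwise_iff_exists _ _ _
  have hnd : ∀ g ∈ H, NDP ω (g • P) := by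
    intro g hg
    refine ⟨g e, g f, by rw [mem_Sp.1 (G.hH hg), G.ef], ?_⟩
    ext x
    rw [hsm, mem_sp_pair]
    constructor
    · rintro ⟨p, hp, rfl⟩
      obtain ⟨a, b, rfl⟩ := mem_sp_pair.1 hp
      exact ⟨a, b, by simp⟩
    · rintro ⟨a, b, rfl⟩
      exact ⟨a • e + b • f, mem_sp_pair.2 ⟨a, b, rfl⟩, by simp⟩
  have hle' : ∀ g ∈ H, g • P ≤ sSup {N | ∃ g ∈ H, N = g • P} := fun g hg => le_sSup ⟨g, hg, rfl⟩
  refine htr (perm_trace y {N | ∃ g ∈ H, N = g • P} ?_ ?_ ?_ ?_)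
  · rintro _ ⟨g, hg, rfl⟩
    exact ⟨y * g, mul_mem hy hg, by rw [mul_smul]; rfl⟩
  · rintro _ ⟨g, hg, rfl⟩ hN
    refine hpl _ (hnd g hg) fun v hv => ?_
    rw [← hN]; exact ⟨v, hv, rfl⟩
  · rintro _ ⟨g, hg, rfl⟩
    let W : Submodule F V :=
      { carrier := {v | ∀ n ∈ g • P, ω n v = 0}
        zero_mem' := by simp
        add_mem' := fun {a b} ha hb n hn => by rw [map_add, ha n hn, hb n hn, add_zero]
        smul_mem' := fun c x hx n hn => by rw [map_smul, hx n hn, smul_zero] }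
    have hle : sSup ({N | ∃ g ∈ H, N = g • P} \ {g • P}) ≤ W := by
      apply sSup_le
      rintro _ ⟨⟨g', hg', rfl⟩, hne⟩ x hx n hn
      obtain ⟨p', hp', rfl⟩ := (hsm _ _).1 hx
      obtain ⟨p, hp, rfl⟩ := (hsm _ _).1 hn
      by_contra h1
      apply hne
      have := smul_sub_eq (bE (g⁻¹ * g') (mul_mem (inv_mem hg) hg') p hp p' hp' (by
        rw [LinearEquiv.mul_apply, Sp_inv_right (G.hH hg)]; exact h1))
      rw [mul_smul, inv_smul_eq_iff] at this
      exact this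
    rw [Submodule.disjoint_def]
    intro x hx hx'
    by_contra x0
    obtain ⟨v, hv, hv'⟩ := NDP.nd h (hnd g hg) x hx x0
    apply hv'
    rw [h.neg, hle hx' v hv, neg_zero]
  · refine G.irr1 h hy (fun _ => hpl P hPn) _ ?_ ?_ ?_
    · intro g hg w hw
      have : sSup {N | ∃ g ∈ H, N = g • P} ≤ (sSup {N | ∃ g ∈ H, N = g • P}).comap g.toLinearMap := by
        apply sSup_le
        rintro _ ⟨g', hg', rfl⟩ x hx
        refine hle' _ (mul_mem hg hg') ?_
        obtain ⟨p', hp', rfl⟩ := (hsm _ _).1 hx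
        exact (hsm _ _).2 ⟨p', hp', rfl⟩
      exact this hw
    · exact hle' 1 (one_mem _) (by rw [one_smul]; exact heP)
    · exact hle' 1 (one_mem _) (by rw [one_smul]; exact hfP)

end P15

section P16
open Classical Pointwise

variable {F V : Type} [Field F] [AddCommGroup V] [Module F V] {ω : V →ₗ[F] V →ₗ[F] F}
variable {H : Subgroup (V ≃ₗ[F] V)} {A : Finset F} {e f : V} {B : Finset (V ≃ₗ[F] V)} {m : ℕ}

theorem RR.shift (h2 : (2 : F) = 0) {u w : V} {z t : F} (T : RR ω H u (w + t • u) z) : RR ω H u w z := by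
  obtain ⟨g, hg, E⟩ := T
  refine ⟨g, hg, fun v => ?_⟩
  rw [E]
  simp only [map_add, map_smul, LinearMap.add_apply, LinearMap.smul_apply, smul_eq_mul]
  match_scalars <;> grind

def Cu (ω : V →ₗ[F] V →ₗ[F] F) (H : Subgroup (V ≃ₗ[F] V)) (u : V) : Prop :=
  (∀ w, ω u w = 0 → ∃ z, RR ω H u w z) ∧ ∀ z, RR ω H u 0 z → z = 0

theorem Cu.map (hH : H ≤ Sp ω) {u : V} (T : Cu ω H u) {g : V ≃ₗ[F] V} (hg : g ∈ H) : Cu ω H (g u) := by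
  refine ⟨fun w hw => ?_, fun z hz => T.2 z ?_⟩
  · obtain ⟨z, hz⟩ := T.1 (g⁻¹ w) (by rw [Sp_inv_right (hH hg), hw])
    exact ⟨z, by simpa using hz.map hH hg⟩
  · simpa using hz.map hH (inv_mem hg)

theorem Cu.smul {u : V} (T : Cu ω H u) {c : F} (hc : c ≠ 0) : Cu ω H (c • u) := by
  refine ⟨fun w hw => ?_, fun z hz => ?_⟩
  · obtain ⟨z, hz⟩ := T.1 (c • w) (by simpa using hw)
    have : RR ω H (c⁻¹ • c • u) (c • w) z := by rwa [smul_smul, inv_mul_cancel₀ hc, one_smul]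
    have := this.scale
    rw [smul_smul, inv_mul_cancel₀ hc, one_smul] at this
    exact ⟨_, this⟩
  · have := T.2 _ (by simpa using hz.scale)
    simpa [hc] using this

theorem Cu.ol (hH : H ≤ Sp ω) (T : Cu ω H e) {u : V} (hu : OL H e u) (u0 : u ≠ 0) : Cu ω H u := by
  obtain ⟨g, hg, s, rfl⟩ := hu
  exact (T.map hH hg).smul (by rintro rfl; simp at u0)

theorem Cu.uniq (h : Symp ω) {u w : V} {z z' : F} (T : Cu ω H u) (hw : ω u w = 0) (h1 : RR ω H u w z) (h2 : RR ω H u w z') : z = z' := by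
  have := T.2 (z - z') (by simpa [h.alt, sub_eq_add_neg] using h1.add h (h2.neg h hw) hw (by simp [hw]))
  exact sub_eq_zero.1 this

theorem RR.pres (h : Symp ω) (h2 : (2 : F) = 0) {Q : V → F} (hQ : QF ω Q) {u w : V} (hu : Q u = 0) (huw : ω u w = 0) {g : V ≃ₗ[F] V}
    (E : ∀ v, g v = v + ω u v • (w + Q w • u) + ω w v • u) (v : V) : Q (g v) = Q v := by
  have e1 : ω v u = - ω u v := h.neg _ _
  have e2 : ω v w = - ω w v := h.neg _ _
  have e3 : ω w u = 0 := by rw [h.neg, huw, neg_zero]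
  rw [E]
  simp only [hQ.ad, hQ.sm, map_add, map_smul, LinearMap.add_apply, LinearMap.smul_apply, smul_eq_mul, h.alt, hu, e1, e2, e3]
  linear_combination (-ω u v * ω w v) * h2

theorem nw (h : Symp ω) (h2 : (2 : F) = 0) {e' w : V} {θ : F} (t0 : θ ≠ 0) (h1 : ω e e' = 1) (hw : ω e w = 0) (hw' : ω e' w = 0)
    (T : RR ω H e w θ) (T' : RR ω H e' (θ⁻¹ • w) θ⁻¹) :
    ∃ n ∈ H, n e = θ⁻¹ • e' ∧ n e' = θ • e ∧ ∀ x, ω e x = 0 → ω e' x = 0 → n x = x + (ω w x * θ⁻¹) • w := by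
  obtain ⟨g, hg, E⟩ := T
  obtain ⟨k, hk, E'⟩ := T'
  have a1 : ω e' e = -1 := by rw [h.neg, h1]
  have a2 : ω w e = 0 := by rw [h.neg, hw, neg_zero]
  have a3 : ω w e' = 0 := by rw [h.neg, hw', neg_zero]
  refine ⟨g * k * g, mul_mem (mul_mem hg hk) hg, ?_, ?_, ?_⟩
  · simp only [LinearEquiv.mul_apply, E, E', map_add, map_smul, LinearMap.add_apply, LinearMap.smul_apply, smul_eq_mul, h.alt, hw, hw', h1, a1, a2, a3]
    match_scalars <;> field_simp <;> grind
  · simp only [LinearEquiv.mul_apply, E, E', map_add, map_smul, LinearMap.add_apply, LinearMap.smul_apply, smul_eq_mul, h.alt, hw, hw', h1, a1, a2, a3]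
    match_scalars <;> field_simp <;> grind
  · intro x hx hx'
    simp only [LinearEquiv.mul_apply, E, E', map_add, map_smul, LinearMap.add_apply, LinearMap.smul_apply, smul_eq_mul, h.alt, hw, hw', h1, a1, a2, a3, hx, hx']
    match_scalars <;> field_simp <;> grind

variable [Fintype F]

theorem GD.theta [Finite V] (h : Symp ω) (h2 : (2 : F) = 0) (G : GD ω H e f A B m) {Q : V → F} (hQ : QF ω Q) (hb : ∀ b ∈ B, ∀ v, Q (b v) = Q v)
    {u : V} (hC : Cu ω H u) (hub : ∀ b ∈ B, b u = u) (huK : ∀ k, ω e k = 0 ∧ ω f k = 0 → ω u k = 0) (w : V) (hw : ω e w = 0 ∧ ω f w = 0) : RR ω H u w (Q w) := by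
  have Q0 : Q 0 = 0 := by simpa using hQ.sm 0 0
  by_cases w0 : w = 0
  · rw [w0, Q0]; exact RR.zero u
  obtain ⟨b, hbB, b', hbB', hbb⟩ := Finset.one_lt_card.1 (G.n3 ⟨w, hw, w0⟩)
  have hs : ∃ k, (ω e k = 0 ∧ ω f k = 0) ∧ b k + b' k = w := by
    let φ : {k // ω e k = 0 ∧ ω f k = 0} → {k // ω e k = 0 ∧ ω f k = 0} := fun k => ⟨b k.1 + b' k.1, by
      simp [G.bK h hbB k.2, G.bK h hbB' k.2]⟩
    have hi : Function.Injective φ := by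
      intro k k' hkk
      by_contra hne
      refine hbb (G.Bf b hbB b' hbB' (k.1 - k'.1) (by simp [k.2, k'.2]) (by simp [k.2, k'.2]) (by rw [sub_ne_zero]; exact fun h => hne (Subtype.ext h)) ?_)
      have h3 := congrArg Subtype.val hkk
      simp only [φ] at h3
      have h4 := add_self_V h2 (b' k.1)
      have h5 := add_self_V h2 (b' k'.1)
      rw [map_sub, map_sub]
      linear_combination (norm := module) h3 - h4 + h5
    obtain ⟨k, hk⟩ := Finite.injective_iff_surjective.1 hi ⟨w, hw⟩
    exact ⟨k.1, k.2, congrArg Subtype.val hk⟩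
  obtain ⟨k, hk, rfl⟩ := hs
  obtain ⟨z, hz⟩ := hC.1 k (huK k hk)
  have z1 := hz.map (G.hH) (G.B1 b hbB).1
  have z2 := hz.map (G.hH) (G.B1 b' hbB').1
  rw [hub b hbB] at z1
  rw [hub b' hbB'] at z2
  have := z1.add h z2 (huK _ (G.bK h hbB hk)) (huK _ (G.bK h hbB' hk))
  convert this using 1
  rw [hQ.ad, hb b hbB, hb b' hbB']
  linear_combination (Q k - z) * h2

theorem GD.toCu (h : Symp ω) (h2 : (2 : F) = 0) (G : GD ω H e f A B m)
    (h3 : ∀ w, ω e w = 0 ∧ ω f w = 0 → ∃ z, RR ω H e w z) (h4 : ∀ z, RR ω H e 0 z → z = 0) : Cu ω H e := by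
  refine ⟨fun w hw => ?_, h4⟩
  obtain ⟨z, hz⟩ := h3 _ (pk_K h G.ef w)
  refine ⟨z, RR.shift h2 (t := ω w f) ?_⟩
  have : pk ω e f w = w + ω w f • e := by
    rw [pk, hw]; linear_combination (norm := module) -add_self_V h2 (ω w f • e)
  rwa [this] at hz

/-- the basic move -/
theorem GD.move [Finite V] (h : Symp ω) (h2 : (2 : F) = 0) (G : GD ω H e f A B m) (hC : Cu ω H e) {Q : V → F} (hQ : QF ω Q)
    (hb : ∀ b ∈ B, ∀ v, Q (b v) = Q v) (he : Q e = 0) (hf : Q f = 0) {o : V} (ho : ω e o = 1) :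
    ∃ g ∈ H, (∀ v, Q (g v) = Q v) ∧ g o = f + Q o • e := by
  have hk := pk_K h G.ef o
  obtain ⟨g, hg, E⟩ := G.theta h h2 hQ hb hC (fun b hb => (G.B1 b hb).2.1) (fun k hk => hk.1) _ hk
  refine ⟨g, hg, RR.pres h h2 hQ he hk.1 E, ?_⟩
  have h3 := pk_eq (ω := ω) e f o
  rw [ho] at h3
  set k := pk ω e f o with hkd
  have e1 : ω k e = 0 := by rw [h.neg, hk.1, neg_zero]
  have e2 : ω k f = 0 := by rw [h.neg, hk.2, neg_zero]
  have h4 : ω k o = 0 := by rw [h3]; simp [h.alt, e1, e2]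
  have h5 : Q o = ω o f + Q k := by
    conv_lhs => rw [h3]
    simp [hQ.ad, hQ.sm, he, hf, G.ef, hk]
  rw [E, ho, h4, h5]
  linear_combination (norm := module) h3 + add_self_V h2 k

theorem GD.claim1 [Finite V] (h : Symp ω) (h2 : (2 : F) = 0) (G : GD ω H e f A B m) (hC : Cu ω H e) {Q : V → F} (hQ : QF ω Q)
    (hb : ∀ b ∈ B, ∀ v, Q (b v) = Q v) (he : Q e = 0) (hf : Q f = 0) (hK : ∃ k, (ω e k = 0 ∧ ω f k = 0) ∧ k ≠ 0)
    {o : V} (hol : OL H e o) (ho : ω e o = 1) : Q o = 0 := by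
  obtain ⟨g, hg, -, hgo⟩ := G.move h h2 hC hQ hb he hf ho
  set c := Q o
  have h3 : OL H e (f + c • e) := hgo ▸ hol.map hg
  have h4 : ω e (f + c • e) = 1 := by simp [G.ef, h.alt]
  have hC' := hC.ol G.hH h3 (by rintro h0; simp [h0] at h4)
  have hK' : ∀ k, ω e k = 0 ∧ ω f k = 0 → ω (f + c • e) k = 0 := by intro k hk; simp [hk]
  have t1 := G.theta h h2 hQ hb hC (fun b hb => (G.B1 b hb).2.1) (fun k hk => hk.1)
  have t2 := G.theta h h2 hQ hb hC' (fun b hb => by rw [map_add, map_smul, (G.B1 b hb).2.1, (G.B1 b hb).2.2]) hK'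
  obtain ⟨w, hw, hQw⟩ : ∃ w, (ω e w = 0 ∧ ω f w = 0) ∧ Q w ≠ 0 := by
    by_contra! hc
    obtain ⟨k, hk, k0⟩ := hK
    obtain ⟨k', hk', h5⟩ := K_nd h G.ef hk k0
    have := hQ.ad k' k
    rw [hc k hk, hc k' hk', hc (k' + k) (by simp [hk, hk'])] at this
    apply h5; simpa using this.symm
  have key : ∀ w, (ω e w = 0 ∧ ω f w = 0) → Q w ≠ 0 → _ := fun w hw hQw => nw h h2 hQw h4 hw.1 (hK' w hw) (t1 w hw) (by
    have := t2 ((Q w)⁻¹ • w) (by simp [hw])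
    rwa [hQ.sm, show (Q w)⁻¹ ^ 2 * Q w = (Q w)⁻¹ by field_simp] at this)
  obtain ⟨l, hl, l0, l2⟩ := G.exA
  have hlw : Q (l • w) = l ^ 2 * Q w := hQ.sm _ _
  obtain ⟨n, hn, n1, n2, n3⟩ := key w hw hQw
  obtain ⟨n', hn', n1', n2', n3'⟩ := key (l • w) (by simp [hw]) (by rw [hlw]; exact mul_ne_zero (pow_ne_zero _ l0) hQw)
  rw [hlw] at n1' n2' n3'
  have T' : Tor ω H e (f + c • e) (l ^ 2) := ⟨n' * n, mul_mem hn' hn, fun v => by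
    have h5 := pk_K h h4 v
    have h6 := pk_eq (ω := ω) e (f + c • e) v
    generalize pk ω e (f + c • e) v = x at h5 h6
    generalize f + c • e = e' at *
    have ww : ω w w = 0 := h.alt w
    have := n3 x h5.1 h5.2
    have h7 : (n' * n) v = (ω v e' * l ^ 2) • e + (ω e v * (l ^ 2)⁻¹) • e' + x := by
      conv_lhs => rw [h6]
      rw [LinearEquiv.mul_apply]
      simp only [map_add, map_smul, n1, n2, this, n1', n2', n3' x h5.1 h5.2, n3' w hw.1 (hK' w hw), LinearMap.smul_apply, ww, smul_eq_mul]
      match_scalars <;> field_simp <;> grind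
    rw [h7]
    conv_rhs => enter [1, 1]; rw [h6]
    module⟩
  have a2 : (l ^ 2) ^ 2 ≠ 1 := by
    intro h8; apply l2
    have : (l ^ 2 - 1) ^ 2 = 0 := by linear_combination h8 + (1 - l ^ 2) * h2
    exact sub_eq_zero.1 (pow_eq_zero_iff two_ne_zero |>.1 this)
  have hlA : l ^ 2 ∈ A := by rw [sq]; exact G.Am _ hl _ hl
  have := Tor.diff h (pow_ne_zero 2 l0) (G.tor _ (G.Ai _ hlA)) T' G.ef h4
  have e1 : pk ω e f (f + c • e) = 0 := by
    simp [pk, h.alt, G.ef]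
  have e2 : ω (f + c • e) f = c := by simp [h.alt, G.ef]
  rw [e1, e2, smul_zero] at this
  exact (mul_eq_zero.1 (hC.2 _ this)).resolve_right (sub_ne_zero.2 a2.symm)

theorem GD.claim2 [Finite V] (h : Symp ω) (h2 : (2 : F) = 0) (G : GD ω H e f A B m) (hC : Cu ω H e) {Q : V → F} (hQ : QF ω Q)
    (hb : ∀ b ∈ B, ∀ v, Q (b v) = Q v) (he : Q e = 0) (hf : Q f = 0) (hK : ∃ k, (ω e k = 0 ∧ ω f k = 0) ∧ k ≠ 0)
    {g : V ≃ₗ[F] V} (hg : g ∈ H) (h0 : ω e (g e) ≠ 0) : OL H e f ∧ ∀ v, Q (g v) = Q v := by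
  set s := ω e (g e) with hs
  have ho : ω e (s⁻¹ • g e) = 1 := by simp [← hs, h0]
  have hol : OL H e (s⁻¹ • g e) := (OL.self.map hg).smul _
  obtain ⟨k, hk, hkQ, hko⟩ := G.move h h2 hC hQ hb he hf ho
  rw [G.claim1 h h2 hC hQ hb he hf hK hol ho, zero_smul, add_zero] at hko
  have hf' : OL H e f := hko ▸ hol.map hk
  refine ⟨hf', ?_⟩
  obtain ⟨g', hg'⟩ : ∃ g', g' = k * g := ⟨_, rfl⟩
  have hgH : g' ∈ H := hg' ▸ mul_mem hk hg
  suffices h3 : ∀ v, Q (g' v) = Q v by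
    intro v; rw [← h3 v, hg', LinearEquiv.mul_apply, hkQ]
  have ge : g' e = s • f := by
    rw [← hko, map_smul, smul_smul, mul_inv_cancel₀ h0, one_smul, hg']; rfl
  have gS := mem_Sp.1 (G.hH hgH)
  have hfe : ω f (-e) = 1 := by rw [map_neg, ← h.neg, G.ef]
  have f0 : f ≠ 0 := by rintro rfl; simpa using G.ef
  have hCf := hC.ol G.hH hf' f0
  have sff : ω f (g' f) = s⁻¹ := by
    have := gS e f
    rw [ge, G.ef] at this
    simp at this
    exact eq_inv_of_mul_eq_one_right this
  have Qf : Q (g' f) = 0 := by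
    have := (G.swap h).claim1 h h2 hCf hQ hb hf (by simpa [he] using hQ.sm (-1) e) (by
      obtain ⟨k, h1, h2⟩ := hK
      exact ⟨k, ⟨h1.2, by simp [h1.1]⟩, h2⟩) (o := s • g' f) ((OL.self.map hgH).smul _) (by simp [sff, h0])
    rw [hQ.sm] at this
    simpa [h0] using this
  have Qk : ∀ k, ω e k = 0 ∧ ω f k = 0 → Q (g' k) = Q k := by
    intro k hk
    have r1 := (G.theta h h2 hQ hb hC (fun b hb => (G.B1 b hb).2.1) (fun k hk => hk.1) k hk).map G.hH hgH
    rw [ge] at r1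
    have r1 := r1.scale
    have r2 := fun w => G.theta h h2 hQ hb hCf (fun b hb => (G.B1 b hb).2.2) (fun k hk => hk.2) w
    have w1 : ω (s • g' k) f = 0 := by
      have := gS e k
      rw [ge, hk.1] at this
      rw [h.neg]; simpa using this
    have hx := pk_K h G.ef (s • g' k)
    have h6 := pk_eq (ω := ω) e f (s • g' k)
    rw [w1, zero_smul, zero_add, add_comm] at h6
    generalize pk ω e f (s • g' k) = x at h6 hx
    have h7 := hCf.uniq h hx.2 (RR.shift h2 (h6 ▸ r1)) (r2 x hx)
    have h8 : Q (s • g' k) = Q x := by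
      rw [h6, hQ.ad, hQ.sm, hf, (ω x).map_smul, h.neg x f, hx.2]; simp
    rw [← h8, hQ.sm] at h7
    exact (mul_left_cancel₀ (pow_ne_zero 2 h0) h7).symm
  intro v
  have hx := pk_K h G.ef v
  have h6 := pk_eq (ω := ω) e f v
  generalize pk ω e f v = x at h6 hx
  rw [h6]
  simp only [map_add, map_smul, hQ.ad, hQ.sm, LinearMap.add_apply, LinearMap.smul_apply, gS, Qk x hx, Qf, he, hf]
  rw [ge, hQ.sm, hf]; simp

theorem GD.caseC [Finite V] (h : Symp ω) (h2 : (2 : F) = 0) (G : GD ω H e f A B m) (hC : Cu ω H e) {Q : V → F} (hQ : QF ω Q)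
    (hb : ∀ b ∈ B, ∀ v, Q (b v) = Q v) (he : Q e = 0) (hf : Q f = 0) (hK : ∃ k, (ω e k = 0 ∧ ω f k = 0) ∧ k ≠ 0)
    {g0 : V ≃ₗ[F] V} (hg0 : g0 ∈ H) (h0 : ω e (g0 e) ≠ 0) {g : V ≃ₗ[F] V} (hg : g ∈ H) (v : V) : Q (g v) = Q v := by
  have c2 := fun (g : V ≃ₗ[F] V) (hg : g ∈ H) (h0 : ω e (g e) ≠ 0) => G.claim2 h h2 hC hQ hb he hf hK hg h0
  by_cases h1 : ω e (g e) = 0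
  swap
  · exact (c2 g hg h1).2 v
  have hfO := (c2 g0 hg0 h0).1
  have : ∃ o, OL H e o ∧ ω e o ≠ 0 ∧ ω o (g e) ≠ 0 := by
    by_cases h3 : ω f (g e) = 0
    · have e0 : g e ≠ 0 := by
        intro h4
        have : e = 0 := by simpa using h4
        have h5 := G.ef
        rw [this] at h5; simp at h5
      obtain ⟨w, hw, hwg⟩ := K_nd h G.ef ⟨h1, h3⟩ e0
      obtain ⟨u, hu, E⟩ := G.theta h h2 hQ hb hC (fun b hb => (G.B1 b hb).2.1) (fun k hk => hk.1) w hw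
      refine ⟨u f, hfO.map hu, ?_, ?_⟩
      · rw [E]; simp [G.ef, hw, h.alt]
      · rw [E]; simp [G.ef, h1, h3, hwg]
    · exact ⟨f, hfO, by simp [G.ef], h3⟩
  obtain ⟨_, ⟨k, hk, s, rfl⟩, o1, o2⟩ := this
  have k1 := (c2 k hk (by intro h4; simp [h4] at o1)).2
  have k2 := (c2 (k⁻¹ * g) (mul_mem (inv_mem hk) hg) (by
    rw [LinearEquiv.mul_apply, Sp_inv_right (G.hH hk)]; intro h4; simp [h4] at o2)).2 v
  rw [← k2, ← k1 ((k⁻¹ * g) v), LinearEquiv.mul_apply, le_inv_apply]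

end P16

section P17
open Classical Pointwise

variable {F V : Type} [Field F] [AddCommGroup V] [Module F V] {ω : V →ₗ[F] V →ₗ[F] F}
variable {H : Subgroup (V ≃ₗ[F] V)} {A : Finset F} {e f : V} {B : Finset (V ≃ₗ[F] V)} {m : ℕ} [Fintype F]

theorem GD.core [FiniteDimensional F V] [Fintype V] (h : Symp ω) (hm : Module.finrank F V = 2 * m) (G : GD ω H e f A B m)
    {χ : F → ℤ} {y : V ≃ₗ[F] V} (hy : y ∈ H) (Y : Yc ω χ m y)
    (hQ : (2 : F) = 0 → 2 ≤ m → ∃ Q, QF ω Q ∧ (∀ b ∈ B, ∀ v, Q (b v) = Q v) ∧ Q e = 0 ∧ Q f = 0 ∧ ga χ Q < 0)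
    (hm2 : (∃ k, (ω e k = 0 ∧ ω f k = 0) ∧ k ≠ 0) → 2 ≤ m)
    {g : V ≃ₗ[F] V} (hg : g ∈ H) {c : F} (ge : g e = c • e) (gf : ¬ ∃ c : F, g f = c • f) : Sp ω ≤ H := by
  have e0 : e ≠ 0 := by rintro rfl; simpa using G.ef
  have c0 : c ≠ 0 := by
    rintro rfl; apply e0; simpa using ge
  obtain ⟨g0, hg0, h0⟩ := G.irr2 h hy (Y.eig e e0)
  obtain ⟨a, ha, a0, a2⟩ := G.exA
  have h1 : ω e (c • g f) = 1 := by
    have := mem_Sp.1 (G.hH hg) e f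
    rw [ge, G.ef] at this
    simpa using this
  have T := (G.tor a ha).map G.hH hg
  rw [ge] at T
  have T' : Tor ω H e (c • g f) a := by
    have := T.scale (inv_ne_zero c0)
    rwa [smul_smul, inv_mul_cancel₀ c0, one_smul, inv_inv] at this
  have R := Tor.diff h a0 (G.tor _ (G.Ai _ ha)) T' G.ef h1
  have a1 : 1 - a ≠ 0 := by
    intro h6; apply a2; rw [← sub_eq_zero.1 h6]; ring
  have key := G.stage2 h (by simp [pk_K h G.ef]) R (by
    by_contra! hc
    have k1 := (smul_eq_zero.1 hc.1).resolve_left a1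
    have k2 := (mul_eq_zero.1 hc.2).resolve_right (sub_ne_zero.2 a2.symm)
    apply gf
    refine ⟨c⁻¹, ?_⟩
    have := pk_eq (ω := ω) e f (c • g f)
    rw [h1, k1, k2] at this
    rw [eq_inv_smul_iff₀ c0, this]; simp)
  rcases key with k | ⟨hK, ⟨k1, k2⟩ | ⟨k0, k1, k2⟩⟩
  · exact G.caseA h hm k hg0 h0
  · exact (G.caseB h k1 k2 hg0 h0 hy Y.tr (Y.pl (hm2 hK))).elim
  · exfalso
    obtain ⟨Q, q1, q2, q3, q4, q5⟩ := hQ k0 (hm2 hK)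
    exact Y.fm (hm2 hK) k0 ⟨Q, q1, fun v => G.caseC h k0 (G.toCu h k0 k1 k2) q1 q2 q3 q4 hK hg0 h0 hy v, by linarith⟩

theorem GD.gen [FiniteDimensional F V] [Fintype V] [Fintype (V ≃ₗ[F] V)] (h : Symp ω) (hm : Module.finrank F V = 2 * m) (hm1 : 1 ≤ m) (G : GD ω H e f A B m)
    {χ : F → ℤ} {y : V ≃ₗ[F] V} (hy : y ∈ H) (Y : Yc ω χ m y)
    (hQ : (2 : F) = 0 → 2 ≤ m → ∃ Q, QF ω Q ∧ (∀ b ∈ B, ∀ v, Q (b v) = Q v) ∧ Q e = 0 ∧ Q f = 0 ∧ ga χ Q < 0) : Sp ω ≤ H := by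
  have hfe : ω f e = -1 := by rw [h.neg, G.ef]
  have hm2 : (∃ k, (ω e k = 0 ∧ ω f k = 0) ∧ k ≠ 0) → 2 ≤ m := by
    rintro ⟨k, hk, k0⟩
    have li : LinearIndependent F ![e, f, k] := by
      rw [Fintype.linearIndependent_iff]
      intro c hc
      rw [Fin.sum_univ_three] at hc
      simp only [Matrix.cons_val_zero, Matrix.cons_val_one, Matrix.cons_val] at hc
      have c1 := congrArg (ω e) hc
      have c2 := congrArg (ω f) hc
      simp [h.alt, G.ef, hk] at c1
      simp [h.alt, hfe, hk] at c2
      rw [c1, c2] at hc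
      have c3 : c 2 = 0 := by simpa [k0] using hc
      intro i; fin_cases i <;> assumption
    have := li.fintype_card_le_finrank
    simp at this
    omega
  have hpl : (∃ k, ω e k = 0 ∧ ω f k = 0 ∧ k ≠ 0) → ¬ ∀ v ∈ Submodule.span F {e, f}, y v ∈ Submodule.span F {e, f} := by
    rintro ⟨k, k1, k2, k3⟩
    exact Y.pl (hm2 ⟨k, ⟨k1, k2⟩, k3⟩) _ ⟨e, f, G.ef, rfl⟩
  obtain ⟨g, hg, hne⟩ := G.stage1 h hm hm1 hy Y.eig Y.tr hpl
  by_cases h1 : ∃ c : F, g e = c • e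
  · obtain ⟨c, hc⟩ := h1
    exact G.core h hm hy Y hQ hm2 hg hc (fun h2 => hne ⟨fun _ => h2, fun _ => ⟨c, hc⟩⟩)
  · have h2 : ∃ c : F, g f = c • f := by
      by_contra h2; exact hne ⟨fun h => (h1 h).elim, fun h => (h2 h).elim⟩
    obtain ⟨c, hc⟩ := h2
    refine (G.swap h).core h hm hy Y (fun k0 k1 => ?_) (fun ⟨k, k1, k2⟩ => hm2 ⟨k, ⟨by simpa using k1.2, k1.1⟩, k2⟩) hg hc ?_
    · obtain ⟨Q, q1, q2, q3, q4, q5⟩ := hQ k0 k1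
      exact ⟨Q, q1, q2, q4, by simpa [q3] using q1.sm (-1) e, q5⟩
    · rintro ⟨c, hc⟩
      exact h1 ⟨c, by simpa using hc⟩

end P17

section P18
open Classical Pointwise Polynomial

structure KD (F K : Type) [Field F] [Fintype F] [CommRing K] [Algebra F K] (n : ℕ) (κ : K →ₗ[F] K →ₗ[F] F) : Prop where
  symp : Symp κ
  fin : Finite K
  fr : Module.finrank F K = 2 * n
  un : ∀ x : K, x ≠ 0 → IsUnit x
  ad : ∀ d : Kˣ, d ^ (Fintype.card F ^ n + 1) = 1 ↔ ∀ u v, κ (d * u) (d * v) = κ u v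
  cy : IsCyclic Kˣ
  cd : 1 ≤ n → Nat.card (powMonoidHom (α := Kˣ) (Fintype.card F ^ n + 1)).ker = Fintype.card F ^ n + 1
  rt : ∀ r : F[X], r ≠ 0 → 1 ≤ r.natDegree → Nat.card {d : Kˣ // d ^ (Fintype.card F ^ n + 1) = 1 ∧ aeval (d : K) r = 0} ≤ r.natDegree

variable {F K : Type} [Field F] [CommRing K] [Algebra F K]

def mω (κ : K →ₗ[F] K →ₗ[F] F) : (F × F × K) →ₗ[F] (F × F × K) →ₗ[F] F :=
  LinearMap.mk₂ F (fun u v => u.1 * v.2.1 - u.2.1 * v.1 + κ u.2.2 v.2.2)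
    (by intros; simp; ring) (by intros; simp; ring) (by intros; simp; ring) (by intros; simp; ring)

@[simp] theorem mω_apply (κ : K →ₗ[F] K →ₗ[F] F) (u v : F × F × K) : mω κ u v = u.1 * v.2.1 - u.2.1 * v.1 + κ u.2.2 v.2.2 := rfl

theorem mω_symp {κ : K →ₗ[F] K →ₗ[F] F} (h : Symp κ) : Symp (mω κ) := by
  refine ⟨fun v => by simp [h.alt]; ring, fun v hv => ?_⟩
  have h1 := hv (0, 1, 0)
  have h2 := hv (1, 0, 0)
  have h3 := h.nd v.2.2 (fun w => by simpa using hv (0, 0, w))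
  simp at h1 h2
  ext <;> simp [h1, h2, h3]

def Xm : Fˣ × Kˣ →* ((F × F × K) ≃ₗ[F] (F × F × K)) :=
  MonoidHom.mk' (fun p =>
    { toFun := fun v => (p.1 * v.1, (p.1⁻¹ : Fˣ) * v.2.1, p.2 * v.2.2)
      map_add' := fun u v => by simp [mul_add]
      map_smul' := fun c v => by simp [mul_left_comm]
      invFun := fun v => ((p.1⁻¹ : Fˣ) * v.1, p.1 * v.2.1, (p.2⁻¹ : Kˣ) * v.2.2)
      left_inv := fun v => by simp
      right_inv := fun v => by simp }) (fun p p' => by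
    apply LinearEquiv.ext; intro v
    simp [mul_assoc, mul_left_comm])

theorem Xm_apply (p : Fˣ × Kˣ) (v : F × F × K) : Xm p v = (p.1 * v.1, (p.1⁻¹ : Fˣ) * v.2.1, p.2 * v.2.2) := rfl

variable [Fintype F] {n : ℕ} {κ : K →ₗ[F] K →ₗ[F] F}

theorem Xm_mem (D : KD F K n κ) (a : Fˣ) {d : Kˣ} (hd : d ^ (Fintype.card F ^ n + 1) = 1) : Xm (a, d) ∈ Sp (mω κ) := by
  intro u v
  simp only [mω_apply, Xm_apply, (D.ad d).1 hd, Units.val_inv_eq_inv_val]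
  have := a.ne_zero
  field_simp

/-- free action divisibility -/
theorem KD.dvd (D : KD F K n κ) (Z : Subgroup Kˣ) (S : Set K) (h0 : (0 : K) ∉ S) (hS : ∀ z ∈ Z, ∀ s ∈ S, (z : K) * s ∈ S) : Nat.card Z ∣ Nat.card S := by
  have e1 : Nat.card S = Nat.card {u : Kˣ // (u : K) ∈ S} := by
    refine (Nat.card_congr (Equiv.ofBijective (fun u => ⟨u.1, u.2⟩) ⟨?_, ?_⟩)).symm
    · intro u v h; simpa [Subtype.ext_iff, Units.ext_iff] using h
    · rintro ⟨s, hs⟩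
      obtain ⟨u, rfl⟩ := D.un s (by rintro rfl; exact h0 hs)
      exact ⟨⟨u, hs⟩, rfl⟩
  have e2 : {u : Kˣ | (u : K) ∈ S} = (QuotientGroup.mk : Kˣ → Kˣ ⧸ Z) ⁻¹' (QuotientGroup.mk '' {u : Kˣ | (u : K) ∈ S}) := by
    ext u
    constructor
    · exact fun hu => ⟨u, hu, rfl⟩
    · rintro ⟨v, hv, hvu⟩
      have := hS _ (QuotientGroup.eq.1 hvu) _ hv
      have h3 : ((v⁻¹ * u : Kˣ) : K) * v = u := by rw [← Units.val_mul]; congr 1; rw [mul_comm, mul_inv_cancel_left]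
      rw [h3] at this; exact this
  have e3 := Nat.card_congr (QuotientGroup.preimageMkEquivSubgroupProdSet Z (QuotientGroup.mk '' {u : Kˣ | (u : K) ∈ S}))
  rw [← e2, Nat.card_prod] at e3
  rw [e1]; exact ⟨_, e3⟩

theorem KD.irr (D : KD F K n κ) {z : Kˣ} (hz : z ^ (Fintype.card F ^ n + 1) = 1) (h3 : 1 ≤ n → 3 ≤ orderOf z) (hn : 1 ≤ n → Fintype.card F ^ (n - 1) < orderOf z)
    (U : Submodule F K) (hU : ∀ u ∈ U, (z : K) * u ∈ U) (hne : ∃ u ∈ U, u ≠ 0) (k : K) : k ∈ U := by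
  have := D.fin
  have := Fintype.ofFinite K
  have hfd : FiniteDimensional F K := inferInstance
  have q1 := Fintype.one_lt_card (α := F)
  set q := Fintype.card F
  suffices U = ⊤ by rw [this]; trivial
  by_contra hT
  have hlt := Submodule.finrank_lt hT
  rw [D.fr] at hlt
  have n1 : 1 ≤ n := by omega
  have hd : orderOf z ∣ q ^ Module.finrank F U - 1 := by
    have := D.dvd (Subgroup.zpowers z) {u | u ∈ U ∧ u ≠ 0} (by simp) (by
      intro w hw s hs
      refine ⟨?_, ?_⟩
      · obtain ⟨i, rfl⟩ := (mem_powers_iff_mem_zpowers (x := z)).2 hw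
        induction i with
        | zero => simpa using hs.1
        | succ i ih =>
          have := hU _ (ih (Subgroup.npow_mem_zpowers _ _))
          simpa [pow_succ', mul_assoc] using this
      · intro h0; apply hs.2
        rwa [Units.mul_right_eq_zero] at h0)
    rw [Nat.card_zpowers] at this
    convert this using 1
    have e1 := Module.card_eq_pow_finrank (K := F) (V := U)
    have e2 : Nat.card {u | u ∈ U ∧ u ≠ 0} = Nat.card {u : U // u ≠ 0} := Nat.card_congr
      { toFun := fun u => ⟨⟨u.1, u.2.1⟩, fun h => u.2.2 (congrArg Subtype.val h)⟩
        invFun := fun u => ⟨u.1.1, u.1.2, fun h => u.2 (Subtype.ext h)⟩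
        left_inv := fun _ => rfl
        right_inv := fun _ => rfl }
    rw [e2, Nat.card_eq_fintype_card, ← e1]
    have := Fintype.card_subtype_compl (fun u : U => u = 0)
    simp only [Fintype.card_unique] at this
    rw [← this]
  have hd2 : orderOf z ∣ q ^ (2 * n) - 1 := by
    refine (orderOf_dvd_of_pow_eq_one hz).trans ⟨q ^ n - 1, ?_⟩
    rw [mul_comm 2 n, pow_mul]
    simpa using Nat.sq_sub_sq (q ^ n) 1
  have hU1 : 1 ≤ Module.finrank F U := by
    obtain ⟨u, hu, u0⟩ := hne
    exact Submodule.one_le_finrank_iff.2 (fun h => u0 (by rw [h] at hu; simpa using hu))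
  have hd3 := Nat.dvd_gcd hd hd2
  rw [Nat.pow_sub_one_gcd_pow_sub_one] at hd3
  have g1 := Nat.gcd_dvd_left (Module.finrank F U) (2 * n)
  have g2 := Nat.gcd_dvd_right (Module.finrank F U) (2 * n)
  have g3 := Nat.le_of_dvd (by omega) g1
  set j := Nat.gcd (Module.finrank F U) (2 * n)
  have j1 : 1 ≤ j := Nat.gcd_pos_of_pos_left _ hU1
  have hjn : j ≤ n := by
    obtain ⟨c, hc⟩ := g2
    have : 2 ≤ c := by by_contra h; interval_cases c <;> omega
    nlinarith
  have hqj : q ≤ q ^ j := by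
    calc q = q ^ 1 := (pow_one q).symm
      _ ≤ q ^ j := Nat.pow_le_pow_right (by omega) j1
  have hle := Nat.le_of_dvd (by omega) hd3
  rcases hjn.lt_or_eq with hj | hj
  · have := Nat.pow_le_pow_right (n := q) (by omega) (show j ≤ n - 1 by omega)
    have := hn n1
    omega
  · rw [hj] at hd3 hqj
    have h4 := Nat.dvd_sub (orderOf_dvd_of_pow_eq_one hz) hd3
    rw [show q ^ n + 1 - (q ^ n - 1) = 2 by omega] at h4
    have := Nat.le_of_dvd (by omega) h4
    have := h3 n1
    omega

theorem KD.eig (D : KD F K n κ) {a c : Fˣ} {b : Kˣ} (hb : b ^ (Fintype.card F ^ n + 1) = 1) (hc : c ^ 2 ≠ 1) {v : F × F × K}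
    (hv : Xm (a, b) v = (c : F) • v) : (v.1 = 0 ∨ c = a) ∧ (v.2.1 = 0 ∨ c = a⁻¹) ∧ v.2.2 = 0 := by
  rw [Xm_apply] at hv
  have e1 : (a : F) * v.1 = c * v.1 := congrArg Prod.fst hv
  have e2 : ((a⁻¹ : Fˣ) : F) * v.2.1 = c * v.2.1 := congrArg (fun v => v.2.1) hv
  have e3 : (b : K) * v.2.2 = (c : F) • v.2.2 := congrArg (fun v => v.2.2) hv
  refine ⟨?_, ?_, ?_⟩
  · by_cases h : v.1 = 0
    · exact Or.inl h
    · exact Or.inr (Units.ext (mul_right_cancel₀ h e1).symm)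
  · by_cases h : v.2.1 = 0
    · exact Or.inl h
    · exact Or.inr (Units.ext (mul_right_cancel₀ h e2).symm)
  · by_contra h
    obtain ⟨u, hu⟩ := D.un _ h
    have hbc : ∀ x : K, (b : K) * x = (c : F) • x := by
      intro x
      calc (b : K) * x = (b * v.2.2) * ((u⁻¹ : Kˣ) * x) := by rw [← hu, mul_assoc, Units.mul_inv_cancel_left]
        _ = _ := by rw [e3, smul_mul_assoc, ← hu, Units.mul_inv_cancel_left]
    obtain ⟨w, hw⟩ := D.symp.nd' h
    have := (D.ad b).1 hb v.2.2 w
    rw [hbc, hbc] at this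
    simp only [map_smul, LinearMap.smul_apply, smul_eq_mul, hw, mul_one] at this
    apply hc; ext; rw [Units.val_pow_eq_pow_val, Units.val_one, sq]; exact this

theorem KD.cent (D : KD F K n κ) {a : Fˣ} {b : Kˣ} (hb : b ^ (Fintype.card F ^ n + 1) = 1) (ha : a ^ 2 ≠ 1)
    (hi : ∀ U : Submodule F K, (∀ u ∈ U, (b : K) * u ∈ U) → (∃ u ∈ U, u ≠ 0) → ∀ k, k ∈ U)
    {g : (F × F × K) ≃ₗ[F] (F × F × K)} (hg : g ∈ Sp (mω κ)) (hc : g * Xm (a, b) = Xm (a, b) * g) :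
    ∃ c d, d ^ (Fintype.card F ^ n + 1) = 1 ∧ g = Xm (c, d) := by
  have hcv : ∀ v, g (Xm (a, b) v) = Xm (a, b) (g v) := fun v => DFunLike.congr_fun hc v
  have haa : a ≠ a⁻¹ := by intro h; apply ha; rw [sq]; nth_rw 2 [h]; simp
  have hE := D.eig hb ha (a := a) (v := g (1, 0, 0)) (by rw [← hcv, ← map_smul]; simp [Xm_apply])
  have hF := D.eig hb (c := a⁻¹) (by simpa using ha) (a := a) (v := g (0, 1, 0)) (by rw [← hcv, ← map_smul]; simp [Xm_apply])
  have hE2 := hE.2.1.resolve_right haa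
  have hF2 := hF.1.resolve_right haa.symm
  obtain ⟨α, hα⟩ : ∃ α, g (1, 0, 0) = (α, 0, 0) := ⟨(g (1, 0, 0)).1, by ext <;> simp [hE2, hE.2.2]⟩
  obtain ⟨β, hβ⟩ : ∃ β, g (0, 1, 0) = (0, β, 0) := ⟨(g (0, 1, 0)).2.1, by ext <;> simp [hF2, hF.2.2]⟩
  have hg' := mem_Sp.1 hg
  have hab : α * β = 1 := by
    have := hg' (1, 0, 0) (0, 1, 0)
    rw [hα, hβ] at this; simpa using this
  have α0 : α ≠ 0 := left_ne_zero_of_mul_eq_one hab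
  have β0 : β ≠ 0 := right_ne_zero_of_mul_eq_one hab
  have hk : ∀ k : K, g (0, 0, k) = (0, 0, (g (0, 0, k)).2.2) := by
    intro k
    have h1 := hg' (1, 0, 0) (0, 0, k)
    have h2 := hg' (0, 1, 0) (0, 0, k)
    rw [hα] at h1
    rw [hβ] at h2
    simp [α0] at h1
    simp [β0] at h2
    ext <;> simp [h1, h2]
  have hl : ∀ k : K, (g (0, 0, k)).2.2 = k * (g (0, 0, 1)).2.2 := by
    let U : Submodule F K :=
      { carrier := {k | (g (0, 0, k)).2.2 = k * (g (0, 0, 1)).2.2}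
        zero_mem' := by
          have : g (0, 0, (0 : K)) = 0 := g.map_zero
          simp [this]
        add_mem' := fun {x y} hx hy => by
          have : g (0, 0, x + y) = g (0, 0, x) + g (0, 0, y) := by rw [← map_add]; simp
          simp only [Set.mem_setOf_eq] at *
          rw [this, add_mul, ← hx, ← hy]; rfl
        smul_mem' := fun c x hx => by
          have : g (0, 0, c • x) = c • g (0, 0, x) := by rw [← map_smul]; simp
          simp only [Set.mem_setOf_eq] at *
          rw [this, smul_mul_assoc, ← hx]; rfl }
    intro k
    by_cases h1 : (1 : K) = 0
    · have := subsingleton_of_zero_eq_one h1.symm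
      exact Subsingleton.elim _ _
    · refine hi U (fun u hu => ?_) ⟨1, by simp [U], h1⟩ k
      have := congrArg (fun v => v.2.2) (hcv (0, 0, u))
      have hu' : (g (0, 0, u)).2.2 = u * (g (0, 0, 1)).2.2 := hu
      simp only [Xm_apply, mul_zero, hu'] at this
      change (g (0, 0, b * u)).2.2 = _
      rw [this, mul_assoc]
  have hdu : IsUnit (g (0, 0, (1 : K))).2.2 := by
    by_cases h1 : (1 : K) = 0
    · have := subsingleton_of_zero_eq_one h1.symm
      exact isUnit_of_subsingleton _
    · refine D.un _ fun h2 => h1 ?_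
      have h3 := hk 1
      rw [h2] at h3
      have : ((0, 0, 1) : F × F × K) = 0 := by
        apply g.injective; rw [h3, map_zero]; rfl
      exact congrArg (fun v => v.2.2) this
  obtain ⟨d, hd⟩ := hdu
  refine ⟨Units.mk0 α α0, d, (D.ad d).2 fun u v => ?_, ?_⟩
  · have := hg' (0, 0, u) (0, 0, v)
    rw [hk u, hk v] at this
    simpa [hl u, hl v, ← hd, mul_comm] using this
  · apply LinearEquiv.ext
    intro v
    have hv : v = v.1 • (1, 0, 0) + v.2.1 • (0, 1, 0) + (0, 0, v.2.2) := by ext <;> simp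
    have hβ' : β = α⁻¹ := eq_inv_of_mul_eq_one_right hab
    conv_lhs => rw [hv, map_add, map_add, map_smul, map_smul, hα, hβ, hk, hl, ← hd]
    rw [Xm_apply]
    simp [hβ', mul_comm]

end P18

section P19
open Classical Pointwise Polynomial

theorem KD_zero (F : Type) [Field F] [Fintype F] : KD F PUnit.{1} 0 0 where
  symp := ⟨fun v => rfl, fun v _ => rfl⟩
  fin := inferInstance
  fr := by simp [Module.finrank_zero_of_subsingleton]
  un x h := (h rfl).elim
  ad d := ⟨fun _ _ _ => rfl, fun _ => Subsingleton.elim _ _⟩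
  cy := isCyclic_of_subsingleton
  cd h := by omega
  rt r _ h := le_trans (Finite.card_le_one_iff_subsingleton.2 inferInstance) h

theorem KD_pos (F : Type) [Field F] [Fintype F] (n : ℕ) (hn : 1 ≤ n) :
    ∃ (K : Type) (_ : CommRing K) (_ : Algebra F K) (κ : K →ₗ[F] K →ₗ[F] F), KD F K n κ := by
  obtain ⟨p, hp⟩ := CharP.exists F
  have : Fact p.Prime := ⟨CharP.char_is_prime F p⟩
  have : NeZero (2 * n) := ⟨by omega⟩
  let K := FiniteField.Extension F p (2 * n)
  have cK : Nat.card K = Fintype.card F ^ (2 * n) := by rw [FiniteField.natCard_extension, Nat.card_eq_fintype_card]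
  let s : K ≃ₐ[F] K := FiniteField.Extension.frob F p (2 * n) ^ n
  have hs : ∀ x, s x = x ^ (Fintype.card F ^ n) := fun x => by
    rw [← Nat.card_eq_fintype_card]; exact FiniteField.Extension.frob_iterate_apply F p (2 * n) n
  have q1 := Fintype.one_lt_card (α := F)
  set q := Fintype.card F with hq
  have qn : 1 < q ^ n := Nat.one_lt_pow (by omega) q1
  have hsq : q ^ (2 * n) - 1 = (q ^ n + 1) * (q ^ n - 1) := by
    rw [mul_comm 2 n, pow_mul]; simpa using Nat.sq_sub_sq (q ^ n) 1
  have hss : ∀ x, s (s x) = x := fun x => by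
    have := Fintype.ofFinite K
    rw [hs, hs, ← pow_mul, ← pow_add, ← two_mul, ← cK, Nat.card_eq_fintype_card]; exact FiniteField.pow_card x
  have cU : Nat.card Kˣ = q ^ (2 * n) - 1 := by rw [Nat.card_units, cK]
  obtain ⟨u0, hu0⟩ : ∃ u0, u0 - s u0 ≠ 0 := by
    by_contra hh
    push Not at hh
    obtain ⟨g, hg⟩ := IsCyclic.exists_generator (α := Kˣ)
    have h1 := orderOf_eq_card_of_forall_mem_zpowers hg
    have h2 : g ^ (q ^ n - 1) = 1 := by
      have := sub_eq_zero.1 (hh g)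
      rw [hs] at this
      have h3 : g = g ^ (q ^ n) := by ext; push_cast; exact this
      apply mul_left_cancel (a := g)
      rw [← pow_succ', Nat.sub_add_cancel (by omega), ← h3, mul_one]
    have h4 := Nat.le_of_dvd (by omega) (orderOf_dvd_of_pow_eq_one h2)
    rw [h1, cU, hsq] at h4
    have : 1 ≤ q ^ n - 1 := by omega
    nlinarith
  set γ := u0 - s u0 with hγ
  have nd : ∀ x : K, (∀ y, Algebra.trace F K (x * y) = 0) → x = 0 := fun x hx => (traceForm_nondegenerate F K).1 x hx
  have trs : ∀ x, Algebra.trace F K (s x) = Algebra.trace F K x := fun x => Algebra.trace_eq_of_algEquiv s x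
  let κ : K →ₗ[F] K →ₗ[F] F := LinearMap.mk₂ F (fun u v => Algebra.trace F K (γ * (u * s v)))
    (by intros; simp [mul_add, add_mul]) (by intros; simp) (by intros; simp [mul_add]) (by intros; simp)
  have hκ : ∀ u v, κ u v = Algebra.trace F K (γ * (u * s v)) := fun _ _ => rfl
  refine ⟨K, inferInstance, inferInstance, κ, ?_, inferInstance, FiniteField.finrank_extension F p (2 * n), fun x h => h.isUnit, fun d => ?_, inferInstance, fun _ => ?_, fun r r0 _ => ?_⟩
  · refine ⟨fun v => ?_, fun v hv => ?_⟩
    · have : γ * (v * s v) = u0 * (v * s v) - s (u0 * (v * s v)) := by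
        rw [map_mul, map_mul, hss, hγ]; ring
      rw [hκ, this, map_sub, trs, sub_self]
    · have := nd (γ * v) (fun y => by
        have := hv (s y); rwa [hκ, hss, ← mul_assoc] at this)
      exact (mul_eq_zero.1 this).resolve_left hu0
  · have h1 : d ^ (q ^ n + 1) = 1 ↔ (d : K) * s d = 1 := by
      rw [hs, ← pow_succ', Units.ext_iff]; push_cast; rfl
    rw [h1]
    constructor
    · intro h u v
      rw [hκ, hκ, map_mul s, show (d : K) * u * (s d * s v) = (d * s d) * (u * s v) by ring, h, one_mul]
    · intro h
      have := nd (γ * (d * s d - 1)) (fun y => by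
        have := h y 1
        rw [hκ, hκ, ← sub_eq_zero, ← map_sub, mul_one, map_one] at this
        rw [← this]; congr 1; ring)
      exact sub_eq_zero.1 ((mul_eq_zero.1 this).resolve_left hu0)
  · rw [IsCyclic.card_powMonoidHom_ker, cU, hsq, Nat.gcd_eq_right (Dvd.intro _ rfl)]
  · refine le_trans ?_ (card_roots' (r.map (algebraMap F K)) |>.trans_eq (natDegree_map _))
    refine le_trans ?_ (Multiset.toFinset_card_le _)
    rw [← Nat.card_eq_finsetCard]
    refine Nat.card_le_card_of_injective (fun d => ⟨d.1.1, ?_⟩) (fun d d' h => ?_)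
    · rw [Multiset.mem_toFinset, mem_roots (map_ne_zero r0), IsRoot, eval_map_algebraMap]; exact d.2.2
    · simpa [Subtype.ext_iff, Units.ext_iff] using h

theorem KD_ex (F : Type) [Field F] [Fintype F] (n : ℕ) :
    ∃ (K : Type) (_ : CommRing K) (_ : Algebra F K) (κ : K →ₗ[F] K →ₗ[F] F), KD F K n κ := by
  rcases Nat.eq_zero_or_pos n with rfl | h
  · exact ⟨_, _, _, _, KD_zero F⟩
  · exact KD_pos F n h

end P19

section P20
open Classical Pointwise
variable {F K : Type} [Field F] [CommRing K] [Algebra F K] [Fintype F] {n : ℕ} {κ : K →ₗ[F] K →ₗ[F] F}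

theorem KD.neg (D : KD F K n κ) (h2 : (2 : F) = 0) {χ : F → ℤ} (hχ : Chi χ) [Fintype K] {z : Kˣ} (hz : z ^ (Fintype.card F ^ n + 1) = 1) (h3 : 3 ≤ orderOf z) :
    ∃ Q, QF κ Q ∧ (∀ v, Q (z * v) = Q v) ∧ ga χ Q < 0 := by
  let g : K ≃ₗ[F] K := DistribMulAction.toLinearEquiv F K z
  have hg : ∀ v, g v = z * v := fun v => rfl
  obtain ⟨Q, hQ, hQg⟩ := form_exists h2 D.symp D.fr (g := g) ((D.ad z).1 hz) (by
    intro x hx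
    by_contra h0
    obtain ⟨u, rfl⟩ := D.un x h0
    have : z * u = u := by ext; exact hx
    rw [mul_eq_right] at this
    rw [this, orderOf_one] at h3; omega)
  refine ⟨Q, hQ, hQg, ?_⟩
  have hc : (Fintype.card K : ℤ) = ((Fintype.card F : ℤ) ^ n) ^ 2 := by
    rw [Module.card_eq_pow_finrank (K := F), D.fr, mul_comm 2 n, pow_mul]; push_cast; rfl
  have hsq := ga_sq h2 D.symp hχ hQ
  rw [hc, sq_eq_sq_iff_eq_or_eq_neg] at hsq
  have q1 := Fintype.card_pos (α := F)
  set q := Fintype.card F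
  have qp : (0 : ℤ) < (q : ℤ) ^ n := by positivity
  rcases hsq with hp | hp
  swap
  · omega
  exfalso
  have Q0 : Q 0 = 0 := by simpa using hQ.sm 0 0
  have hd : ∀ t : ℤ, (orderOf z : ℤ) ∣ (Finset.univ.filter (fun k => k ≠ 0 ∧ χ (Q k) = t)).card := fun t => by
    have := D.dvd (Subgroup.zpowers z) {k | k ≠ 0 ∧ χ (Q k) = t} (by simp) (by
      intro w hw s hs
      obtain ⟨i, rfl⟩ := (mem_powers_iff_mem_zpowers (x := z)).2 hw
      refine ⟨fun h0 => hs.1 (by rwa [Units.mul_right_eq_zero] at h0), ?_⟩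
      rw [← hs.2]; congr 1
      clear hw
      induction i with
      | zero => simp
      | succ i ih =>
        change Q (((z ^ (i + 1) : Kˣ) : K) * s) = _
        rw [pow_succ', Units.val_mul, mul_assoc]; exact (hQg _).trans ih)
    rw [Nat.card_zpowers, Nat.card_eq_fintype_card, Fintype.card_ofFinset] at this
    exact_mod_cast this
  have hga : ga χ Q = 1 + ((Finset.univ.filter (fun k => k ≠ 0 ∧ χ (Q k) = 1)).card : ℤ) - ((Finset.univ.filter (fun k => k ≠ 0 ∧ χ (Q k) = -1)).card : ℤ) := by
    have : ∀ k, χ (Q k) = (if k = 0 then 1 else 0) + (if k ≠ 0 ∧ χ (Q k) = 1 then 1 else 0) - (if k ≠ 0 ∧ χ (Q k) = -1 then 1 else 0) := by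
      intro k
      by_cases h : k = 0
      · simp [h, Q0, hχ.zero]
      · rcases hχ.pm (Q k) with h' | h' <;> simp [h, h']
    rw [ga, Finset.sum_congr rfl (fun k _ => this k), Finset.sum_sub_distrib, Finset.sum_add_distrib, Finset.sum_boole, Finset.sum_boole, Finset.sum_boole]
    have : (Finset.univ.filter (fun k : K => k = 0)).card = 1 := Finset.card_eq_one.2 ⟨0, by ext; simp⟩
    simp [this]
  have d1 : (orderOf z : ℤ) ∣ (q : ℤ) ^ n - 1 := by
    rw [← hp, hga, show ∀ x y : ℤ, 1 + x - y - 1 = x - y by intros; ring]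
    exact dvd_sub (hd _) (hd _)
  have d2 : (orderOf z : ℤ) ∣ (q : ℤ) ^ n + 1 := by exact_mod_cast orderOf_dvd_of_pow_eq_one hz
  have d3 := dvd_sub d2 d1
  rw [show (q : ℤ) ^ n + 1 - (q ^ n - 1) = 2 by ring] at d3
  have := Int.le_of_dvd (by norm_num) d3
  omega

theorem KD.form (D : KD F K n κ) (h2 : (2 : F) = 0) {χ : F → ℤ} (hχ : Chi χ) [Fintype K] {Q : K → F} (hQ : QF κ Q) (hn : ga χ Q < 0) :
    QF (mω κ) (fun v => v.1 * v.2.1 + Q v.2.2) ∧ ga χ (fun v : F × F × K => v.1 * v.2.1 + Q v.2.2) < 0 := by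
  refine ⟨⟨fun c v => ?_, fun u v => ?_⟩, ?_⟩
  · simp [hQ.sm]; ring
  · simp [hQ.ad]; linear_combination (v.1 * u.2.1) * h2
  · have h0 : ∀ α : F, ∑ β, χ (α * β) = if α = 0 then (Fintype.card F : ℤ) else 0 := by
      intro α
      split_ifs with h
      · simp [h, hχ.zero]
      · rw [← hχ.sum0]; exact Equiv.sum_comp (Equiv.mulLeft₀ α h) χ
    have : ga χ (fun v : F × F × K => v.1 * v.2.1 + Q v.2.2) = Fintype.card F * ga χ Q := by
      simp only [ga, hχ.ad, Fintype.sum_prod_type, ← Finset.mul_sum, ← Finset.sum_mul, h0]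
      simp
    rw [this]
    have := Fintype.card_pos (α := F)
    have : (0 : ℤ) < Fintype.card F := by exact_mod_cast this
    nlinarith

theorem KD.gen [Fintype K] [Fintype ((F × F × K) ≃ₗ[F] (F × F × K))] (D : KD F K n κ) {a : Fˣ} {b : Kˣ} (hb : b ^ (Fintype.card F ^ n + 1) = 1) {H : Subgroup ((F × F × K) ≃ₗ[F] (F × F × K))}
    (hH : H ≤ Sp (mω κ)) (ht : Xm (a, b) ∈ H)
    (n1 : 8 * (n + 1) * (Fintype.card F ^ (n + 1) + 1) < orderOf (a ^ 2) * (orderOf (a ^ 2) - 5) * orderOf (b ^ (Fintype.card F - 1)))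
    (n2 : 8 * (Fintype.card F + 1) < orderOf (a ^ 2) * (orderOf (a ^ 2) - 5))
    (h3 : 1 ≤ n → 3 ≤ orderOf (b ^ (Fintype.card F - 1))) (h4 : 1 ≤ n → Fintype.card F ^ (n - 1) < orderOf (b ^ (Fintype.card F - 1)))
    {χ : F → ℤ} (hχ : (2 : F) = 0 → Chi χ) {y : (F × F × K) ≃ₗ[F] (F × F × K)} (hy : y ∈ H) (Y : Yc (mω κ) χ (n + 1) y) : Sp (mω κ) ≤ H := by
  set q := Fintype.card F with hq
  set z := b ^ (q - 1) with hzd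
  have hz : z ^ (q ^ n + 1) = 1 := by rw [hzd, ← pow_mul, mul_comm, pow_mul, hb, one_pow]
  have HA : Subgroup.zpowers (a ^ 2) ≤ H.comap (Xm.comp (MonoidHom.inl Fˣ Kˣ)) := by
    rw [Subgroup.zpowers_le, Subgroup.mem_comap]
    have := H.pow_mem ht (q ^ n + 1)
    rw [← map_pow, Prod.pow_mk, hb, pow_succ] at this
    have h1 : a ^ q ^ n = a := by ext; push_cast; exact FiniteField.pow_card_pow _ _
    rw [h1, ← sq] at this
    exact this
  have HB : Subgroup.zpowers z ≤ H.comap (Xm.comp (MonoidHom.inr Fˣ Kˣ)) := by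
    rw [Subgroup.zpowers_le, Subgroup.mem_comap]
    have := H.pow_mem ht (q - 1)
    rw [← map_pow, Prod.pow_mk] at this
    have h1 : a ^ (q - 1) = 1 := by ext; push_cast; exact FiniteField.pow_card_sub_one_eq_one _ a.ne_zero
    rw [h1] at this
    exact this
  let A : Finset F := (Units.val '' (Subgroup.zpowers (a ^ 2) : Set Fˣ)).toFinset
  let B : Finset ((F × F × K) ≃ₗ[F] (F × F × K)) := ((fun d : Kˣ => Xm ((1 : Fˣ), d)) '' (Subgroup.zpowers z : Set Kˣ)).toFinset
  have hA : ∀ x, x ∈ A ↔ ∃ u ∈ Subgroup.zpowers (a ^ 2), (u : F) = x := fun x => by simp [A]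
  have hB : ∀ x, x ∈ B ↔ ∃ u ∈ Subgroup.zpowers z, Xm ((1 : Fˣ), u) = x := fun x => by simp only [B, Set.mem_toFinset]; rfl
  have cA : A.card = orderOf (a ^ 2) := by
    rw [← Nat.card_zpowers, ← Set.ncard_eq_toFinset_card', Set.ncard_image_of_injective _ Units.val_injective]; rfl
  have cB : B.card = orderOf z := by
    rw [← Nat.card_zpowers, ← Set.ncard_eq_toFinset_card', Set.ncard_image_of_injective]
    · rfl
    · intro d d' h
      have := congrArg (fun v => v.2.2) (DFunLike.congr_fun h ((0 : F), (0 : F), (1 : K)))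
      simp only [Xm_apply, mul_one] at this
      ext; exact this
  have hp : ∀ k : F × F × K, mω κ (1, 0, 0) k = 0 → mω κ (0, 1, 0) k = 0 → k = (0, 0, k.2.2) := by
    intro k h1 h2
    simp at h1 h2
    ext <;> simp [h1, h2]
  have hXk : ∀ (u : Kˣ) (k : K), Xm ((1 : Fˣ), u) (0, 0, k) = (0, 0, u * k) := fun u k => by simp [Xm_apply]
  have n0 : ∀ k : K, k ≠ 0 → 1 ≤ n := by
    intro k k0
    by_contra h
    have h0 : Module.finrank F K = 0 := by rw [D.fr]; omega
    have := Module.finrank_zero_iff.1 h0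
    exact k0 (Subsingleton.elim _ _)
  have G : GD (mω κ) H (1, 0, 0) (0, 1, 0) A B (n + 1) :=
    { hH := hH
      ef := by simp
      A0 := by rw [hA]; rintro ⟨u, _, h⟩; exact u.ne_zero h
      A1 := (hA _).2 ⟨1, one_mem _, rfl⟩
      Am := fun x hx y hy => by
        obtain ⟨u, hu, rfl⟩ := (hA _).1 hx
        obtain ⟨v, hv, rfl⟩ := (hA _).1 hy
        exact (hA _).2 ⟨_, mul_mem hu hv, by simp⟩
      Ai := fun x hx => by
        obtain ⟨u, hu, rfl⟩ := (hA _).1 hx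
        exact (hA _).2 ⟨_, inv_mem hu, by simp⟩
      tor := fun x hx => by
        obtain ⟨u, hu, rfl⟩ := (hA _).1 hx
        refine ⟨_, HA hu, fun v => ?_⟩
        change Xm (u, 1) v = _
        rw [Xm_apply]
        ext <;> simp <;> ring
      B1 := fun x hx => by
        obtain ⟨u, hu, rfl⟩ := (hB _).1 hx
        refine ⟨HB hu, ?_, ?_⟩ <;> simp [Xm_apply]
      Bf := fun x hx y hy k h1 h2 k0 hk => by
        obtain ⟨u, hu, rfl⟩ := (hB _).1 hx
        obtain ⟨v, hv, rfl⟩ := (hB _).1 hy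
        have e := hp k h1 h2
        have k1 : k.2.2 ≠ 0 := fun h => k0 (by rw [e, h]; rfl)
        rw [e, hXk, hXk] at hk
        obtain ⟨w, hw⟩ := D.un _ k1
        have hk : (u : K) * k.2.2 = v * k.2.2 := congrArg (fun v => v.2.2) hk
        rw [← hw, Units.mul_left_inj] at hk
        rw [Units.ext hk]
      Bi := fun U h1 h2 h3' k hk hk' => by
        obtain ⟨u, hu, u0⟩ := h3'
        have e := hp u (h1 u hu).1 (h1 u hu).2
        have u1 : u.2.2 ≠ 0 := fun h => u0 (by rw [e, h]; rfl)
        have := D.irr hz h3 h4 (U.comap (LinearMap.inr F F (F × K) ∘ₗ LinearMap.inr F F K)) (fun x hx => by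
          have := h2 _ ((hB _).2 ⟨z, Subgroup.mem_zpowers z, rfl⟩) _ hx
          change Xm ((1 : Fˣ), z) (0, 0, x) ∈ U at this
          rwa [hXk] at this) ⟨u.2.2, by rw [e] at hu; exact hu, u1⟩ k.2.2
        rw [hp k hk hk']; exact this
      n1 := by rw [cA, cB]; exact n1
      n2 := by rw [cA]; exact n2
      n3 := by
        rintro ⟨k, hk, k0⟩
        have e := hp k hk.1 hk.2
        have := h3 (n0 k.2.2 fun h => k0 (by rw [e, h]; rfl))
        omega }
  have fr : Module.finrank F (F × F × K) = 2 * (n + 1) := by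
    rw [Module.finrank_prod, Module.finrank_prod, D.fr, Module.finrank_self]; ring
  refine G.gen (mω_symp D.symp) fr (by omega) hy Y (fun h2 hm => ?_)
  obtain ⟨Q, hQ, hQz, hQn⟩ := D.neg h2 (hχ h2) hz (h3 (by omega))
  obtain ⟨f1, f2⟩ := D.form h2 (hχ h2) hQ hQn
  have Q0 : Q 0 = 0 := by simpa using hQ.sm 0 0
  refine ⟨_, f1, fun x hx v => ?_, by simp [Q0], by simp [Q0], f2⟩
  obtain ⟨u, hu, rfl⟩ := (hB _).1 hx
  obtain ⟨i, rfl⟩ := (mem_powers_iff_mem_zpowers (x := z)).2 hu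
  simp only [Xm_apply, inv_one, Units.val_one, one_mul]
  congr 1
  clear hx hu
  induction i with
  | zero => simp
  | succ i ih =>
    change Q (((z ^ (i + 1) : Kˣ) : K) * _) = _
    rw [pow_succ', Units.val_mul, mul_assoc]; exact (hQz _).trans ih

end P20

section P21
open Classical

theorem divisor_bound (k : ℕ) (hk : 1 ≤ k) : ∃ C, 1 ≤ C ∧ ∀ N : ℕ, N ≠ 0 → N.divisors.card ^ k ≤ C * N := by
  have k1 : 1 ≤ k ^ k := Nat.one_le_pow _ _ hk
  refine ⟨(k ^ k) ^ (2 ^ k), Nat.one_le_pow _ _ k1, fun N hN => ?_⟩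
  have b1 : ∀ e, (e + 1) ^ k ≤ k ^ k * 2 ^ e := fun e => by
    have h1 : e + 1 ≤ k * (e / k + 1) := by
      have := Nat.lt_mul_div_succ e (show 0 < k by omega); omega
    have h2 : e / k + 1 ≤ 2 ^ (e / k) := Nat.lt_two_pow_self
    calc (e + 1) ^ k ≤ (k * 2 ^ (e / k)) ^ k := Nat.pow_le_pow_left (h1.trans (Nat.mul_le_mul_left _ h2)) _
      _ = k ^ k * 2 ^ (e / k * k) := by rw [mul_pow, ← pow_mul]
      _ ≤ _ := Nat.mul_le_mul_left _ (Nat.pow_le_pow_right (by norm_num) (Nat.div_mul_le_self _ _))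
  have b2 : ∀ p ∈ N.primeFactors, (N.factorization p + 1) ^ k ≤ (if p < 2 ^ k then k ^ k else 1) * p ^ N.factorization p := by
    intro p hp
    have p2 := (Nat.prime_of_mem_primeFactors hp).two_le
    split_ifs with h
    · exact (b1 _).trans (Nat.mul_le_mul_left _ (Nat.pow_le_pow_left p2 _))
    · calc (N.factorization p + 1) ^ k ≤ (2 ^ N.factorization p) ^ k := Nat.pow_le_pow_left Nat.lt_two_pow_self _
        _ = (2 ^ k) ^ N.factorization p := by rw [← pow_mul, ← pow_mul, mul_comm]
        _ ≤ _ := by rw [one_mul]; exact Nat.pow_le_pow_left (by omega) _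
  rw [Nat.card_divisors hN, ← Finset.prod_pow]
  refine (Finset.prod_le_prod' b2).trans ?_
  rw [Finset.prod_mul_distrib]
  have e1 : ∏ p ∈ N.primeFactors, p ^ N.factorization p = N := Nat.prod_factorization_pow_eq_self hN
  rw [e1]
  refine Nat.mul_le_mul_right _ ?_
  rw [Finset.prod_ite, Finset.prod_const, Finset.prod_const_one, mul_one]
  refine Nat.pow_le_pow_right k1 ?_
  calc _ ≤ (Finset.range (2 ^ k)).card := Finset.card_le_card (fun p hp => by simp at hp ⊢; exact hp.2)
    _ = _ := by simp

def Dq (n q : ℕ) : ℕ := 8 * (q - 1).divisors.card + 8 * (q ^ n + 1).divisors.card + 1000 * (n + 1)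

theorem Dq_bound (n : ℕ) : ∃ q0, ∀ q, 2 ≤ q → q0 ≤ q → Dq n q ^ 4 ≤ q := by
  obtain ⟨C1, c1, h1⟩ := divisor_bound 5 (by norm_num)
  obtain ⟨C2, c2, h2⟩ : ∃ C, 1 ≤ C ∧ ∀ q, 2 ≤ q → (q ^ n + 1).divisors.card ^ 5 ≤ C * q := by
    rcases Nat.eq_zero_or_pos n with rfl | hn
    · refine ⟨32, by norm_num, fun q hq => ?_⟩
      have : (q ^ 0 + 1).divisors.card = 2 := by simp; decide
      rw [this]; omega
    · obtain ⟨C, c, h⟩ := divisor_bound (5 * n) (by omega)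
      refine ⟨2 * C, by omega, fun q hq => ?_⟩
      have := h (q ^ n + 1) (by omega)
      rw [pow_mul] at this
      refine (Nat.pow_le_pow_iff_left (n := n) (by omega)).1 (this.trans ?_)
      have q1 : 1 ≤ q ^ n := Nat.one_le_pow _ _ (by omega)
      have : 2 * C ≤ (2 * C) ^ n := Nat.le_self_pow (by omega) _
      rw [mul_pow]
      nlinarith
  set E := 1016 + 1000 * n
  refine ⟨(E ^ 5 * (C1 + C2)) ^ 4, fun q hq hq0 => ?_⟩
  obtain ⟨x, hx, hD⟩ : ∃ x, x ^ 5 ≤ (C1 + C2) * q ∧ Dq n q ≤ E * x := by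
    have a1 : 1 ≤ (q - 1).divisors.card := Finset.card_pos.2 ⟨1, by simp; omega⟩
    have a2 := h1 (q - 1) (by omega)
    have a3 := h2 q hq
    have a4 : C1 * (q - 1) ≤ C1 * q := Nat.mul_le_mul_left _ (by omega)
    rcases le_total (q - 1).divisors.card (q ^ n + 1).divisors.card with h | h
    · refine ⟨_, a3.trans (by nlinarith), ?_⟩
      have : 1 ≤ (q ^ n + 1).divisors.card := by omega
      simp only [Dq, E]; nlinarith
    · refine ⟨_, a2.trans (by nlinarith), ?_⟩
      simp only [Dq, E]; nlinarith
  refine (Nat.pow_le_pow_iff_left (n := 5) (by omega)).1 ?_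
  calc (Dq n q ^ 4) ^ 5 ≤ ((E * x) ^ 4) ^ 5 := by gcongr
    _ = (E ^ 5 * x ^ 5) ^ 4 := by ring
    _ ≤ (E ^ 5 * ((C1 + C2) * q)) ^ 4 := by gcongr
    _ = (E ^ 5 * (C1 + C2)) ^ 4 * q ^ 4 := by ring
    _ ≤ q * q ^ 4 := by gcongr
    _ = q ^ 5 := by ring

theorem num {q n r s D : ℕ} (hD : 1000 * (n + 1) ≤ D) (hq : D ^ 4 ≤ q) (hr : q ≤ 2 * r * D) (hs : q ^ n + 1 ≤ 2 * s * D) :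
    8 * (n + 1) * (q ^ (n + 1) + 1) < r * (r - 5) * s ∧ 8 * (q + 1) < r * (r - 5) ∧ 3 ≤ r ∧ (1 ≤ n → 3 ≤ s ∧ q ^ (n - 1) < s) := by
  have D1 : 1000 ≤ D := by omega
  have D3 : D ^ 3 ≤ 2 * r := by
    have : D ^ 3 * D ≤ 2 * r * D := by rw [← pow_succ]; exact hq.trans hr
    exact Nat.le_of_mul_le_mul_right this (by omega)
  have D2 : 1000 * D ≤ D ^ 2 := by nlinarith
  have D33 : 1000 * D ^ 2 ≤ D ^ 3 := by nlinarith
  have D44 : D ^ 4 = D * D ^ 3 := by ring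
  have hq3 : 1000 * (n + 1) * D ^ 3 ≤ q := (by rw [D44] at hq; exact (Nat.mul_le_mul_right _ hD).trans hq)
  have r10 : 10 ≤ r := by omega
  have hrr : r * r ≤ 2 * (r * (r - 5)) := by
    obtain ⟨t, rfl⟩ := Nat.exists_eq_add_of_le r10
    simp only [show 10 + t - 5 = 5 + t by omega]; nlinarith
  have key : q * q ≤ 8 * D ^ 2 * (r * (r - 5)) := by
    calc q * q ≤ (2 * r * D) * (2 * r * D) := Nat.mul_le_mul hr hr
      _ = 4 * D ^ 2 * (r * r) := by ring
      _ ≤ 4 * D ^ 2 * (2 * (r * (r - 5))) := Nat.mul_le_mul_left _ hrr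
      _ = _ := by ring
  set R := r * (r - 5)
  have q1 : 1 ≤ q := by nlinarith
  refine ⟨?_, ?_, by omega, fun hn => ?_⟩
  · have k2 : q * q * (q ^ n + 1) ≤ 8 * D ^ 2 * R * (2 * s * D) := Nat.mul_le_mul key hs
    have k3 : 16 * D ^ 3 * (8 * (n + 1) * (q ^ (n + 1) + 1)) < 16 * D ^ 3 * (R * s) := by
      calc 16 * D ^ 3 * (8 * (n + 1) * (q ^ (n + 1) + 1)) ≤ (128 * (n + 1) * D ^ 3) * (2 * q ^ (n + 1)) := by
            have : 1 ≤ q ^ (n + 1) := Nat.one_le_pow _ _ q1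
            calc _ = (128 * (n + 1) * D ^ 3) * (q ^ (n + 1) + 1) := by ring
              _ ≤ _ := Nat.mul_le_mul_left _ (by omega)
        _ = (256 * (n + 1) * D ^ 3) * q ^ (n + 1) := by ring
        _ ≤ q * q ^ (n + 1) := Nat.mul_le_mul_right _ (by nlinarith)
        _ = q * q * q ^ n := by ring
        _ < q * q * (q ^ n + 1) := by
            have : 0 < q * q := by positivity
            nlinarith
        _ ≤ 8 * D ^ 2 * R * (2 * s * D) := k2
        _ = _ := by ring
    exact Nat.lt_of_mul_lt_mul_left k3
  · have : 1000 * D ^ 2 ≤ q := by nlinarith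
    by_contra h
    have h5 : q * q ≤ 8 * D ^ 2 * (8 * (q + 1)) := key.trans (Nat.mul_le_mul_left _ (by omega))
    have h6 : 8 * D ^ 2 * (8 * (q + 1)) ≤ 128 * D ^ 2 * q := by nlinarith
    have : 128 * D ^ 2 * q < q * q := Nat.mul_lt_mul_of_pos_right (by nlinarith) q1
    omega
  · obtain ⟨n, rfl⟩ : ∃ k, n = k + 1 := ⟨n - 1, by omega⟩
    simp only [Nat.add_sub_cancel]
    have p1 : 1 ≤ q ^ n := Nat.one_le_pow _ _ q1
    have h1 : 2 * D * (q ^ n * 3) < 2 * D * s := by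
      calc 2 * D * (q ^ n * 3) = (6 * D) * q ^ n := by ring
        _ ≤ q * q ^ n := Nat.mul_le_mul_right _ (by nlinarith)
        _ = q ^ (n + 1) := by ring
        _ < 2 * s * D := hs
        _ = _ := by ring
    have := Nat.lt_of_mul_lt_mul_left h1
    omega

theorem cyc_count {C : Type} [Group C] [IsCyclic C] [Fintype C] {D : ℕ} (hD : 8 * (Fintype.card C).divisors.card ≤ D) :
    7 * Fintype.card C ≤ 8 * (Finset.univ.filter (fun x : C => Fintype.card C < orderOf x * D)).card := by
  set N := Fintype.card C
  have N0 : N ≠ 0 := Fintype.card_ne_zero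
  have t0 : 0 < N.divisors.card := Finset.card_pos.2 ⟨1, by simp [N0]⟩
  have h1 : (Finset.univ.filter (fun x : C => ¬ N < orderOf x * D)).card * D ≤ N.divisors.card * N := by
    have h2 : (Finset.univ.filter (fun x : C => ¬ N < orderOf x * D)).card = ∑ d ∈ N.divisors.filter (fun d => d * D ≤ N), (Finset.univ.filter (fun x : C => orderOf x = d)).card := by
      rw [Finset.card_eq_sum_card_fiberwise (f := orderOf) (t := N.divisors.filter (fun d => d * D ≤ N))]
      · refine Finset.sum_congr rfl fun d hd => congrArg _ ?_
        ext x
        simp only [Finset.mem_filter, Finset.mem_univ, true_and, not_lt] at hd ⊢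
        exact ⟨fun h => h.2, fun h => ⟨by rw [h]; exact hd.2, h⟩⟩
      · intro x hx
        simp at hx
        simp [N0, hx, N, orderOf_dvd_card]
    rw [h2, Finset.sum_mul]
    refine (Finset.sum_le_card_nsmul _ _ N fun d hd => ?_).trans ?_
    · simp at hd
      rw [IsCyclic.card_orderOf_eq_totient hd.1.1]
      exact (Nat.mul_le_mul_right _ (Nat.totient_le d)).trans hd.2
    · exact Nat.mul_le_mul_right _ (Finset.card_filter_le _ _)
  have h3 := Finset.card_filter_add_card_filter_not (s := (Finset.univ : Finset C)) (fun x : C => N < orderOf x * D)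
  rw [Finset.card_univ] at h3
  set bad := (Finset.univ.filter (fun x : C => ¬ N < orderOf x * D)).card
  have h4 : N.divisors.card * (8 * bad) ≤ N.divisors.card * N := by nlinarith
  have := Nat.le_of_mul_le_mul_left h4 t0
  omega

end P21

section P22
open Classical Pointwise Polynomial
variable {F K : Type} [Field F] [CommRing K] [Algebra F K] [Fintype F] {n : ℕ} {κ : K →ₗ[F] K →ₗ[F] F}

def Gd (n : ℕ) (p : Fˣ × Kˣ) : Prop := p.2 ^ (Fintype.card F ^ n + 1) = 1 ∧ Fintype.card Fˣ < orderOf p.1 * Dq n (Fintype.card F) ∧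
  Nat.card (powMonoidHom (α := Kˣ) (Fintype.card F ^ n + 1)).ker < orderOf p.2 * Dq n (Fintype.card F)

theorem ord_half {G : Type} [Group G] [Finite G] (x : G) {k : ℕ} (h : Nat.gcd (orderOf x) k ≤ 2) : orderOf x ≤ 2 * orderOf (x ^ k) := by
  rw [orderOf_pow]
  calc orderOf x = Nat.gcd (orderOf x) k * (orderOf x / Nat.gcd (orderOf x) k) := (Nat.mul_div_cancel' (Nat.gcd_dvd_left _ _)).symm
    _ ≤ _ := Nat.mul_le_mul_right _ h

theorem KD.num (D : KD F K n κ) (hq : Dq n (Fintype.card F) ^ 4 ≤ Fintype.card F) {p : Fˣ × Kˣ} (hp : Gd n p) :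
    8 * (n + 1) * (Fintype.card F ^ (n + 1) + 1) < orderOf (p.1 ^ 2) * (orderOf (p.1 ^ 2) - 5) * orderOf (p.2 ^ (Fintype.card F - 1)) ∧
    8 * (Fintype.card F + 1) < orderOf (p.1 ^ 2) * (orderOf (p.1 ^ 2) - 5) ∧ 3 ≤ orderOf (p.1 ^ 2) ∧
    (1 ≤ n → 3 ≤ orderOf (p.2 ^ (Fintype.card F - 1)) ∧ Fintype.card F ^ (n - 1) < orderOf (p.2 ^ (Fintype.card F - 1))) := by
  have := D.fin
  obtain ⟨h1, h2, h3⟩ := hp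
  have q1 := Fintype.one_lt_card (α := F)
  have cu : Fintype.card Fˣ = Fintype.card F - 1 := Fintype.card_units F
  have hD : 1000 * (n + 1) ≤ Dq n (Fintype.card F) := by simp [Dq]
  have cd := D.cd
  set q := Fintype.card F
  refine _root_.num hD hq ?_ ?_
  · have := ord_half p.1 (k := 2) (Nat.le_of_dvd (by norm_num) (Nat.gcd_dvd_right _ _))
    have h4 := Nat.mul_le_mul_right (Dq n q) this
    omega
  · have hg : Nat.gcd (orderOf p.2) (q - 1) ∣ 2 := by
      have d1 := (Nat.gcd_dvd_left (orderOf p.2) (q - 1)).trans (orderOf_dvd_of_pow_eq_one h1)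
      have d2 := (Nat.gcd_dvd_right (orderOf p.2) (q - 1)).trans (Nat.sub_one_dvd_pow_sub_one q n)
      have p1 : 1 ≤ q ^ n := Nat.one_le_pow _ _ (by omega)
      have := Nat.dvd_sub d1 d2
      rwa [show q ^ n + 1 - (q ^ n - 1) = 2 by omega] at this
    have := ord_half p.2 (k := q - 1) (Nat.le_of_dvd (by norm_num) hg)
    have h4 := Nat.mul_le_mul_right (Dq n q) this
    rcases Nat.eq_zero_or_pos n with h0 | h0
    · have o1 : 1 ≤ orderOf (p.2 ^ (q - 1)) := orderOf_pos _
      rw [h0] at hD ⊢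
      simp only [pow_zero]
      nlinarith
    · rw [cd h0] at h3; omega

theorem KD.irr' (D : KD F K n κ) (hq : Dq n (Fintype.card F) ^ 4 ≤ Fintype.card F) {p : Fˣ × Kˣ} (hp : Gd n p) :
    ∀ U : Submodule F K, (∀ u ∈ U, (p.2 : K) * u ∈ U) → (∃ u ∈ U, u ≠ 0) → ∀ k, k ∈ U := by
  have := D.fin
  obtain ⟨_, _, _, h4⟩ := D.num hq hp
  have := Nat.le_of_dvd (orderOf_pos p.2) (orderOf_pow_dvd (x := p.2) (Fintype.card F - 1))
  exact D.irr hp.1 (fun h => by have := h4 h; omega) (fun h => by have := h4 h; omega)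

variable [Fintype K]

theorem KD.good_count (D : KD F K n κ) :
    (Finset.univ.filter (fun p : Fˣ × Kˣ => p.2 ^ (Fintype.card F ^ n + 1) = 1)).card ≤ 2 * (Finset.univ.filter (fun p : Fˣ × Kˣ => Gd n p)).card := by
  have := D.cy
  let NN := (powMonoidHom (α := Kˣ) (Fintype.card F ^ n + 1)).ker
  have hNN : ∀ x : Kˣ, x ∈ NN ↔ x ^ (Fintype.card F ^ n + 1) = 1 := fun x => Iff.rfl
  have c1 := cyc_count (C := Fˣ) (D := Dq n (Fintype.card F)) (by rw [Fintype.card_units]; simp only [Dq]; omega)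
  have c2 := cyc_count (C := NN) (D := Dq n (Fintype.card F)) (by
    rw [← Nat.card_eq_fintype_card]
    rcases Nat.eq_zero_or_pos n with h0 | h0
    · have h1 : Module.finrank F K = 0 := by rw [D.fr]; omega
      have := Module.finrank_zero_iff.1 h1
      have : Nat.card NN = 1 := Nat.card_unique
      rw [this]; simp only [Dq, Nat.divisors_one, Finset.card_singleton]; omega
    · rw [D.cd h0]; simp only [Dq]; omega)
  have e1 : (Finset.univ.filter (fun p : Fˣ × Kˣ => p.2 ^ (Fintype.card F ^ n + 1) = 1)).card ≤ Fintype.card Fˣ * Fintype.card NN := by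
    rw [← Fintype.card_prod, ← Fintype.card_subtype]
    exact Fintype.card_le_of_injective (fun p => (p.1.1, ⟨p.1.2, p.2⟩)) (fun p p' h => by
      simp only [Prod.mk.injEq, Subtype.mk.injEq] at h; exact Subtype.ext (Prod.ext h.1 (congrArg Subtype.val h.2)))
  have e2 : (Finset.univ.filter (fun x : Fˣ => Fintype.card Fˣ < orderOf x * Dq n (Fintype.card F))).card *
      (Finset.univ.filter (fun x : NN => Fintype.card NN < orderOf x * Dq n (Fintype.card F))).card ≤ (Finset.univ.filter (fun p : Fˣ × Kˣ => Gd n p)).card := by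
    rw [← Finset.card_product]
    refine Finset.card_le_card_of_injOn (fun p => (p.1, p.2.1)) (fun p hp => ?_) (fun p _ p' _ h => ?_)
    · simp only [Finset.coe_product, Set.mem_prod, Finset.mem_coe, Finset.mem_filter, Finset.mem_univ, true_and] at hp ⊢
      refine ⟨p.2.2, hp.1, ?_⟩
      have := hp.2
      rw [← Nat.card_eq_fintype_card, ← Subgroup.orderOf_coe] at this; exact this
    · simp only [Prod.mk.injEq] at h; exact Prod.ext h.1 (Subtype.ext h.2)
  nlinarith

theorem Xm_aeval (p : Fˣ × Kˣ) (r : F[X]) : aeval (Xm p : (F × F × K) ≃ₗ[F] (F × F × K)).toLinearMap r (0, 0, 1) = (0, 0, aeval (p.2 : K) r) := by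
  have hp : ∀ i : ℕ, ((Xm p : (F × F × K) ≃ₗ[F] (F × F × K)).toLinearMap ^ i) (0, 0, 1) = (0, 0, (p.2 : K) ^ i) := by
    intro i
    induction i with
    | zero => simp
    | succ i ih => rw [pow_succ', Module.End.mul_apply, ih, pow_succ']; simp [Xm_apply]
  induction r using Polynomial.induction_on' with
  | add r s hr hs => rw [map_add, LinearMap.add_apply, hr, hs, map_add]; simp
  | monomial i c => rw [aeval_monomial, aeval_monomial, Module.End.mul_apply, hp, Module.algebraMap_end_apply]; simp [Algebra.smul_def]

theorem KD.conj (D : KD F K n κ) {p p0 : Fˣ × Kˣ} (hp : p.2 ^ (Fintype.card F ^ n + 1) = 1) (h0 : p0.1 ^ 2 ≠ 1) {h : (F × F × K) ≃ₗ[F] (F × F × K)}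
    (hh : Xm p = h * Xm p0 * h⁻¹) : (p.1 = p0.1 ∨ p.1 = p0.1⁻¹) ∧ aeval (p.2 : K) (Xm p0 : (F × F × K) ≃ₗ[F] (F × F × K)).toLinearMap.charpoly = 0 := by
  have hh' : Xm p * h = h * Xm p0 := by rw [hh, inv_mul_cancel_right]
  constructor
  · have hv : Xm (p.1, p.2) (h (1, 0, 0)) = (p0.1 : F) • h (1, 0, 0) := by
      have := DFunLike.congr_fun hh' ((1 : F), (0 : F), (0 : K))
      simp only [LinearEquiv.mul_apply] at this
      rw [Prod.mk.eta, this, ← map_smul]; simp [Xm_apply]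
    obtain ⟨e1, e2, e3⟩ := D.eig hp h0 hv
    rcases e1 with e1 | e1
    · rcases e2 with e2 | e2
      · have : h (1, 0, 0) = 0 := by ext <;> simp [e1, e2, e3]
        rw [LinearEquiv.map_eq_zero_iff] at this
        simp at this
      · right; rw [e2, inv_inv]
    · left; exact e1.symm
  · have hc : (Xm p : (F × F × K) ≃ₗ[F] (F × F × K)).toLinearMap.charpoly = (Xm p0 : (F × F × K) ≃ₗ[F] (F × F × K)).toLinearMap.charpoly := by
      rw [← LinearEquiv.charpoly_conj h (Xm p0).toLinearMap, hh]; rfl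
    have := LinearMap.aeval_self_charpoly (Xm p : (F × F × K) ≃ₗ[F] (F × F × K)).toLinearMap
    rw [hc] at this
    have h1 := Xm_aeval p (Xm p0 : (F × F × K) ≃ₗ[F] (F × F × K)).toLinearMap.charpoly
    rw [this] at h1
    exact (congrArg (fun v => v.2.2) h1).symm

variable [Fintype ((F × F × K) ≃ₗ[F] (F × F × K))]

def XX (n : ℕ) (κ : K →ₗ[F] K →ₗ[F] F) (x : (F × F × K) ≃ₗ[F] (F × F × K)) : Prop := ∃ g ∈ Sp (mω κ), ∃ p, Gd n p ∧ x = g * Xm p * g⁻¹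

theorem KD.X_count (D : KD F K n κ) (hq : Dq n (Fintype.card F) ^ 4 ≤ Fintype.card F) :
    cG (Sp (mω κ)) ≤ 8 * (n + 1) * (Finset.univ.filter (XX n κ)).card := by
  have fr : Module.finrank F (F × F × K) = 2 * (n + 1) := by
    rw [Module.finrank_prod, Module.finrank_prod, D.fr, Module.finrank_self]; ring
  have gc := D.good_count
  set T := (Finset.univ.filter (fun p : Fˣ × Kˣ => p.2 ^ (Fintype.card F ^ n + 1) = 1)) with hT
  set Gs := (Finset.univ.filter (fun p : Fˣ × Kˣ => Gd n p)) with hGs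
  have T0 : 0 < T.card := Finset.card_pos.2 ⟨1, by simp [hT]⟩
  have a2 : ∀ p : Fˣ × Kˣ, Gd n p → p.1 ^ 2 ≠ 1 := fun p hp h => by
    have := (D.num hq hp).2.2.1; rw [h, orderOf_one] at this; omega
  have key : cG (Sp (mω κ)) * Gs.card ≤ (T.card * (2 * (2 * (n + 1)))) * (Finset.univ.filter (XX n κ)).card := by
    rw [← Finset.card_product]
    refine Finset.card_le_mul_card_image_of_maps_to (f := fun gp => gp.1 * Xm gp.2 * gp.1⁻¹) (fun gp h => ?_) _ (fun x hx => ?_)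
    · simp only [hGs, Finset.mem_product, Finset.mem_filter, Finset.mem_univ, true_and] at h ⊢
      exact ⟨_, h.1, _, h.2, rfl⟩
    · obtain ⟨g0, hg0, p0, hp0, rfl⟩ := (Finset.mem_filter.1 hx).2
      set c := (Xm p0 : (F × F × K) ≃ₗ[F] (F × F × K)).toLinearMap.charpoly with hc
      have cdg : c.natDegree = 2 * (n + 1) := by rw [hc, LinearMap.charpoly_natDegree, fr]
      let S : Finset Kˣ := Finset.univ.filter (fun d => d ^ (Fintype.card F ^ n + 1) = 1 ∧ aeval (d : K) c = 0)
      have hS : S.card ≤ 2 * (n + 1) := by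
        have := D.rt c (LinearMap.charpoly_monic _).ne_zero (by omega)
        rwa [Nat.card_eq_fintype_card, Fintype.card_subtype, cdg] at this
      have hP : (({p0.1, p0.1⁻¹} : Finset Fˣ) ×ˢ S).card ≤ 2 * (2 * (n + 1)) := by
        rw [Finset.card_product]; exact Nat.mul_le_mul Finset.card_le_two hS
      refine le_trans (Finset.card_le_mul_card_image_of_maps_to (f := Prod.snd) (t := ({p0.1, p0.1⁻¹} : Finset Fˣ) ×ˢ S) (fun gp h => ?_) T.card (fun p _ => ?_)) (Nat.mul_le_mul_left _ hP)
      · simp only [hGs, Finset.mem_product, Finset.mem_filter, Finset.mem_univ, true_and] at h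
        have := D.conj h.1.2.1 (a2 _ hp0) (p := gp.2) (h := gp.1⁻¹ * g0) (by have := congrArg (fun z => gp.1⁻¹ * z * gp.1) h.2; simpa [mul_assoc] using this)
        simp only [Finset.mem_product, Finset.mem_insert, Finset.mem_singleton, S, Finset.mem_filter, Finset.mem_univ, true_and]
        exact ⟨this.1, h.1.2.1, this.2⟩
      · rcases Finset.eq_empty_or_nonempty (Finset.filter (fun gp => gp.2 = p) (Finset.filter (fun gp : ((F × F × K) ≃ₗ[F] (F × F × K)) × (Fˣ × Kˣ) => gp.1 * Xm gp.2 * gp.1⁻¹ = g0 * Xm p0 * g0⁻¹)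
          ((Finset.univ.filter (fun g => g ∈ Sp (mω κ))) ×ˢ Gs))) with h | ⟨⟨g1, p1⟩, h⟩
        · refine (Finset.card_eq_zero.2 ?_).le.trans (Nat.zero_le _)
          refine Eq.trans ?_ h
          congr!
        · simp only [hGs, Finset.mem_product, Finset.mem_filter, Finset.mem_univ, true_and] at h
          obtain ⟨⟨⟨m1, m2⟩, m3⟩, rfl⟩ := h
          refine le_trans (Finset.card_le_card (t := T.image (fun t => (g1 * Xm t, p1))) (fun gp h => ?_)) Finset.card_image_le
          simp only [hGs, Finset.mem_product, Finset.mem_filter, Finset.mem_univ, true_and] at h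
          obtain ⟨⟨⟨k1, k2⟩, k3⟩, k4⟩ := h
          rw [k4, ← m3] at k3
          have hcm : (g1⁻¹ * gp.1) * Xm (p1.1, p1.2) = Xm (p1.1, p1.2) * (g1⁻¹ * gp.1) := by
            have := congrArg (fun z => g1⁻¹ * z * gp.1) k3
            simpa [mul_assoc] using this
          obtain ⟨u, d, hd, e⟩ := D.cent m2.1 (a2 _ m2) (D.irr' hq m2) (mul_mem (inv_mem m1) k1) hcm
          refine Finset.mem_image.2 ⟨(u, d), by simp [hT, hd], ?_⟩
          rw [← e, mul_inv_cancel_left, ← k4]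
  have G0 : 0 < Gs.card := by omega
  refine Nat.le_of_mul_le_mul_right (key.trans ?_) G0
  calc _ = 4 * (n + 1) * (Finset.univ.filter (XX n κ)).card * T.card := by ring
    _ ≤ 4 * (n + 1) * (Finset.univ.filter (XX n κ)).card * (2 * Gs.card) := Nat.mul_le_mul_left _ gc
    _ = _ := by ring

end P22

section P23
open Classical Pointwise

theorem Yc.conj {F V : Type} [Field F] [AddCommGroup V] [Module F V] {ω : V →ₗ[F] V →ₗ[F] F} [Fintype F] [Fintype V] [Fintype (V ≃ₗ[F] V)]
    {χ : F → ℤ} {m : ℕ} {g k : V ≃ₗ[F] V} (Y : Yc ω χ m g) (hk : k ∈ Sp ω) : Yc ω χ m (k * g * k⁻¹) := by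
  have hinv : ∀ v, k⁻¹ (k v) = v := fun v => k.symm_apply_apply v
  have hc : ∀ v, (k * g * k⁻¹) (k v) = k (g v) := fun v => by simp only [LinearEquiv.mul_apply, hinv]
  refine ⟨fun v v0 a h => ?_, fun hm U ⟨e, f, hef, hU⟩ hs => ?_, ?_, fun hm h2 ⟨Q, hQ, hQg, hs⟩ => ?_⟩
  · obtain ⟨w, rfl⟩ := k.surjective v
    rw [hc, ← map_smul] at h
    exact Y.eig w (by rintro rfl; simp at v0) a (k.injective h)
  · refine Y.pl hm (U.comap k.toLinearMap) ⟨k⁻¹ e, k⁻¹ f, by rw [mem_Sp.1 (inv_mem hk), hef], ?_⟩ (fun v hv => ?_)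
    · rw [hU]
      have : Submodule.span F {e, f} = (Submodule.span F {k⁻¹ e, k⁻¹ f}).map k.toLinearMap := by
        rw [Submodule.map_span, Set.image_pair]; simp
      rw [this, Submodule.comap_map_eq_of_injective k.injective]
    · have := hs (k v) hv
      rw [hc] at this; exact this
  · have : (k * g * k⁻¹).toLinearMap = k.conj g.toLinearMap := rfl
    rw [this, LinearMap.trace_conj']; exact Y.tr
  · refine Y.fm hm h2 ⟨fun v => Q (k v), ⟨fun c v => by rw [map_smul, hQ.sm], fun u v => by rw [map_add, hQ.ad, mem_Sp.1 hk]⟩, fun v => ?_, ?_⟩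
    · exact (congrArg Q (hc v)).symm.trans (hQg _)
    · have : ga χ (fun v => Q (k v)) = ga χ Q := Equiv.sum_comp k.toEquiv (fun v => χ (Q v))
      rw [this]; exact hs

theorem ex_chi (F : Type) [Field F] [Fintype F] : ∃ χ : F → ℤ, (2 : F) = 0 → Chi χ := by
  by_cases h : (2 : F) = 0
  · obtain ⟨p, hp⟩ := CharP.exists F
    have hp' := CharP.char_is_prime F p
    have : p ∣ 2 := (CharP.cast_eq_zero_iff F p 2).1 (by exact_mod_cast h)
    have := (Nat.prime_dvd_prime_iff_eq hp' Nat.prime_two).1 this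
    subst this
    obtain ⟨χ, hχ⟩ := exists_chi (F := F)
    exact ⟨χ, fun _ => hχ⟩
  · exact ⟨0, fun h' => (h h').elim⟩

theorem main_count {F : Type} [Field F] [Fintype F] (n : ℕ) (hq : Dq n (Fintype.card F) ^ 4 ≤ Fintype.card F) (h100 : 100 ≤ Fintype.card F) :
    ∃ X Y : ℕ, Nat.card (Matrix.symplecticGroup (Fin (n + 1)) F) ≤ 8 * (n + 1) * X ∧
      (1 / 6 - (50 * (n + 1 : ℕ)) / Fintype.card F : ℝ) * Nat.card (Matrix.symplecticGroup (Fin (n + 1)) F) ≤ Y ∧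
      X * Y ≤ Nat.card {p : Matrix.symplecticGroup (Fin (n + 1)) F × Matrix.symplecticGroup (Fin (n + 1)) F // InvGen p.1 p.2} := by
  obtain ⟨K, _, _, κ, D⟩ := KD_ex F n
  have := D.fin
  have := Fintype.ofFinite K
  have : Finite ((F × F × K) ≃ₗ[F] (F × F × K)) := DFunLike.finite _
  have := Fintype.ofFinite ((F × F × K) ≃ₗ[F] (F × F × K))
  have := Fintype.ofFinite (Submodule F (F × F × K))
  have fr : Module.finrank F (F × F × K) = 2 * (n + 1) := by
    rw [Module.finrank_prod, Module.finrank_prod, D.fr, Module.finrank_self]; ring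
  obtain ⟨χ, hχ⟩ := ex_chi F
  have S := mω_symp D.symp
  obtain ⟨Φ⟩ := Sp_model (n + 1) S fr
  have cG1 : Nat.card (Matrix.symplecticGroup (Fin (n + 1)) F) = cG (Sp (mω κ)) := by
    rw [Nat.card_congr Φ.toEquiv, Nat.card_eq_fintype_card]; exact Fintype.card_subtype _
  refine ⟨_, _, by rw [cG1]; exact D.X_count hq, by rw [cG1]; exact Y_count S fr (by omega) hχ h100, ?_⟩
  have XS : ∀ x, XX n κ x → x ∈ Sp (mω κ) := by
    rintro _ ⟨g, hg, p, hp, rfl⟩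
    exact mul_mem (mul_mem hg (Xm_mem D p.1 hp.1)) (inv_mem hg)
  rw [cP, ← Fintype.card_subtype, ← Fintype.card_subtype, ← Fintype.card_prod, ← Nat.card_eq_fintype_card]
  have key : ∀ x y : Matrix.symplecticGroup (Fin (n + 1)) F, XX n κ (Φ x) → Yc (mω κ) χ (n + 1) (Φ y) → InvGen x y := by
    rintro x y ⟨k, hk, p, hp, hx⟩ hy g h
    obtain ⟨n1, n2, _, n4⟩ := D.num hq hp
    set C := Subgroup.closure {g * x * g⁻¹, h * y * h⁻¹} with hC
    let ι := (Sp (mω κ)).subtype.comp Φ.toMonoidHom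
    have hι : ∀ z, ι z = (Φ z : (F × F × K) ≃ₗ[F] (F × F × K)) := fun _ => rfl
    set l : (F × F × K) ≃ₗ[F] (F × F × K) := ι g * k with hl
    have ls : l ∈ Sp (mω κ) := mul_mem (Φ g).2 hk
    let H := C.map ((MulAut.conj l⁻¹).toMonoidHom.comp ι)
    have hH : ∀ z, z ∈ C → l⁻¹ * ι z * l ∈ H := fun z hz => ⟨z, hz, by simp [MulAut.conj_apply]⟩
    have hgen : Sp (mω κ) ≤ H := by
      refine D.gen hp.1 (a := p.1) ?_ ?_ n1 n2 (fun h => (n4 h).1) (fun h => (n4 h).2) hχ (hH _ (Subgroup.subset_closure (by right; rfl))) ?_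
      · rintro _ ⟨z, hz, rfl⟩
        simp only [MonoidHom.comp_apply, MulEquiv.coe_toMonoidHom, MulAut.conj_apply, inv_inv]
        exact mul_mem (mul_mem (inv_mem ls) (Φ z).2) ls
      · have := hH _ (Subgroup.subset_closure (Set.mem_insert _ _))
        rw [map_mul, map_mul, map_inv, hι x, hx, hl] at this
        convert this using 1
        simp [mul_assoc]
      · have := hy.conj (k := l⁻¹ * ι h) (mul_mem (inv_mem ls) (Φ h).2)
        convert this using 1
        rw [map_mul, map_mul, map_inv, hι y]
        simp [mul_assoc]
    rw [eq_top_iff]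
    intro w _
    obtain ⟨z, hz, e⟩ := hgen (mul_mem (mul_mem (inv_mem ls) (Φ w).2) ls)
    simp only [MonoidHom.comp_apply, MulEquiv.coe_toMonoidHom, MulAut.conj_apply, inv_inv, mul_left_inj, mul_right_inj] at e
    have : z = w := Φ.injective (Subtype.ext e)
    rw [← this]; exact hz
  refine Nat.card_le_card_of_injective (fun xy => ⟨(Φ.symm ⟨xy.1.1, XS _ xy.1.2⟩, Φ.symm ⟨xy.2.1, xy.2.2.1⟩), key _ _ (by simpa using xy.1.2) (by simpa using xy.2.2.2)⟩) (fun a b h => ?_)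
  simp only [Subtype.mk.injEq, Prod.mk.injEq, EmbeddingLike.apply_eq_iff_eq] at h
  exact Prod.ext (Subtype.ext h.1) (Subtype.ext h.2)

end P23

theorem stmt_9 :
    ∃ c : ℝ, 0 < c ∧
      ∀ m : ℕ, 1 ≤ m →
        ∃ C : ℝ, 0 < C ∧
          ∀ (F : Type) [Field F] [Fintype F],
            (Nat.card {p : Matrix.symplecticGroup (Fin m) F ×
                Matrix.symplecticGroup (Fin m) F // InvGen p.1 p.2} : ℝ) ≥
              (c / m - C / Fintype.card F) *
                (Nat.card (Matrix.symplecticGroup (Fin m) F) : ℝ) ^ 2 := by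
  refine ⟨1 / 48, by norm_num, fun m hm => ?_⟩
  obtain ⟨n, rfl⟩ : ∃ n, m = n + 1 := ⟨m - 1, by omega⟩
  obtain ⟨q0, hq0⟩ := Dq_bound n
  refine ⟨q0 + 107, by positivity, fun F _ _ => ?_⟩
  have q2 := Fintype.one_lt_card (α := F)
  have qp : (0 : ℝ) < Fintype.card F := by exact_mod_cast Fintype.card_pos
  have mp : (1 : ℝ) ≤ ((n + 1 : ℕ) : ℝ) := by exact_mod_cast hm
  by_cases hq : q0 + 100 ≤ Fintype.card F
  · obtain ⟨X, Y, h1, h2, h3⟩ := main_count (F := F) n (hq0 _ q2 (by omega)) (by omega)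
    set N := Nat.card (Matrix.symplecticGroup (Fin (n + 1)) F)
    have h1' : (N : ℝ) ≤ 8 * ((n + 1 : ℕ) : ℝ) * X := by exact_mod_cast h1
    refine le_trans ?_ (Nat.cast_le.2 h3)
    rw [Nat.cast_mul]
    set M := ((n + 1 : ℕ) : ℝ)
    have X1 : (N : ℝ) / (8 * M) ≤ X := by rw [div_le_iff₀ (by positivity)]; linarith
    have e1 : (1 / 48 / M - (q0 + 107) / Fintype.card F : ℝ) * (N : ℝ) ^ 2 ≤ (N / (8 * M)) * ((1 / 6 - (50 * M) / Fintype.card F) * N) := by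
      have : (N : ℝ) / (8 * M) * ((1 / 6 - (50 * M) / Fintype.card F) * N) = (1 / 48 / M - (25 / 4) / Fintype.card F) * (N : ℝ) ^ 2 := by
        field_simp; ring
      rw [this]
      gcongr
      have : (0 : ℝ) ≤ q0 := by positivity
      linarith
    refine e1.trans ?_
    calc (N : ℝ) / (8 * M) * ((1 / 6 - (50 * M) / Fintype.card F) * N) ≤ N / (8 * M) * Y := by gcongr
      _ ≤ X * Y := by gcongr
  · push Not at hq
    have hq' : (Fintype.card F : ℝ) ≤ q0 + 100 := by exact_mod_cast hq.le
    have e1 : (1 : ℝ) / 48 / ((n + 1 : ℕ) : ℝ) ≤ 1 := by rw [div_le_one (by positivity)]; linarith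
    have e2 : (1 : ℝ) ≤ (q0 + 107) / Fintype.card F := by rw [le_div_iff₀ qp]; linarith
    refine le_trans (mul_nonpos_of_nonpos_of_nonneg (by linarith) (by positivity)) (by positivity)
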